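/- Let A be a compact homologically smooth DG algebra concentrated in non-positive degrees. Then HH_n(A) = 0 for all n ≠ 0, i.e., the Hochschild homology of A is concentrated in degree 0. -/

import Mathlib

/- Framework: differential graded algebras (internal ℤ-grading), right DG modules,
DG bimodules, homotopy-theoretic notions (twisted modules, perfectness,
homological smoothness), cohomology and Hochschild homology. -/

open DirectSum TensorProduct

noncomputable section
set_option linter.unusedVariables false

/-- `(-1)^i` for `i : ℤ`, valued in `ℤ`. -/
def sgnz (i : ℤ) : ℤ := if Even i then 1 else -1

/-- `(-1)^i` for `i : ℤ`, valued in a field `k`. -/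
def sgnk (k : Type) [Field k] (i : ℤ) : k := if Even i then 1 else -1

/-- A differential graded algebra over a field `k`: a `k`-algebra with an internal
ℤ-grading and a square-zero degree `+1` differential satisfying the graded Leibniz rule. -/
structure DGAlgebra (k : Type) [Field k] : Type 1 where
  R : Type
  [ring : Ring R]
  [alg : Algebra k R]
  gr : ℤ → Submodule k R
  [dec : DirectSum.Decomposition gr]
  one_mem : (1 : R) ∈ gr 0
  mul_mem : ∀ {i j : ℤ} {x y : R}, x ∈ gr i → y ∈ gr j → x * y ∈ gr (i + j)
  d : R →ₗ[k] R
  d_deg : ∀ (i : ℤ), ∀ x ∈ gr i, d x ∈ gr (i + 1)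
  d_sq : ∀ x : R, d (d x) = 0
  leibniz : ∀ (i : ℤ), ∀ x ∈ gr i, ∀ y : R,
    d (x * y) = d x * y + sgnz i • (x * d y)

attribute [instance] DGAlgebra.ring DGAlgebra.alg DGAlgebra.dec

variable {k : Type} [Field k]

/-- A right DG module over a DG algebra `A`.  The right action of `x : A` on `m`
is written `act x m` (representing `m · x`). -/
structure DGMod (A : DGAlgebra k) : Type 1 where
  M : Type
  [acg : AddCommGroup M]
  [kmod : Module k M]
  gm : ℤ → Submodule k M
  [dec : DirectSum.Decomposition gm]
  act : A.R →ₗ[k] M →ₗ[k] M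
  act_one : ∀ m : M, act 1 m = m
  act_mul : ∀ (x y : A.R) (m : M), act (x * y) m = act y (act x m)
  act_deg : ∀ (i j : ℤ) (x : A.R) (m : M), x ∈ A.gr i → m ∈ gm j → act x m ∈ gm (j + i)
  D : M →ₗ[k] M
  D_deg : ∀ (j : ℤ), ∀ m ∈ gm j, D m ∈ gm (j + 1)
  D_sq : ∀ m : M, D (D m) = 0
  leibniz : ∀ (i j : ℤ) (x : A.R) (m : M), x ∈ A.gr i → m ∈ gm j →
    D (act x m) = act x (D m) + sgnz j • act (A.d x) m

attribute [instance] DGMod.acg DGMod.kmod DGMod.dec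

variable {A : DGAlgebra k}

/-- Morphisms of right DG modules (closed, degree 0). -/
structure DGHom (X Y : DGMod A) where
  f : X.M →ₗ[k] Y.M
  deg : ∀ (j : ℤ), ∀ m ∈ X.gm j, f m ∈ Y.gm j
  actc : ∀ (x : A.R) (m : X.M), f (X.act x m) = Y.act x (f m)
  comm : ∀ m : X.M, f (X.D m) = Y.D (f m)

/-- The identity morphism. -/
def DGHom.id (X : DGMod A) : DGHom X X :=
  ⟨LinearMap.id, fun _ _ h => h, fun _ _ => rfl, fun _ => rfl⟩

/-- Composition of morphisms of DG modules. -/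
def DGHom.comp {X Y Z : DGMod A} (G : DGHom Y Z) (F : DGHom X Y) : DGHom X Z :=
  ⟨G.f ∘ₗ F.f, fun j m h => G.deg j _ (F.deg j m h),
    fun x m => by simp [LinearMap.comp_apply, F.actc, G.actc],
    fun m => by simp [LinearMap.comp_apply, F.comm, G.comm]⟩

/-- The zero morphism. -/
def DGHom.zero (X Y : DGMod A) : DGHom X Y :=
  ⟨0, fun j _ _ => (Y.gm j).zero_mem, fun _ _ => by simp, fun _ => by simp⟩

/-- Chain homotopy between two morphisms of DG modules. -/
def Homotopic {X Y : DGMod A} (F G : DGHom X Y) : Prop :=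
  ∃ h : X.M →ₗ[k] Y.M,
    (∀ (j : ℤ), ∀ m ∈ X.gm j, h m ∈ Y.gm (j - 1)) ∧
    (∀ (x : A.R) (m : X.M), h (X.act x m) = Y.act x (h m)) ∧
    ∀ m : X.M, F.f m - G.f m = Y.D (h m) + h (X.D m)

/-- Cycles of degree `n` of a complex given by a grading and a differential. -/
def Zg {M : Type} [AddCommGroup M] [Module k M]
    (gm : ℤ → Submodule k M) (Dm : M →ₗ[k] M) (n : ℤ) : Submodule k M :=
  gm n ⊓ LinearMap.ker Dm

/-- Boundaries of degree `n`. -/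
def Bg {M : Type} [AddCommGroup M] [Module k M]
    (gm : ℤ → Submodule k M) (Dm : M →ₗ[k] M) (n : ℤ) : Submodule k M :=
  gm n ⊓ LinearMap.range Dm

/-- Degree `n` cohomology of a complex. -/
def Hg {M : Type} [AddCommGroup M] [Module k M]
    (gm : ℤ → Submodule k M) (Dm : M →ₗ[k] M) (n : ℤ) : Type :=
  ↥(Zg gm Dm n) ⧸ (Submodule.comap (Zg gm Dm n).subtype (Bg gm Dm n))

instance {M : Type} [AddCommGroup M] [Module k M]
    (gm : ℤ → Submodule k M) (Dm : M →ₗ[k] M) (n : ℤ) : AddCommGroup (Hg gm Dm n) := by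
  unfold Hg; infer_instance

instance {M : Type} [AddCommGroup M] [Module k M]
    (gm : ℤ → Submodule k M) (Dm : M →ₗ[k] M) (n : ℤ) : Module k (Hg gm Dm n) := by
  unfold Hg; infer_instance

/-- `f` induces an isomorphism on the homology of two complexes presented by
(families of) cycle and boundary submodules. -/
def InducesHIso {M₁ M₂ : Type} [AddCommGroup M₁] [Module k M₁] [AddCommGroup M₂] [Module k M₂]
    (Z₁ B₁ : ℤ → Submodule k M₁) (Z₂ B₂ : ℤ → Submodule k M₂) (f : M₁ →ₗ[k] M₂) : Prop :=
  (∀ n : ℤ, ∀ x ∈ Z₁ n, f x ∈ Z₂ n) ∧ (∀ n : ℤ, ∀ x ∈ B₁ n, f x ∈ B₂ n) ∧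
  ∀ n : ℤ, (∀ z ∈ Z₂ n, ∃ w ∈ Z₁ n, f w - z ∈ B₂ n) ∧
    (∀ w ∈ Z₁ n, f w ∈ B₂ n → w ∈ B₁ n)

/-- Quasi-isomorphism of complexes, in elementary terms. -/
def QIsoData {M₁ M₂ : Type} [AddCommGroup M₁] [Module k M₁] [AddCommGroup M₂] [Module k M₂]
    (gm₁ : ℤ → Submodule k M₁) (D₁ : M₁ →ₗ[k] M₁)
    (gm₂ : ℤ → Submodule k M₂) (D₂ : M₂ →ₗ[k] M₂) (f : M₁ →ₗ[k] M₂) : Prop :=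
  InducesHIso (Zg gm₁ D₁) (Bg gm₁ D₁) (Zg gm₂ D₂) (Bg gm₂ D₂) f

/-- A morphism of DG modules is a quasi-isomorphism if it induces isomorphisms on
all cohomology groups. -/
def IsQuasiIso {X Y : DGMod A} (F : DGHom X Y) : Prop :=
  QIsoData X.gm X.D Y.gm Y.D F.f

/-- A DG module is acyclic if all its cohomology vanishes. -/
def AcyclicM (X : DGMod A) : Prop := ∀ n : ℤ, Zg X.gm X.D n ≤ Bg X.gm X.D n

/-- The `A`-submodule of a right DG module generated by a set. -/
def rSpan (X : DGMod A) (S : Set X.M) : Submodule k X.M :=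
  sInf {p : Submodule k X.M | S ⊆ ↑p ∧ ∀ (x : A.R) (m : X.M), m ∈ p → X.act x m ∈ p}

/-- Twisted modules: finitely generated semi-free right DG `A`-modules, i.e.
modules with a finite homogeneous basis `e` such that `D (e j)` lies in the
`A`-span of the previous basis elements ("strictly upper triangular" twisting). -/
def IsTwisted (T : DGMod A) : Prop :=
  ∃ (s : ℕ) (r : Fin s → ℤ) (e : Fin s → T.M),
    (∀ j, e j ∈ T.gm (-(r j))) ∧
    (∀ j, T.D (e j) ∈ rSpan T (e '' {i | i < j})) ∧
    Function.Bijective (fun v : Fin s → A.R => ∑ j, T.act (v j) (e j))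

/-- `P` is a homotopy direct summand of `T`. -/
def IsHoSummand (P T : DGMod A) : Prop :=
  ∃ (ι : DGHom P T) (ρ : DGHom T P), Homotopic (ρ.comp ι) (DGHom.id P)

/-- A perfect DG module: one admitting a resolution by a homotopy direct summand
of a twisted module. -/
def IsPerfect (N : DGMod A) : Prop :=
  ∃ T P : DGMod A, IsTwisted T ∧ IsHoSummand P T ∧ ∃ F : DGHom P N, IsQuasiIso F

/-- Homotopically projective (K-projective) DG modules. -/
def IsHoProjM (P : DGMod A) : Prop :=
  ∀ N : DGMod A, AcyclicM N → ∀ F : DGHom P N, Homotopic F (DGHom.zero P N)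

/-- Compactness of a DG algebra: the total cohomology is finite dimensional. -/
def IsCompactAlg (A : DGAlgebra k) : Prop :=
  (∀ n : ℤ, FiniteDimensional k (Hg A.gr A.d n)) ∧
    {n : ℤ | ¬ Subsingleton (Hg A.gr A.d n)}.Finite
/-- The grading operator on a graded module scaling the degree `j` component by `c j`. -/
def gop {M : Type} [AddCommGroup M] [Module k M]
    (gm : ℤ → Submodule k M) [DirectSum.Decomposition gm] (c : ℤ → k) : M →ₗ[k] M :=
  (DirectSum.toModule k ℤ M (fun j => c j • (gm j).subtype)) ∘ₗ
    (DirectSum.decomposeLinearEquiv gm).toLinearMap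

/-- A DG bimodule over `A` (equivalently, a right DG module over `Aᵉ = Aᵒᵖ ⊗ A`). -/
structure DGBimod (A : DGAlgebra k) : Type 1 where
  M : Type
  [acg : AddCommGroup M]
  [kmod : Module k M]
  gm : ℤ → Submodule k M
  [dec : DirectSum.Decomposition gm]
  actL : A.R →ₗ[k] M →ₗ[k] M
  actR : A.R →ₗ[k] M →ₗ[k] M
  actL_one : ∀ m : M, actL 1 m = m
  actR_one : ∀ m : M, actR 1 m = m
  actL_mul : ∀ (x y : A.R) (m : M), actL (x * y) m = actL x (actL y m)
  actR_mul : ∀ (x y : A.R) (m : M), actR (x * y) m = actR y (actR x m)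
  actLR : ∀ (x y : A.R) (m : M), actL x (actR y m) = actR y (actL x m)
  actL_deg : ∀ (i j : ℤ) (x : A.R) (m : M), x ∈ A.gr i → m ∈ gm j → actL x m ∈ gm (i + j)
  actR_deg : ∀ (i j : ℤ) (x : A.R) (m : M), x ∈ A.gr i → m ∈ gm j → actR x m ∈ gm (j + i)
  D : M →ₗ[k] M
  D_deg : ∀ (j : ℤ), ∀ m ∈ gm j, D m ∈ gm (j + 1)
  D_sq : ∀ m : M, D (D m) = 0
  leibnizL : ∀ (i j : ℤ) (x : A.R) (m : M), x ∈ A.gr i → m ∈ gm j →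
    D (actL x m) = actL (A.d x) m + sgnz i • actL x (D m)
  leibnizR : ∀ (i j : ℤ) (x : A.R) (m : M), x ∈ A.gr i → m ∈ gm j →
    D (actR x m) = actR x (D m) + sgnz j • actR (A.d x) m

attribute [instance] DGBimod.acg DGBimod.kmod DGBimod.dec

/-- Morphisms of DG bimodules (closed, degree 0). -/
structure BimodHom {A : DGAlgebra k} (X Y : DGBimod A) where
  f : X.M →ₗ[k] Y.M
  deg : ∀ (j : ℤ), ∀ m ∈ X.gm j, f m ∈ Y.gm j
  actLc : ∀ (x : A.R) (m : X.M), f (X.actL x m) = Y.actL x (f m)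
  actRc : ∀ (x : A.R) (m : X.M), f (X.actR x m) = Y.actR x (f m)
  comm : ∀ m : X.M, f (X.D m) = Y.D (f m)

def BimodHom.id (X : DGBimod A) : BimodHom X X :=
  ⟨LinearMap.id, fun _ _ h => h, fun _ _ => rfl, fun _ _ => rfl, fun _ => rfl⟩

def BimodHom.comp {X Y Z : DGBimod A} (G : BimodHom Y Z) (F : BimodHom X Y) : BimodHom X Z :=
  ⟨G.f ∘ₗ F.f, fun j m h => G.deg j _ (F.deg j m h),
    fun x m => by simp [LinearMap.comp_apply, F.actLc, G.actLc],
    fun x m => by simp [LinearMap.comp_apply, F.actRc, G.actRc],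
    fun m => by simp [LinearMap.comp_apply, F.comm, G.comm]⟩

def BimodHom.zero (X Y : DGBimod A) : BimodHom X Y :=
  ⟨0, fun j _ _ => (Y.gm j).zero_mem, fun _ _ => by simp, fun _ _ => by simp, fun _ => by simp⟩

/-- Chain homotopy between morphisms of DG bimodules (with the Koszul sign for the
left action). -/
def BimodHomotopic {X Y : DGBimod A} (F G : BimodHom X Y) : Prop :=
  ∃ h : X.M →ₗ[k] Y.M,
    (∀ (j : ℤ), ∀ m ∈ X.gm j, h m ∈ Y.gm (j - 1)) ∧
    (∀ (i : ℤ) (x : A.R), x ∈ A.gr i → ∀ m : X.M, h (X.actL x m) = sgnz i • Y.actL x (h m)) ∧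
    (∀ (x : A.R) (m : X.M), h (X.actR x m) = Y.actR x (h m)) ∧
    ∀ m : X.M, F.f m - G.f m = Y.D (h m) + h (X.D m)

def AcyclicB (X : DGBimod A) : Prop := ∀ n : ℤ, Zg X.gm X.D n ≤ Bg X.gm X.D n

def IsHoProjB (P : DGBimod A) : Prop :=
  ∀ N : DGBimod A, AcyclicB N → ∀ F : BimodHom P N, BimodHomotopic F (BimodHom.zero P N)

/-- Auxiliary: the action of a homogeneous element of degree `i` in the first tensor
factor of `Aᵉ` on a bimodule, with its Koszul sign. -/
def biactAux (N : DGBimod A) (i : ℤ) : ↥(A.gr i) →ₗ[k] A.R →ₗ[k] N.M →ₗ[k] N.M where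
  toFun x :=
    { toFun := fun y => (N.actL ↑x) ∘ₗ (N.actR y) ∘ₗ (gop N.gm fun j => sgnk k (i * j))
      map_add' := by intro y z; ext m; simp
      map_smul' := by intro c y; ext m; simp }
  map_add' := by intro x z; ext y m; simp [Submodule.coe_add]
  map_smul' := by intro c x; ext y m; simp

/-- The right action of `Aᵉ = Aᵒᵖ ⊗ A` (as a `k`-module, `A.R ⊗[k] A.R`) on a DG
bimodule, with Koszul signs. -/
def biact (N : DGBimod A) : (A.R ⊗[k] A.R) →ₗ[k] N.M →ₗ[k] N.M :=
  TensorProduct.lift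
    ((DirectSum.toModule k ℤ _ (fun i => biactAux N i)) ∘ₗ
      (DirectSum.decomposeLinearEquiv A.gr).toLinearMap)

/-- The sub-bimodule generated by a set. -/
def biSpan (N : DGBimod A) (S : Set N.M) : Submodule k N.M :=
  sInf {p : Submodule k N.M | S ⊆ ↑p ∧ (∀ (x : A.R) (m : N.M), m ∈ p → N.actL x m ∈ p) ∧
    ∀ (x : A.R) (m : N.M), m ∈ p → N.actR x m ∈ p}

/-- Twisted DG bimodules: finitely generated semi-free DG `Aᵉ`-modules. -/
def IsTwistedB (T : DGBimod A) : Prop :=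
  ∃ (s : ℕ) (r : Fin s → ℤ) (e : Fin s → T.M),
    (∀ j, e j ∈ T.gm (-(r j))) ∧
    (∀ j, T.D (e j) ∈ biSpan T (e '' {i | i < j})) ∧
    Function.Bijective (fun v : Fin s → A.R ⊗[k] A.R => ∑ j, biact T (v j) (e j))

def IsHoSummandB (P T : DGBimod A) : Prop :=
  ∃ (ι : BimodHom P T) (ρ : BimodHom T P), BimodHomotopic (ρ.comp ι) (BimodHom.id P)

def IsPerfectB (N : DGBimod A) : Prop :=
  ∃ T P : DGBimod A, IsTwistedB T ∧ IsHoSummandB P T ∧ ∃ F : BimodHom P N, QIsoData P.gm P.D N.gm N.D F.f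

/-- The diagonal bimodule: `A` as a DG bimodule over itself. -/
def diagBimod (A : DGAlgebra k) : DGBimod A where
  M := A.R
  gm := A.gr
  actL := LinearMap.mul k A.R
  actR := (LinearMap.mul k A.R).flip
  actL_one := fun m => one_mul m
  actR_one := fun m => mul_one m
  actL_mul := fun x y m => mul_assoc x y m
  actR_mul := fun x y m => (mul_assoc m x y).symm
  actLR := fun x y m => (mul_assoc x m y).symm
  actL_deg := fun i j x m hx hm => A.mul_mem hx hm
  actR_deg := fun i j x m hx hm => A.mul_mem hm hx
  D := A.d
  D_deg := A.d_deg
  D_sq := A.d_sq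
  leibnizL := fun i j x m hx _ => A.leibniz i x hx m
  leibnizR := fun i j x m _ hm => A.leibniz j m hm x

/-- `A` is homologically smooth if the diagonal bimodule is perfect over `Aᵉ`. -/
def IsSmooth (A : DGAlgebra k) : Prop := IsPerfectB (diagBimod A)

/-- The graded commutator subspace `[A, P] ⊆ P` of a DG bimodule. -/
def commSub (P : DGBimod A) : Submodule k P.M :=
  Submodule.span k {z : P.M | ∃ (i j : ℤ) (x : A.R) (m : P.M), x ∈ A.gr i ∧ m ∈ P.gm j ∧
    z = P.actL x m - sgnz (i * j) • P.actR x m}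

/-- Degree-`n` cycles of the complex `P/[A,P]` (computing `P ⊗_{Aᵉ} A`), described by
representatives in `P`. -/
def HHZ (P : DGBimod A) (n : ℤ) : Submodule k P.M :=
  P.gm n ⊓ (commSub P).comap P.D

/-- Degree-`n` boundaries of the complex `P/[A,P]`, described by representatives. -/
def HHB (P : DGBimod A) (n : ℤ) : Submodule k P.M :=
  P.gm n ⊓ (commSub P ⊔ LinearMap.range P.D)

/-- The `n`-th Hochschild homology group `HH_n(A) = H^n(P ⊗_{Aᵉ} A)` computed from a
bimodule resolution `P` of the diagonal. -/
def HHspace (P : DGBimod A) (n : ℤ) : Type :=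
  ↥(HHZ P n) ⧸ (Submodule.comap (HHZ P n).subtype (HHB P n ⊓ HHZ P n))

instance (P : DGBimod A) (n : ℤ) : AddCommGroup (HHspace P n) := by
  unfold HHspace; infer_instance

instance (P : DGBimod A) (n : ℤ) : Module k (HHspace P n) := by
  unfold HHspace; infer_instance

/-- `F : P → A` is an h-projective bimodule resolution of the diagonal bimodule. -/
def IsDiagResolution {A : DGAlgebra k} (P : DGBimod A) (F : BimodHom P (diagBimod A)) : Prop :=
  IsHoProjB P ∧ QIsoData P.gm P.D (diagBimod A).gm (diagBimod A).D F.f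
/-! ### Hom complexes and Ext spaces -/

/-- The degree-`n` part of the Hom complex of two right DG `A`-modules:
`A`-linear maps shifting degrees by `n`. -/
def homGrade (X Y : DGMod A) (n : ℤ) : Submodule k (X.M →ₗ[k] Y.M) where
  carrier := {f | (∀ (j : ℤ), ∀ m ∈ X.gm j, f m ∈ Y.gm (j + n)) ∧
    ∀ (x : A.R) (m : X.M), f (X.act x m) = Y.act x (f m)}
  add_mem' := by
    rintro f g ⟨hf1, hf2⟩ ⟨hg1, hg2⟩
    refine ⟨fun j m hm => ?_, fun x m => ?_⟩
    · exact (Y.gm (j + n)).add_mem (hf1 j m hm) (hg1 j m hm)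
    · simp [hf2, hg2]
  zero_mem' := by
    refine ⟨fun j m hm => (Y.gm (j + n)).zero_mem, fun x m => by simp⟩
  smul_mem' := by
    rintro c f ⟨hf1, hf2⟩
    refine ⟨fun j m hm => (Y.gm (j + n)).smul_mem c (hf1 j m hm), fun x m => ?_⟩
    simp [hf2]

theorem mem_homGrade {X Y : DGMod A} {n : ℤ} {f : X.M →ₗ[k] Y.M} :
    f ∈ homGrade X Y n ↔ ((∀ (j : ℤ), ∀ m ∈ X.gm j, f m ∈ Y.gm (j + n)) ∧
      ∀ (x : A.R) (m : X.M), f (X.act x m) = Y.act x (f m)) := Iff.rfl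

/-- The differential of the Hom complex in degree `n`:
`f ↦ D_Y ∘ f - (-1)^n f ∘ D_X`. -/
def homDop (X Y : DGMod A) (n : ℤ) : (X.M →ₗ[k] Y.M) →ₗ[k] (X.M →ₗ[k] Y.M) :=
  (LinearMap.llcomp k X.M Y.M Y.M) Y.D - sgnz n • (LinearMap.llcomp k X.M X.M Y.M).flip X.D

/-- Closed degree-`n` `A`-linear maps. -/
def ZHomS (X Y : DGMod A) (n : ℤ) : Submodule k (X.M →ₗ[k] Y.M) :=
  homGrade X Y n ⊓ LinearMap.ker (homDop X Y n)

/-- Degree-`n` boundaries of the Hom complex. -/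
def BHomS (X Y : DGMod A) (n : ℤ) : Submodule k (X.M →ₗ[k] Y.M) :=
  Submodule.map (homDop X Y (n - 1)) (homGrade X Y (n - 1))

/-- `Hom_{Ho(A)}(X, Y[n])`: the `n`-th cohomology of the Hom complex.  For
homotopically projective `X` this computes `Hom_{D(A)}(X, Y[n])`. -/
def ExtSpace (X Y : DGMod A) (n : ℤ) : Type :=
  ↥(ZHomS X Y n) ⧸ (Submodule.comap (ZHomS X Y n).subtype (BHomS X Y n ⊓ ZHomS X Y n))

instance (X Y : DGMod A) (n : ℤ) : AddCommGroup (ExtSpace X Y n) := by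
  unfold ExtSpace; infer_instance

instance (X Y : DGMod A) (n : ℤ) : Module k (ExtSpace X Y n) := by
  unfold ExtSpace; infer_instance

/-! ### Shifts, cones, isomorphisms in the homotopy category -/

/-- `X'` realizes the shift `X[t]` (so `X'^n = X^{n+t}`). -/
def IsShiftOf (X X' : DGMod A) (t : ℤ) : Prop :=
  ∃ g : X.M ≃ₗ[k] X'.M,
    (∀ n : ℤ, ∀ m ∈ X.gm (n + t), g m ∈ X'.gm n) ∧
    (∀ (x : A.R) (m : X.M), g (X.act x m) = X'.act x (g m)) ∧
    ∀ m : X.M, g (X.D m) = sgnz t • X'.D (g m)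

/-- `C` realizes the cone of the closed morphism `F : X → Y` with canonical
inclusion `j : Y → C`. -/
def IsConeOf {X Y : DGMod A} (F : DGHom X Y) (C : DGMod A) (j : DGHom Y C) : Prop :=
  ∃ (p : C.M →ₗ[k] X.M) (s : X.M →ₗ[k] C.M) (q : C.M →ₗ[k] Y.M),
    (∀ n : ℤ, ∀ c ∈ C.gm n, p c ∈ X.gm (n + 1)) ∧
    (∀ n : ℤ, ∀ m ∈ X.gm (n + 1), s m ∈ C.gm n) ∧
    (∀ n : ℤ, ∀ c ∈ C.gm n, q c ∈ Y.gm n) ∧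
    (∀ (x : A.R) (c : C.M), p (C.act x c) = X.act x (p c)) ∧
    (∀ (x : A.R) (m : X.M), s (X.act x m) = C.act x (s m)) ∧
    (∀ (x : A.R) (c : C.M), q (C.act x c) = Y.act x (q c)) ∧
    (∀ y : Y.M, q (j.f y) = y) ∧ (∀ m : X.M, p (s m) = m) ∧
    (∀ m : X.M, q (s m) = 0) ∧ (∀ y : Y.M, p (j.f y) = 0) ∧
    (∀ c : C.M, j.f (q c) + s (p c) = c) ∧
    ∀ m : X.M, C.D (s m) = j.f (F.f m) - s (X.D m)

/-- Isomorphism in the homotopy category of DG modules. -/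
def HoIso (X Y : DGMod A) : Prop :=
  ∃ (F : DGHom X Y) (G : DGHom Y X),
    Homotopic (G.comp F) (DGHom.id X) ∧ Homotopic (F.comp G) (DGHom.id Y)
/-! ### Left DG modules (right modules over `Aᵒᵖ`) and duality complexes -/

/-- A left DG module over `A` (equivalently, a right DG module over `Aᵒᵖ`). -/
structure DGModL (A : DGAlgebra k) : Type 1 where
  M : Type
  [acg : AddCommGroup M]
  [kmod : Module k M]
  gm : ℤ → Submodule k M
  [dec : DirectSum.Decomposition gm]
  actL : A.R →ₗ[k] M →ₗ[k] M
  actL_one : ∀ m : M, actL 1 m = m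
  actL_mul : ∀ (x y : A.R) (m : M), actL (x * y) m = actL x (actL y m)
  actL_deg : ∀ (i j : ℤ) (x : A.R) (m : M), x ∈ A.gr i → m ∈ gm j → actL x m ∈ gm (i + j)
  D : M →ₗ[k] M
  D_deg : ∀ (j : ℤ), ∀ m ∈ gm j, D m ∈ gm (j + 1)
  D_sq : ∀ m : M, D (D m) = 0
  leibnizL : ∀ (i j : ℤ) (x : A.R) (m : M), x ∈ A.gr i → m ∈ gm j →
    D (actL x m) = actL (A.d x) m + sgnz i • actL x (D m)

attribute [instance] DGModL.acg DGModL.kmod DGModL.dec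

/-- Morphisms of left DG modules. -/
structure DGHomL (X Y : DGModL A) where
  f : X.M →ₗ[k] Y.M
  deg : ∀ (j : ℤ), ∀ m ∈ X.gm j, f m ∈ Y.gm j
  actc : ∀ (x : A.R) (m : X.M), f (X.actL x m) = Y.actL x (f m)
  comm : ∀ m : X.M, f (X.D m) = Y.D (f m)

def DGHomL.id (X : DGModL A) : DGHomL X X :=
  ⟨LinearMap.id, fun _ _ h => h, fun _ _ => rfl, fun _ => rfl⟩

def DGHomL.comp {X Y Z : DGModL A} (G : DGHomL Y Z) (F : DGHomL X Y) : DGHomL X Z :=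
  ⟨G.f ∘ₗ F.f, fun j m h => G.deg j _ (F.deg j m h),
    fun x m => by simp [LinearMap.comp_apply, F.actc, G.actc],
    fun m => by simp [LinearMap.comp_apply, F.comm, G.comm]⟩

def HomotopicL {X Y : DGModL A} (F G : DGHomL X Y) : Prop :=
  ∃ h : X.M →ₗ[k] Y.M,
    (∀ (j : ℤ), ∀ m ∈ X.gm j, h m ∈ Y.gm (j - 1)) ∧
    (∀ (i : ℤ) (x : A.R), x ∈ A.gr i → ∀ m : X.M, h (X.actL x m) = sgnz i • Y.actL x (h m)) ∧
    ∀ m : X.M, F.f m - G.f m = Y.D (h m) + h (X.D m)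

def lSpan (X : DGModL A) (S : Set X.M) : Submodule k X.M :=
  sInf {p : Submodule k X.M | S ⊆ ↑p ∧ ∀ (x : A.R) (m : X.M), m ∈ p → X.actL x m ∈ p}

def IsTwistedL (T : DGModL A) : Prop :=
  ∃ (s : ℕ) (r : Fin s → ℤ) (e : Fin s → T.M),
    (∀ j, e j ∈ T.gm (-(r j))) ∧
    (∀ j, T.D (e j) ∈ lSpan T (e '' {i | i < j})) ∧
    Function.Bijective (fun v : Fin s → A.R => ∑ j, T.actL (v j) (e j))

def IsHoSummandL (P T : DGModL A) : Prop :=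
  ∃ (ι : DGHomL P T) (ρ : DGHomL T P), HomotopicL (ρ.comp ι) (DGHomL.id P)

def IsPerfectL (N : DGModL A) : Prop :=
  ∃ T P : DGModL A, IsTwistedL T ∧ IsHoSummandL P T ∧
    ∃ F : DGHomL P N, QIsoData P.gm P.D N.gm N.D F.f

/-- The degree-`n` part of the complex `Hom_A(X, A)` of right `A`-module maps into `A`. -/
def rHomGrade (X : DGMod A) (n : ℤ) : Submodule k (X.M →ₗ[k] A.R) where
  carrier := {g | (∀ (j : ℤ), ∀ m ∈ X.gm j, g m ∈ A.gr (j + n)) ∧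
    ∀ (x : A.R) (m : X.M), g (X.act x m) = g m * x}
  add_mem' := by
    rintro f g ⟨hf1, hf2⟩ ⟨hg1, hg2⟩
    exact ⟨fun j m hm => (A.gr (j + n)).add_mem (hf1 j m hm) (hg1 j m hm),
      fun x m => by simp [hf2, hg2, add_mul]⟩
  zero_mem' := ⟨fun j m hm => (A.gr (j + n)).zero_mem, fun x m => by simp⟩
  smul_mem' := by
    rintro c f ⟨hf1, hf2⟩
    exact ⟨fun j m hm => (A.gr (j + n)).smul_mem c (hf1 j m hm),
      fun x m => by simp [hf2, Algebra.smul_mul_assoc]⟩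

/-- `V` realizes the dual complex `X^∨ = RHom_A(X, A)` of a (homotopically projective)
right DG module `X`, as a left DG module. -/
def IsRightDualOf (X : DGMod A) (V : DGModL A) : Prop :=
  ∃ Φ : V.M →ₗ[k] (X.M →ₗ[k] A.R),
    Function.Injective Φ ∧
    (∀ n : ℤ, Submodule.map Φ (V.gm n) = rHomGrade X n) ∧
    (∀ (n : ℤ), ∀ v ∈ V.gm n, Φ (V.D v) = A.d ∘ₗ Φ v - sgnz n • (Φ v ∘ₗ X.D)) ∧
    ∀ (x : A.R) (v : V.M), Φ (V.actL x v) = LinearMap.mul k A.R x ∘ₗ Φ v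

/-- The degree-`n` part of the complex `Hom_{Aᵒᵖ}(V, A)` of left `A`-module maps into `A`
(with Koszul signs for moving a degree-`n` map past a left action). -/
def lHomGrade (V : DGModL A) (n : ℤ) : Submodule k (V.M →ₗ[k] A.R) where
  carrier := {g | (∀ (j : ℤ), ∀ v ∈ V.gm j, g v ∈ A.gr (j + n)) ∧
    ∀ (i : ℤ) (x : A.R), x ∈ A.gr i → ∀ v : V.M, g (V.actL x v) = sgnz (i * n) • (x * g v)}
  add_mem' := by
    rintro f g ⟨hf1, hf2⟩ ⟨hg1, hg2⟩
    exact ⟨fun j v hv => (A.gr (j + n)).add_mem (hf1 j v hv) (hg1 j v hv),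
      fun i x hx v => by simp [hf2 i x hx, hg2 i x hx, mul_add, smul_add]⟩
  zero_mem' := ⟨fun j v hv => (A.gr (j + n)).zero_mem, fun i x hx v => by simp⟩
  smul_mem' := by
    rintro c f ⟨hf1, hf2⟩
    refine ⟨fun j v hv => (A.gr (j + n)).smul_mem c (hf1 j v hv), fun i x hx v => ?_⟩
    simp only [LinearMap.smul_apply, hf2 i x hx, Algebra.mul_smul_comm]
    rw [smul_comm]

/-- `W` realizes the bidual complex `Hom_{Aᵒᵖ}(V, A)` of a left DG module `V`,
as a right DG module. -/
def IsLeftDualOf (V : DGModL A) (W : DGMod A) : Prop :=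
  ∃ Ψ : W.M →ₗ[k] (V.M →ₗ[k] A.R),
    Function.Injective Ψ ∧
    (∀ n : ℤ, Submodule.map Ψ (W.gm n) = lHomGrade V n) ∧
    (∀ (n : ℤ), ∀ w ∈ W.gm n, Ψ (W.D w) = A.d ∘ₗ Ψ w - sgnz n • (Ψ w ∘ₗ V.D)) ∧
    ∀ (x : A.R) (w : W.M), Ψ (W.act x w) = (LinearMap.mul k A.R).flip x ∘ₗ Ψ w

/-- The degree-`j` part of the graded `k`-linear dual of a graded module:
functionals vanishing on all components of degree `≠ -j`. -/
def dualGrade {M : Type} [AddCommGroup M] [Module k M]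
    (gm : ℤ → Submodule k M) (j : ℤ) : Submodule k (M →ₗ[k] k) where
  carrier := {ν | ∀ l : ℤ, l ≠ -j → ∀ m ∈ gm l, ν m = 0}
  add_mem' := by
    intro f g hf hg l hl m hm
    simp [hf l hl m hm, hg l hl m hm]
  zero_mem' := by intro l hl m hm; simp
  smul_mem' := by
    intro c f hf l hl m hm
    simp [hf l hl m hm]

/-- `W` realizes the graded `k`-linear dual of a left DG module `V`, as a right DG
module (the Nakayama construction `V ↦ V^*`). -/
def IsGradedKDual (V : DGModL A) (W : DGMod A) : Prop :=
  ∃ Ψ : W.M →ₗ[k] (V.M →ₗ[k] k),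
    (∀ (n : ℤ), ∀ w ∈ W.gm n, Ψ w ∈ dualGrade V.gm n) ∧
    (∀ n : ℤ, Function.Bijective
      (fun w : ↥(W.gm n) => (Ψ ↑w) ∘ₗ (V.gm (-n)).subtype)) ∧
    (∀ (n : ℤ), ∀ w ∈ W.gm n, ∀ v : V.M, Ψ (W.D w) v = -(sgnz n) • Ψ w (V.D v)) ∧
    ∀ (i : ℤ) (x : A.R), x ∈ A.gr i → ∀ (n : ℤ), ∀ w ∈ W.gm n, ∀ v : V.M,
      Ψ (W.act x w) v = sgnz (i * n) • Ψ w (V.actL x v)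

/-- `W` realizes the Nakayama functor value `S_A(X) = (X^∨)^*`. -/
def IsNakayamaOf (X : DGMod A) (W : DGMod A) : Prop :=
  ∃ V : DGModL A, IsRightDualOf X V ∧ IsGradedKDual V W
/-! ### Graded tensor products, dual complexes, and bimodule Hom complexes -/

/-- The degree-`n` part of the tensor product of two graded modules. -/
def tenGrade {M₁ M₂ : Type} [AddCommGroup M₁] [Module k M₁] [AddCommGroup M₂] [Module k M₂]
    (gm₁ : ℤ → Submodule k M₁) (gm₂ : ℤ → Submodule k M₂) (n : ℤ) :
    Submodule k (M₁ ⊗[k] M₂) :=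
  Submodule.span k {t : M₁ ⊗[k] M₂ | ∃ (i j : ℤ) (x : M₁) (y : M₂),
    x ∈ gm₁ i ∧ y ∈ gm₂ j ∧ i + j = n ∧ t = x ⊗ₜ y}

/-- The differential `D₁ ⊗ 1 + σ₁ ⊗ D₂` on a tensor product of complexes, where `σ₁`
is the sign operator of the first factor. -/
def tenD {M₁ M₂ : Type} [AddCommGroup M₁] [Module k M₁] [AddCommGroup M₂] [Module k M₂]
    (D₁ : M₁ →ₗ[k] M₁) (s₁ : M₁ →ₗ[k] M₁) (D₂ : M₂ →ₗ[k] M₂) :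
    (M₁ ⊗[k] M₂) →ₗ[k] (M₁ ⊗[k] M₂) :=
  TensorProduct.map D₁ LinearMap.id + TensorProduct.map s₁ D₂

/-- Cycles of a quotient complex `M/K`, described by representatives in `M`. -/
def ZgK {M : Type} [AddCommGroup M] [Module k M]
    (gm : ℤ → Submodule k M) (Dm : M →ₗ[k] M) (K : Submodule k M) (n : ℤ) :
    Submodule k M :=
  gm n ⊓ K.comap Dm

/-- Boundaries of a quotient complex `M/K`, described by representatives in `M`. -/
def BgK {M : Type} [AddCommGroup M] [Module k M]
    (gm : ℤ → Submodule k M) (Dm : M →ₗ[k] M) (K : Submodule k M) (n : ℤ) :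
    Submodule k M :=
  gm n ⊓ (K ⊔ LinearMap.range Dm)

/-- The differential of the graded dual of a complex. -/
def dualD {M : Type} [AddCommGroup M] [Module k M]
    (gm : ℤ → Submodule k M) [DirectSum.Decomposition gm] (Dm : M →ₗ[k] M) :
    (M →ₗ[k] k) →ₗ[k] (M →ₗ[k] k) :=
  -((LinearMap.llcomp k M M k).flip (Dm ∘ₗ gop gm fun j => sgnk k (j + 1)))

/-- The left `A`-action on the dual `M^*` of a right DG `A`-module `M`. -/
def dualActL (M : DGMod A) (x : A.R) : (M.M →ₗ[k] k) →ₗ[k] (M.M →ₗ[k] k) :=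
  (LinearMap.llcomp k M.M M.M k).flip (M.act x)

/-- The relations submodule defining `X ⊗_A V` inside `X ⊗_k V` for a right module `X`
and a bimodule `V`. -/
def tenRelMB (X : DGMod A) (V : DGBimod A) : Submodule k (X.M ⊗[k] V.M) :=
  Submodule.span k {t : X.M ⊗[k] V.M | ∃ (a : A.R) (x : X.M) (v : V.M),
    t = (X.act a x) ⊗ₜ v - x ⊗ₜ (V.actL a v)}

/-- The relations submodule defining `U ⊗_A V` inside `U ⊗_k V` for two bimodules. -/
def tenRelBB (U V : DGBimod A) : Submodule k (U.M ⊗[k] V.M) :=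
  Submodule.span k {t : U.M ⊗[k] V.M | ∃ (a : A.R) (u : U.M) (v : V.M),
    t = (U.actR a u) ⊗ₜ v - u ⊗ₜ (V.actL a v)}

/-- `V` realizes the dual bimodule `A^* = Hom_k(A, k)` (with its canonical DG
`A`-bimodule structure induced from the diagonal bimodule `A`). -/
def IsDualDiagOf {A : DGAlgebra k} (V : DGBimod A) : Prop :=
  ∃ Ψ : V.M →ₗ[k] (A.R →ₗ[k] k),
    (∀ (n : ℤ), ∀ v ∈ V.gm n, Ψ v ∈ dualGrade A.gr n) ∧
    (∀ n : ℤ, Function.Bijective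
      (fun v : ↥(V.gm n) => (Ψ ↑v) ∘ₗ (A.gr (-n)).subtype)) ∧
    (∀ (n : ℤ), ∀ v ∈ V.gm n, ∀ b : A.R, Ψ (V.D v) b = -(sgnz n) • Ψ v (A.d b)) ∧
    (∀ (i : ℤ) (x : A.R), x ∈ A.gr i → ∀ (n : ℤ), ∀ v ∈ V.gm n, ∀ b : A.R,
      Ψ (V.actL x v) b = sgnz (i * n) • Ψ v (b * x)) ∧
    ∀ (x : A.R) (v : V.M) (b : A.R), Ψ (V.actR x v) b = Ψ v (x * b)

/-- The degree-`n` part of the bimodule Hom complex `Hom_{Aᵉ}(P, T)`, for a target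
complex `T` equipped with (degreewise) commuting `Aᵉ`-actions `actLT`, `actRT`. -/
def bheGrade (P : DGBimod A) {T : Type} [AddCommGroup T] [Module k T]
    (gmT : ℤ → Submodule k T) (actLT actRT : ℤ → A.R → T →ₗ[k] T) (n : ℤ) :
    Submodule k (P.M →ₗ[k] T) where
  carrier := {g | (∀ (j : ℤ), ∀ m ∈ P.gm j, g m ∈ gmT (j + n)) ∧
    (∀ (i : ℤ) (x : A.R), x ∈ A.gr i → ∀ m : P.M,
      g (P.actL x m) = sgnz (i * n) • actLT i x (g m)) ∧
    ∀ (i : ℤ) (x : A.R), x ∈ A.gr i → ∀ m : P.M, g (P.actR x m) = actRT i x (g m)}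
  add_mem' := by
    rintro f g ⟨hf1, hf2, hf3⟩ ⟨hg1, hg2, hg3⟩
    exact ⟨fun j m hm => (gmT (j + n)).add_mem (hf1 j m hm) (hg1 j m hm),
      fun i x hx m => by simp [hf2 i x hx, hg2 i x hx, smul_add],
      fun i x hx m => by simp [hf3 i x hx, hg3 i x hx]⟩
  zero_mem' := ⟨fun j m hm => (gmT (j + n)).zero_mem,
    fun i x hx m => by simp, fun i x hx m => by simp⟩
  smul_mem' := by
    rintro c f ⟨hf1, hf2, hf3⟩
    refine ⟨fun j m hm => (gmT (j + n)).smul_mem c (hf1 j m hm), fun i x hx m => ?_,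
      fun i x hx m => by simp [hf3 i x hx]⟩
    simp only [LinearMap.smul_apply, hf2 i x hx, map_smul]
    rw [smul_comm]

/-- The differential of the bimodule Hom complex in degree `n`. -/
def bhDop (P : DGBimod A) {T : Type} [AddCommGroup T] [Module k T]
    (DT : T →ₗ[k] T) (n : ℤ) : (P.M →ₗ[k] T) →ₗ[k] (P.M →ₗ[k] T) :=
  (LinearMap.llcomp k P.M T T) DT - sgnz n • (LinearMap.llcomp k P.M P.M T).flip P.D

/-- Closed degree-`n` elements of the bimodule Hom complex. -/
def ZbhS (P : DGBimod A) {T : Type} [AddCommGroup T] [Module k T]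
    (gmT : ℤ → Submodule k T) (actLT actRT : ℤ → A.R → T →ₗ[k] T)
    (DT : T →ₗ[k] T) (n : ℤ) : Submodule k (P.M →ₗ[k] T) :=
  bheGrade P gmT actLT actRT n ⊓ LinearMap.ker (bhDop P DT n)

/-- Boundaries of degree `n` of the bimodule Hom complex. -/
def BbhS (P : DGBimod A) {T : Type} [AddCommGroup T] [Module k T]
    (gmT : ℤ → Submodule k T) (actLT actRT : ℤ → A.R → T →ₗ[k] T)
    (DT : T →ₗ[k] T) (n : ℤ) : Submodule k (P.M →ₗ[k] T) :=
  Submodule.map (bhDop P DT (n - 1)) (bheGrade P gmT actLT actRT (n - 1))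

/-- Cohomology of the bimodule Hom complex (`Ext` over `Aᵉ`). -/
def ExtBSpace (P : DGBimod A) {T : Type} [AddCommGroup T] [Module k T]
    (gmT : ℤ → Submodule k T) (actLT actRT : ℤ → A.R → T →ₗ[k] T)
    (DT : T →ₗ[k] T) (n : ℤ) : Type :=
  ↥(ZbhS P gmT actLT actRT DT n) ⧸
    (Submodule.comap (ZbhS P gmT actLT actRT DT n).subtype
      (BbhS P gmT actLT actRT DT n ⊓ ZbhS P gmT actLT actRT DT n))

instance (P : DGBimod A) {T : Type} [AddCommGroup T] [Module k T]
    (gmT : ℤ → Submodule k T) (actLT actRT : ℤ → A.R → T →ₗ[k] T)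
    (DT : T →ₗ[k] T) (n : ℤ) : AddCommGroup (ExtBSpace P gmT actLT actRT DT n) := by
  unfold ExtBSpace; infer_instance

instance (P : DGBimod A) {T : Type} [AddCommGroup T] [Module k T]
    (gmT : ℤ → Submodule k T) (actLT actRT : ℤ → A.R → T →ₗ[k] T)
    (DT : T →ₗ[k] T) (n : ℤ) : Module k (ExtBSpace P gmT actLT actRT DT n) := by
  unfold ExtBSpace; infer_instance

/-- The differential of `Aᵉ` on the underlying space `A.R ⊗[k] A.R`. -/
def aeD (A : DGAlgebra k) : (A.R ⊗[k] A.R) →ₗ[k] (A.R ⊗[k] A.R) :=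
  tenD A.d (gop A.gr fun j => sgnk k j) A.d

/-- The inner (module) action of a homogeneous element of degree `i` on the left slot
of the free `Aᵉ`-module `Aᵉ`. -/
def aeInnerL (A : DGAlgebra k) (i : ℤ) (x : A.R) : (A.R ⊗[k] A.R) →ₗ[k] (A.R ⊗[k] A.R) :=
  TensorProduct.map (LinearMap.mulLeft k x) (gop A.gr fun j => sgnk k (i * j))

/-- The inner (module) action on the right slot of the free `Aᵉ`-module `Aᵉ`. -/
def aeInnerR (A : DGAlgebra k) (i : ℤ) (x : A.R) : (A.R ⊗[k] A.R) →ₗ[k] (A.R ⊗[k] A.R) :=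
  TensorProduct.map LinearMap.id (LinearMap.mulRight k x)

/-- The outer left action on the free `Aᵉ`-module `Aᵉ`. -/
def aeOuterL (A : DGAlgebra k) (i : ℤ) (x : A.R) : (A.R ⊗[k] A.R) →ₗ[k] (A.R ⊗[k] A.R) :=
  TensorProduct.map (LinearMap.mulRight k x) LinearMap.id

/-- The outer right action on the free `Aᵉ`-module `Aᵉ`. -/
def aeOuterR (A : DGAlgebra k) (i : ℤ) (x : A.R) : (A.R ⊗[k] A.R) →ₗ[k] (A.R ⊗[k] A.R) :=
  TensorProduct.map (gop A.gr fun j => sgnk k (i * j)) (LinearMap.mulLeft k x)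

/-- `E` represents the inverse dualizing bimodule
`A^! = RHom_{(Aᵉ)ᵒᵖ}(A, (Aᵉ)ᵒᵖ)`: `E` is identified, via `Φ`, with the bimodule Hom
complex `Hom_{Aᵉ}(P, Aᵉ)` for an h-projective bimodule resolution `P` of the diagonal. -/
def RepresentsShriek {A : DGAlgebra k} (E : DGBimod A) : Prop :=
  ∃ (P : DGBimod A) (F : BimodHom P (diagBimod A)), IsDiagResolution P F ∧
  ∃ Φ : E.M →ₗ[k] (P.M →ₗ[k] (A.R ⊗[k] A.R)),
    Function.Injective Φ ∧
    (∀ n : ℤ, Submodule.map Φ (E.gm n) =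
      bheGrade P (tenGrade A.gr A.gr) (aeInnerL A) (aeInnerR A) n) ∧
    (∀ (n : ℤ), ∀ v ∈ E.gm n, Φ (E.D v) = bhDop P (aeD A) n (Φ v)) ∧
    (∀ (i : ℤ) (x : A.R), x ∈ A.gr i → ∀ v : E.M,
      Φ (E.actL x v) = aeOuterL A i x ∘ₗ Φ v) ∧
    ∀ (i : ℤ) (x : A.R), x ∈ A.gr i → ∀ v : E.M,
      Φ (E.actR x v) = aeOuterR A i x ∘ₗ Φ v


set_option linter.unusedVariables false
set_option linter.unusedSimpArgs false
section

set_option linter.unusedSimpArgs false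
section basics

theorem sgnk_zero : sgnk k 0 = 1 := by simp [sgnk]

theorem sgnk_one : sgnk k 1 = -1 := by simp [sgnk]

theorem sgnk_add (i j : ℤ) : sgnk k (i + j) = sgnk k i * sgnk k j := by
  unfold sgnk
  simp only [Int.even_add]
  by_cases hi : Even i <;> by_cases hj : Even j <;> simp [hi, hj]

theorem sgnk_even {i : ℤ} (h : Even i) : sgnk k i = 1 := by simp [sgnk, h]

theorem sgnk_sq (i : ℤ) : sgnk k i * sgnk k i = 1 := by
  unfold sgnk; split_ifs <;> simp

theorem sgnk_neg (i : ℤ) : sgnk k (-i) = sgnk k i := by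
  unfold sgnk; simp

theorem sgnk_succ (i : ℤ) : sgnk k (i + 1) = - sgnk k i := by
  rw [sgnk_add, sgnk_one]; ring

theorem sgnk_pred (i : ℤ) : sgnk k (i - 1) = - sgnk k i := by
  rw [sub_eq_add_neg, sgnk_add, sgnk_neg, sgnk_one]; ring

theorem sgnz_smul {M : Type} [AddCommGroup M] [Module k M] (i : ℤ) (x : M) :
    sgnz i • x = sgnk k i • x := by
  unfold sgnz sgnk; split_ifs <;> simp

theorem sgnk_smul_smul {M : Type} [AddCommGroup M] [Module k M] (i : ℤ) (x : M) :
    sgnk k i • sgnk k i • x = x := by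
  rw [smul_smul, sgnk_sq, one_smul]

section gopsec
variable {M : Type} [AddCommGroup M] [Module k M] (gm : ℤ → Submodule k M)
  [DirectSum.Decomposition gm]

theorem gop_of_mem (c : ℤ → k) {j : ℤ} {x : M} (hx : x ∈ gm j) : gop gm c x = c j • x := by
  have : DirectSum.decomposeLinearEquiv gm x = DirectSum.lof k ℤ (fun i => gm i) j ⟨x, hx⟩ := by
    exact DirectSum.decompose_of_mem gm hx
  simp [gop, this]

theorem gr_le {p : Submodule k M} (h : ∀ j, gm j ≤ p) (x : M) : x ∈ p := by
  classical
  rw [← DirectSum.sum_support_decompose gm x]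
  exact Submodule.sum_mem _ fun j _ => h j (SetLike.coe_mem _)

theorem gr_ext {N : Type} [AddCommGroup N] [Module k N] {f g : M →ₗ[k] N}
    (h : ∀ j, ∀ x ∈ gm j, f x = g x) (x : M) : f x = g x :=
  gr_le gm (p := LinearMap.eqLocus f g) (fun j x hx => h j x hx) x

theorem gop_gop (c c' : ℤ → k) (x : M) : gop gm c (gop gm c' x) = gop gm (fun j => c j * c' j) x :=
  gr_ext gm (f := gop gm c ∘ₗ gop gm c') (g := gop gm (fun j => c j * c' j)) (fun j x hx => by
    simp [gop_of_mem gm _ hx, smul_smul, mul_comm]) x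

theorem gop_mem (c : ℤ → k) {j : ℤ} {x : M} (hx : x ∈ gm j) : gop gm c x ∈ gm j := by
  rw [gop_of_mem gm _ hx]; exact Submodule.smul_mem _ _ hx

/-- projection to degree j -/
def gpr (j : ℤ) : M →ₗ[k] M := gop gm (fun l => if l = j then 1 else 0)

theorem gpr_same {j : ℤ} {x : M} (hx : x ∈ gm j) : gpr gm j x = x := by
  simp [gpr, gop_of_mem gm _ hx]

theorem gpr_ne {i j : ℤ} (h : i ≠ j) {x : M} (hx : x ∈ gm i) : gpr gm j x = 0 := by
  simp [gpr, gop_of_mem gm _ hx, h]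

theorem gpr_mem (j : ℤ) (x : M) : gpr gm j x ∈ gm j := by
  refine gr_le gm (p := (gm j).comap (gpr gm j)) (fun i y hy => ?_) x
  simp only [Submodule.mem_comap]
  by_cases h : i = j
  · subst h; rwa [gpr_same gm hy]
  · rw [gpr_ne gm h hy]; exact zero_mem _

theorem gr_disj {i j : ℤ} (h : i ≠ j) {x : M} (hx : x ∈ gm i) (hx' : x ∈ gm j) : x = 0 := by
  rw [← gpr_same gm hx', gpr_ne gm h hx]

end gopsec

/-- powers of the sign automorphism -/
def epz (A : DGAlgebra k) (m : ℤ) : A.R →ₗ[k] A.R := gop A.gr (fun j => sgnk k (m * j))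

theorem epz_of_mem {j : ℤ} {x : A.R} (m : ℤ) (hx : x ∈ A.gr j) :
    epz A m x = sgnk k (m * j) • x := gop_of_mem A.gr _ hx

theorem epz_deg {j : ℤ} {x : A.R} (m : ℤ) (hx : x ∈ A.gr j) : epz A m x ∈ A.gr j :=
  gop_mem A.gr _ hx

theorem ep_of_mem {j : ℤ} {x : A.R} (hx : x ∈ A.gr j) : epz A 1 x = sgnk k j • x := by
  rw [epz_of_mem 1 hx, one_mul]

theorem epz_mul (m : ℤ) (x y : A.R) : epz A m (x * y) = epz A m x * epz A m y := by
  have := gr_ext A.gr (f := (epz A m) ∘ₗ (LinearMap.mul k A.R).flip y)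
    (g := (LinearMap.mul k A.R).flip (epz A m y) ∘ₗ epz A m) (fun i x hx => ?_) x
  · simpa using this
  have := gr_ext A.gr (f := (epz A m) ∘ₗ (LinearMap.mul k A.R) x)
    (g := (LinearMap.mul k A.R (epz A m x)) ∘ₗ epz A m) (fun j y hy => ?_) y
  · simpa using this
  simp [epz_of_mem m hx, epz_of_mem m hy, epz_of_mem m (A.mul_mem hx hy), smul_smul, mul_add,
    sgnk_add, mul_comm]

theorem epz_one (m : ℤ) : epz A m 1 = 1 := by
  rw [epz_of_mem m A.one_mem]; simp [sgnk_zero]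

theorem epz_epz (m n : ℤ) (x : A.R) : epz A m (epz A n x) = epz A (m + n) x := by
  unfold epz; rw [gop_gop]; congr 2; ext j; rw [add_mul, sgnk_add]

theorem epz_even {m : ℤ} (h : Even m) (x : A.R) : epz A m x = x := by
  refine gr_ext A.gr (g := LinearMap.id) (fun j x hx => ?_) x
  simp [epz_of_mem m hx, sgnk_even (h.mul_right j)]

theorem epz_zero (x : A.R) : epz A 0 x = x := epz_even (by simp) x

theorem epz_self (m : ℤ) (x : A.R) : epz A m (epz A m x) = x := by
  rw [epz_epz]; exact epz_even ⟨m, rfl⟩ x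

theorem epz_d (m : ℤ) (x : A.R) : A.d (epz A m x) = sgnk k m • epz A m (A.d x) := by
  refine gr_ext A.gr (f := A.d ∘ₗ epz A m) (g := sgnk k m • (epz A m ∘ₗ A.d)) (fun j x hx => ?_) x
  simp [epz_of_mem m hx, epz_of_mem m (A.d_deg j x hx), smul_smul, mul_add, sgnk_add]
  rw [mul_left_comm, sgnk_sq, mul_one]

theorem ep_d (x : A.R) : A.d (epz A 1 x) = - epz A 1 (A.d x) := by
  rw [epz_d, sgnk_one]; simp

theorem d_mul (x y : A.R) : A.d (x * y) = A.d x * y + epz A 1 x * A.d y := by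
  refine gr_ext A.gr (f := A.d ∘ₗ (LinearMap.mul k A.R).flip y)
    (g := (LinearMap.mul k A.R).flip y ∘ₗ A.d + (LinearMap.mul k A.R).flip (A.d y) ∘ₗ epz A 1)
    (fun i x hx => ?_) x
  simp [A.leibniz i x hx, ep_of_mem hx, sgnz_smul (k := k)]

theorem d_one : A.d 1 = 0 := by
  have h := A.leibniz 0 1 A.one_mem 1
  simpa [sgnz_smul (k := k), sgnk_zero] using h

end basics

/-- Target bimodules: no decomposition is required. -/
structure Tgt (A : DGAlgebra k) : Type 1 where
  M : Type
  [acg : AddCommGroup M]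
  [kmod : Module k M]
  gm : ℤ → Submodule k M
  E : M →ₗ[k] M
  D : M →ₗ[k] M
  L : A.R →ₗ[k] M →ₗ[k] M
  R : A.R →ₗ[k] M →ₗ[k] M
  L_one : ∀ m : M, L 1 m = m
  R_one : ∀ m : M, R 1 m = m
  L_mul : ∀ (x y : A.R) (m : M), L (x * y) m = L x (L y m)
  R_mul : ∀ (x y : A.R) (m : M), R (x * y) m = R y (R x m)
  LR : ∀ (x y : A.R) (m : M), L x (R y m) = R y (L x m)
  DD : ∀ m : M, D (D m) = 0
  DL : ∀ (x : A.R) (m : M), D (L x m) = L (A.d x) m + L (epz A 1 x) (D m)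
  DR : ∀ (x : A.R) (m : M), D (R x m) = R x (D m) + R (A.d x) (E m)
  E_deg : ∀ (j : ℤ), ∀ m ∈ gm j, E m = sgnk k j • m
  L_deg : ∀ (i j : ℤ) (x : A.R) (m : M), x ∈ A.gr i → m ∈ gm j → L x m ∈ gm (i + j)
  R_deg : ∀ (i j : ℤ) (x : A.R) (m : M), x ∈ A.gr i → m ∈ gm j → R x m ∈ gm (j + i)
  D_deg : ∀ (j : ℤ), ∀ m ∈ gm j, D m ∈ gm (j + 1)

attribute [instance] Tgt.acg Tgt.kmod

/-- sign operator of a bimodule -/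
def bE (X : DGBimod A) : X.M →ₗ[k] X.M := gop X.gm (sgnk k)

theorem bE_of_mem (X : DGBimod A) {j : ℤ} {m : X.M} (h : m ∈ X.gm j) : bE X m = sgnk k j • m :=
  gop_of_mem X.gm _ h

theorem b_DL (X : DGBimod A) (x : A.R) (m : X.M) :
    X.D (X.actL x m) = X.actL (A.d x) m + X.actL (epz A 1 x) (X.D m) := by
  refine gr_ext A.gr (f := X.D ∘ₗ X.actL.flip m)
    (g := X.actL.flip m ∘ₗ A.d + X.actL.flip (X.D m) ∘ₗ epz A 1) (fun i x hx => ?_) x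
  refine gr_ext X.gm (f := X.D ∘ₗ X.actL x)
    (g := X.actL (A.d x) + X.actL (epz A 1 x) ∘ₗ X.D) (fun j m hm => ?_) m
  simp [X.leibnizL i j x m hx hm, ep_of_mem hx, sgnz_smul (k := k)]

theorem b_DR (X : DGBimod A) (x : A.R) (m : X.M) :
    X.D (X.actR x m) = X.actR x (X.D m) + X.actR (A.d x) (bE X m) := by
  refine gr_ext A.gr (f := X.D ∘ₗ X.actR.flip m)
    (g := X.actR.flip (X.D m) + X.actR.flip (bE X m) ∘ₗ A.d) (fun i x hx => ?_) x
  refine gr_ext X.gm (f := X.D ∘ₗ X.actR x)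
    (g := X.actR x ∘ₗ X.D + X.actR (A.d x) ∘ₗ bE X) (fun j m hm => ?_) m
  simp [X.leibnizR i j x m hx hm, bE_of_mem X hm, sgnz_smul (k := k)]

/-- a bimodule as a target -/
@[reducible] def tg (X : DGBimod A) : Tgt A where
  M := X.M
  gm := X.gm
  E := bE X
  D := X.D
  L := X.actL
  R := X.actR
  L_one := X.actL_one
  R_one := X.actR_one
  L_mul := X.actL_mul
  R_mul := X.actR_mul
  LR := X.actLR
  DD := X.D_sq
  DL := b_DL X
  DR := b_DR X
  E_deg := fun j m h => bE_of_mem X h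
  L_deg := X.actL_deg
  R_deg := X.actR_deg
  D_deg := X.D_deg

/-- shift -/
@[reducible] def Sh (m : ℤ) (N : Tgt A) : Tgt A where
  M := N.M
  gm := fun j => N.gm (j + m)
  E := sgnk k m • N.E
  D := sgnk k m • N.D
  L := N.L ∘ₗ epz A m
  R := N.R
  L_one := fun n => by simp [epz_one, N.L_one]
  R_one := N.R_one
  L_mul := fun x y n => by simp [epz_mul, N.L_mul]
  R_mul := N.R_mul
  LR := fun x y n => by simp [N.LR]
  DD := fun n => by simp [N.DD]
  DL := fun x n => by
    simp only [LinearMap.smul_apply, LinearMap.comp_apply, N.DL, epz_d, smul_add, map_smul,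
      epz_epz, sgnk_smul_smul, add_comm m 1]
  DR := fun x n => by
    simp only [LinearMap.smul_apply, N.DR, smul_add, map_smul]
  E_deg := fun j n h => by
    simp only [LinearMap.smul_apply, N.E_deg _ _ h]
    rw [smul_smul, add_comm, sgnk_add, ← mul_assoc, sgnk_sq, one_mul]
  L_deg := fun i j x n hx hn => by
    have := N.L_deg i (j + m) _ n (epz_deg m hx) hn
    rwa [← add_assoc] at this
  R_deg := fun i j x n hx hn => by
    have := N.R_deg i (j + m) x n hx hn
    rwa [show j + m + i = j + i + m by ring] at this
  D_deg := fun j n hn => by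
    have := N.D_deg _ n hn
    rw [show j + m + 1 = j + 1 + m by ring] at this
    exact Submodule.smul_mem _ _ this

/-- closed degree zero bimodule maps -/
structure IsMor (N N' : Tgt A) (f : N.M →ₗ[k] N'.M) : Prop where
  deg : ∀ (j : ℤ), ∀ m ∈ N.gm j, f m ∈ N'.gm j
  l : ∀ (x : A.R) (m : N.M), f (N.L x m) = N'.L x (f m)
  r : ∀ (x : A.R) (m : N.M), f (N.R x m) = N'.R x (f m)
  dd : ∀ m : N.M, f (N.D m) = N'.D (f m)

/-- degree -1 bimodule maps -/
structure IsHt (N N' : Tgt A) (h : N.M →ₗ[k] N'.M) : Prop where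
  deg : ∀ (j : ℤ), ∀ m ∈ N.gm j, h m ∈ N'.gm (j - 1)
  l : ∀ (x : A.R) (m : N.M), h (N.L x m) = N'.L (epz A 1 x) (h m)
  r : ∀ (x : A.R) (m : N.M), h (N.R x m) = N'.R x (h m)

/-- null-homotopic -/
def Null (N N' : Tgt A) (f : N.M →ₗ[k] N'.M) : Prop :=
  ∃ h, IsHt N N' h ∧ ∀ m, f m = N'.D (h m) + h (N.D m)

theorem IsMor.zero (N N' : Tgt A) : IsMor N N' 0 :=
  ⟨fun _ _ _ => zero_mem _, by simp, by simp, by simp⟩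

theorem IsMor.id (N : Tgt A) : IsMor N N LinearMap.id :=
  ⟨fun _ _ h => h, by simp, by simp, by simp⟩

theorem IsMor.sub {N N' : Tgt A} {f g : N.M →ₗ[k] N'.M} (hf : IsMor N N' f) (hg : IsMor N N' g) :
    IsMor N N' (f - g) :=
  ⟨fun j m h => sub_mem (hf.deg j m h) (hg.deg j m h), by simp [hf.l, hg.l], by simp [hf.r, hg.r],
    by simp [hf.dd, hg.dd]⟩

theorem IsMor.neg {N N' : Tgt A} {f : N.M →ₗ[k] N'.M} (hf : IsMor N N' f) : IsMor N N' (-f) := by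
  simpa using (IsMor.zero N N').sub hf

theorem IsMor.comp {N N' N'' : Tgt A} {f : N'.M →ₗ[k] N''.M} {g : N.M →ₗ[k] N'.M}
    (hf : IsMor N' N'' f) (hg : IsMor N N' g) : IsMor N N'' (f ∘ₗ g) :=
  ⟨fun j m h => hf.deg j _ (hg.deg j m h), by simp [hf.l, hg.l], by simp [hf.r, hg.r],
    by simp [hf.dd, hg.dd]⟩

theorem IsHt.zero (N N' : Tgt A) : IsHt N N' 0 :=
  ⟨fun _ _ _ => zero_mem _, by simp, by simp⟩

theorem IsHt.add {N N' : Tgt A} {f g : N.M →ₗ[k] N'.M} (hf : IsHt N N' f) (hg : IsHt N N' g) :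
    IsHt N N' (f + g) :=
  ⟨fun j m h => add_mem (hf.deg j m h) (hg.deg j m h), by simp [hf.l, hg.l], by simp [hf.r, hg.r]⟩

theorem IsHt.sub {N N' : Tgt A} {f g : N.M →ₗ[k] N'.M} (hf : IsHt N N' f) (hg : IsHt N N' g) :
    IsHt N N' (f - g) :=
  ⟨fun j m h => sub_mem (hf.deg j m h) (hg.deg j m h), by simp [hf.l, hg.l], by simp [hf.r, hg.r]⟩

theorem IsHt.neg {N N' : Tgt A} {f : N.M →ₗ[k] N'.M} (hf : IsHt N N' f) : IsHt N N' (-f) := by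
  simpa using (IsHt.zero N N').sub hf

theorem IsHt.smul {N N' : Tgt A} {f : N.M →ₗ[k] N'.M} (c : k) (hf : IsHt N N' f) :
    IsHt N N' (c • f) :=
  ⟨fun j m h => Submodule.smul_mem _ _ (hf.deg j m h), by simp [hf.l], by simp [hf.r]⟩

theorem IsHt.comp {N N' N'' : Tgt A} {f : N'.M →ₗ[k] N''.M} {g : N.M →ₗ[k] N'.M}
    (hf : IsHt N' N'' f) (hg : IsMor N N' g) : IsHt N N'' (f ∘ₗ g) :=
  ⟨fun j m h => hf.deg j _ (hg.deg j m h), by simp [hf.l, hg.l], by simp [hf.r, hg.r]⟩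

theorem IsMor.compHt {N N' N'' : Tgt A} {f : N'.M →ₗ[k] N''.M} {g : N.M →ₗ[k] N'.M}
    (hf : IsMor N' N'' f) (hg : IsHt N N' g) : IsHt N N'' (f ∘ₗ g) :=
  ⟨fun j m h => hf.deg _ _ (hg.deg j m h), by simp [hf.l, hg.l], by simp [hf.r, hg.r]⟩

theorem Null.comp {N N' N'' : Tgt A} {f : N'.M →ₗ[k] N''.M} {g : N.M →ₗ[k] N'.M}
    (hf : Null N' N'' f) (hg : IsMor N N' g) : Null N N'' (f ∘ₗ g) := by
  obtain ⟨h, h1, h2⟩ := hf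
  exact ⟨h ∘ₗ g, h1.comp hg, fun m => by simp [h2, hg.dd]⟩

theorem IsMor.compNull {N N' N'' : Tgt A} {f : N'.M →ₗ[k] N''.M} {g : N.M →ₗ[k] N'.M}
    (hf : IsMor N' N'' f) (hg : Null N N' g) : Null N N'' (f ∘ₗ g) := by
  obtain ⟨h, h1, h2⟩ := hg
  exact ⟨f ∘ₗ h, hf.compHt h1, fun m => by simp [h2, hf.dd]⟩

theorem Null.add {N N' : Tgt A} {f g : N.M →ₗ[k] N'.M} (hf : Null N N' f) (hg : Null N N' g) :
    Null N N' (f + g) := by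
  obtain ⟨h, h1, h2⟩ := hf
  obtain ⟨h', h1', h2'⟩ := hg
  exact ⟨h + h', h1.add h1', fun m => by simp [h2, h2']; abel⟩

theorem Null.neg {N N' : Tgt A} {f : N.M →ₗ[k] N'.M} (hf : Null N N' f) :
    Null N N' (-f) := by
  obtain ⟨h, h1, h2⟩ := hf
  exact ⟨-h, h1.neg, fun m => by simp [h2]; abel⟩

theorem Null.sub {N N' : Tgt A} {f g : N.M →ₗ[k] N'.M} (hf : Null N N' f) (hg : Null N N' g) :
    Null N N' (f - g) := by
  rw [sub_eq_add_neg]; exact hf.add hg.neg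

theorem Null.zero (N N' : Tgt A) : Null N N' 0 :=
  ⟨0, IsHt.zero N N', by simp⟩

theorem IsMor.sh {N N' : Tgt A} {f : N.M →ₗ[k] N'.M} (hf : IsMor N N' f) (m : ℤ) :
    IsMor (Sh m N) (Sh m N') f :=
  ⟨fun j n h => hf.deg _ n h, by simp [hf.l], by simp [hf.r], by simp [hf.dd]⟩

theorem IsHt.sh {N N' : Tgt A} {f : N.M →ₗ[k] N'.M} (hf : IsHt N N' f) (m : ℤ) :
    IsHt (Sh m N) (Sh m N') f :=
  ⟨fun j n h => by
      have := hf.deg _ n h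
      rwa [show j + m - 1 = j - 1 + m by ring] at this,
    by simp [hf.l, epz_epz, add_comm], by simp [hf.r]⟩

theorem Null.sh {N N' : Tgt A} {f : N.M →ₗ[k] N'.M} (hf : Null N N' f) (m : ℤ) :
    Null (Sh m N) (Sh m N') f := by
  obtain ⟨h, h1, h2⟩ := hf
  refine ⟨sgnk k m • h, (h1.sh m).smul _, fun n => ?_⟩
  simp only [LinearMap.smul_apply, map_smul, sgnk_smul_smul, h2]

theorem ht_E {X : DGBimod A} {N : Tgt A} {h : X.M →ₗ[k] N.M} (hh : IsHt (tg X) N h) (m : X.M) :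
    N.E (h m) = - h (bE X m) := by
  refine gr_ext X.gm (f := N.E ∘ₗ h) (g := -(h ∘ₗ bE X)) (fun j m hm => ?_) m
  simp [N.E_deg _ _ (hh.deg j m hm), bE_of_mem X hm, sgnk_pred]

theorem mor_E {X : DGBimod A} {N : Tgt A} {h : X.M →ₗ[k] N.M} (hh : IsMor (tg X) N h) (m : X.M) :
    N.E (h m) = h (bE X m) := by
  refine gr_ext X.gm (f := N.E ∘ₗ h) (g := (h ∘ₗ bE X)) (fun j m hm => ?_) m
  simp [N.E_deg _ _ (hh.deg j m hm), bE_of_mem X hm, sgnk_pred]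

theorem ht_mor {X : DGBimod A} {N : Tgt A} {h : X.M →ₗ[k] N.M} (hh : IsHt (tg X) N h) :
    IsMor (tg X) N (N.D ∘ₗ h + h ∘ₗ X.D) := by
  refine ⟨fun j m hm => ?_, fun x m => ?_, fun x m => ?_, fun m => ?_⟩
  · have h1 := N.D_deg _ _ (hh.deg j m hm)
    have h2 := hh.deg _ _ (X.D_deg j m hm)
    simp only [sub_add_cancel, add_sub_cancel_right] at h1 h2
    exact add_mem h1 h2
  · have h1 := hh.l; have h2 := b_DL X
    simp only [LinearMap.add_apply, LinearMap.comp_apply, h1, h2, map_add, N.DL, ep_d, epz_self,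
      map_neg, LinearMap.neg_apply]
    abel
  · have h1 := hh.r; have h2 := b_DR X; have h3 := ht_E hh
    simp only [LinearMap.add_apply, LinearMap.comp_apply, h1, h2, map_add, N.DR, h3, map_neg]
    abel
  · simp [X.D_sq, N.DD]

theorem Null.isMor {X : DGBimod A} {N : Tgt A} {f : X.M →ₗ[k] N.M} (hf : Null (tg X) N f) :
    IsMor (tg X) N f := by
  obtain ⟨h, h1, h2⟩ := hf
  have : f = N.D ∘ₗ h + h ∘ₗ X.D := by ext m; exact h2 m
  rw [this]; exact ht_mor h1

theorem BimodHom.mor {X Y : DGBimod A} (F : BimodHom X Y) : IsMor (tg X) (tg Y) F.f :=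
  ⟨F.deg, F.actLc, F.actRc, F.comm⟩

theorem homotopic_iff {X Y : DGBimod A} (F G : BimodHom X Y) :
    BimodHomotopic F G ↔ Null (tg X) (tg Y) (F.f - G.f) := by
  constructor
  · rintro ⟨h, h1, h2, h3, h4⟩
    refine ⟨h, ⟨h1, fun x m => ?_, h3⟩, fun m => by simp [h4]⟩
    refine gr_ext A.gr (f := h ∘ₗ X.actL.flip m) (g := Y.actL.flip (h m) ∘ₗ epz A 1)
      (fun i x hx => ?_) x
    simp [h2 i x hx m, ep_of_mem hx, sgnz_smul (k := k)]
  · rintro ⟨h, ⟨h1, h2, h3⟩, h4⟩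
    refine ⟨h, h1, fun i x hx m => ?_, h3, fun m => by simpa using h4 m⟩
    rw [h2, ep_of_mem hx, sgnz_smul (k := k)]; simp

/-- acyclic targets -/
def TAc (N : Tgt A) : Prop := ∀ j, ∀ n ∈ N.gm j, N.D n = 0 → ∃ n' ∈ N.gm (j - 1), N.D n' = n

/-- quasi-isomorphisms -/
structure QI (N N' : Tgt A) (φ : N.M →ₗ[k] N'.M) : Prop where
  inj : ∀ j, ∀ n ∈ N.gm j, N.D n = 0 → ∀ n' ∈ N'.gm (j - 1), N'.D n' = φ n →
    ∃ n₀ ∈ N.gm (j - 1), N.D n₀ = n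
  surj : ∀ j, ∀ n' ∈ N'.gm j, N'.D n' = 0 → ∃ n ∈ N.gm j, N.D n = 0 ∧
    ∃ w ∈ N'.gm (j - 1), φ n - n' = N'.D w

theorem sgnk_smul_eq {M : Type} [AddCommGroup M] [Module k M] {i : ℤ} {x y : M}
    (h : x = sgnk k i • y) : sgnk k i • x = y := by rw [h, sgnk_smul_smul]

theorem sgnk_smul_zero {M : Type} [AddCommGroup M] [Module k M] {i : ℤ} {x : M}
    (h : sgnk k i • x = 0) : x = 0 := by
  have := sgnk_smul_smul (k := k) i x
  rw [h, smul_zero] at this; exact this.symm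

theorem QI.sh {N N' : Tgt A} {φ : N.M →ₗ[k] N'.M} (h : QI N N' φ) (m : ℤ) :
    QI (Sh m N) (Sh m N') φ := by
  constructor
  · intro j n hn hD n' hn' hD'
    have e : j - 1 + m = j + m - 1 := by ring
    obtain ⟨n₀, h1, h2⟩ := h.inj (j + m) n hn (sgnk_smul_zero hD) (sgnk k m • n')
      (e ▸ Submodule.smul_mem _ _ hn') (by rw [map_smul]; exact hD')
    refine ⟨sgnk k m • n₀, ?_, ?_⟩
    · show sgnk k m • n₀ ∈ N.gm (j - 1 + m)
      rw [e]; exact Submodule.smul_mem _ _ h1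
    · show sgnk k m • N.D _ = n
      rw [map_smul, sgnk_smul_smul, h2]
  · intro j n' hn' hD'
    have e : j - 1 + m = j + m - 1 := by ring
    obtain ⟨n, h1, h2, w, hw, hw'⟩ := h.surj (j + m) n' hn' (sgnk_smul_zero hD')
    refine ⟨n, h1, ?_, sgnk k m • w, ?_, ?_⟩
    · show sgnk k m • N.D n = 0
      rw [h2, smul_zero]
    · show sgnk k m • w ∈ N'.gm (j - 1 + m)
      rw [e]; exact Submodule.smul_mem _ _ hw
    · show _ = sgnk k m • N'.D _
      rw [map_smul, sgnk_smul_smul, hw']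

/-- homotopy fibre -/
@[reducible] def Fib {N N' : Tgt A} (φ : N.M →ₗ[k] N'.M) (hφ : IsMor N N' φ) : Tgt A where
  M := N.M × N'.M
  gm := fun j => (N.gm j).prod (N'.gm (j - 1))
  E := LinearMap.prodMap N.E (-N'.E)
  D := LinearMap.prod (N.D ∘ₗ LinearMap.fst _ _ _)
    (φ ∘ₗ LinearMap.fst _ _ _ - N'.D ∘ₗ LinearMap.snd _ _ _)
  L := (LinearMap.prodMapLinear k N.M N'.M N.M N'.M k) ∘ₗ (N.L.prod (N'.L ∘ₗ epz A 1))
  R := (LinearMap.prodMapLinear k N.M N'.M N.M N'.M k) ∘ₗ (N.R.prod N'.R)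
  L_one := fun ⟨n, n'⟩ => by simp [epz_one, N.L_one, N'.L_one]
  R_one := fun ⟨n, n'⟩ => by simp [N.R_one, N'.R_one]
  L_mul := fun x y ⟨n, n'⟩ => by simp [epz_mul, N.L_mul, N'.L_mul]
  R_mul := fun x y ⟨n, n'⟩ => by simp [N.R_mul, N'.R_mul]
  LR := fun x y ⟨n, n'⟩ => by simp [N.LR, N'.LR]
  DD := fun ⟨n, n'⟩ => by simp [N.DD, N'.DD, hφ.dd]
  DL := fun x ⟨n, n'⟩ => by
    simp [N.DL, N'.DL, hφ.l, ep_d, epz_self]; abel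
  DR := fun x ⟨n, n'⟩ => by
    simp [N.DR, N'.DR, hφ.r]; abel
  E_deg := fun j ⟨n, n'⟩ h => by
    obtain ⟨h1, h2⟩ := h
    simp at h1 h2
    simp [N.E_deg _ _ h1, N'.E_deg _ _ h2, sgnk_pred]
  L_deg := fun i j x ⟨n, n'⟩ hx h => by
    refine ⟨N.L_deg i j x n hx h.1, ?_⟩
    have := N'.L_deg i _ _ n' (epz_deg 1 hx) h.2
    rwa [← add_sub_assoc] at this
  R_deg := fun i j x ⟨n, n'⟩ hx h => by
    refine ⟨N.R_deg i j x n hx h.1, ?_⟩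
    have := N'.R_deg i _ _ n' hx h.2
    rwa [show j - 1 + i = j + i - 1 by ring] at this
  D_deg := fun j ⟨n, n'⟩ h => by
    refine ⟨N.D_deg j n h.1, ?_⟩
    have h1 := N'.D_deg _ n' h.2
    have h2 := hφ.deg j n h.1
    simp only [sub_add_cancel] at h1
    simp only [add_sub_cancel_right]
    exact sub_mem h2 h1

theorem QI.fib {N N' : Tgt A} {φ : N.M →ₗ[k] N'.M} (h : QI N N' φ) (hφ : IsMor N N' φ) :
    TAc (Fib φ hφ) := by
  rintro j ⟨n, n'⟩ ⟨h1, h2⟩ hD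
  simp only at h1 h2
  simp [sub_eq_zero] at hD
  obtain ⟨hD1, hD2⟩ := hD
  obtain ⟨n₀, h3, h4⟩ := h.inj j n h1 hD1 n' h2 hD2.symm
  obtain ⟨z, h5, h6, w, h7, h8⟩ := h.surj (j - 1) (n' - φ n₀) (sub_mem h2 (hφ.deg _ _ h3))
    (by rw [map_sub, ← hφ.dd, h4, hD2, sub_self])
  refine ⟨(n₀ + z, w), ⟨add_mem h3 h5, h7⟩, ?_⟩
  simp [h4, h6, ← h8]; abel

/-- K-projectivity with respect to all targets -/
def Proj (P : DGBimod A) : Prop := ∀ N : Tgt A, TAc N → ∀ f, IsMor (tg P) N f → Null (tg P) N f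

theorem TAc.sh {N : Tgt A} (h : TAc N) (m : ℤ) : TAc (Sh m N) := by
  intro j n hn hD
  have e : j - 1 + m = j + m - 1 := by ring
  obtain ⟨n₀, h1, h2⟩ := h (j + m) n hn (sgnk_smul_zero hD)
  refine ⟨sgnk k m • n₀, ?_, ?_⟩
  · show sgnk k m • n₀ ∈ N.gm (j - 1 + m)
    rw [e]; exact Submodule.smul_mem _ _ h1
  · show sgnk k m • N.D _ = n
    rw [map_smul, sgnk_smul_smul, h2]

theorem lift_aux {P : DGBimod A} {N N' : Tgt A} {φ : N.M →ₗ[k] N'.M}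
    (hφ : IsMor N N' φ) (hP : ∀ f, IsMor (tg P) (Sh 1 (Fib φ hφ)) f → Null (tg P) (Sh 1 (Fib φ hφ)) f)
    {f : P.M →ₗ[k] N'.M} (hf : IsMor (tg P) N' f) :
    ∃ g, IsMor (tg P) N g ∧ Null (tg P) N' (f - φ ∘ₗ g) := by
  obtain ⟨h, h1, h2⟩ := hP (LinearMap.prod 0 f)
    ⟨fun j m hm => ⟨zero_mem _, by
        show f m ∈ N'.gm (j + 1 - 1)
        rw [add_sub_cancel_right]; exact hf.deg j m hm⟩,
      fun x m => by simp [hf.l, epz_self], fun x m => by simp [hf.r],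
      fun m => by simp [hf.dd, sgnk_one]⟩
  simp [sgnk_one] at h2
  refine ⟨-(LinearMap.fst k N.M N'.M ∘ₗ h), IsMor.neg ⟨fun j m hm => ?_, fun x m => ?_,
    fun x m => ?_, fun m => ?_⟩, LinearMap.snd k N.M N'.M ∘ₗ h, ⟨fun j m hm => ?_, fun x m => ?_,
    fun x m => ?_⟩, fun m => ?_⟩
  · have := (h1.deg j m hm).1
    simpa using this
  · have := congrArg Prod.fst (h1.l x m)
    simpa [epz_self] using this
  · have := congrArg Prod.fst (h1.r x m)
    simpa [epz_self] using this
  · have := congrArg Prod.fst (h2 m)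
    simp at this
    exact (neg_add_eq_zero.mp this.symm).symm
  · have := (h1.deg j m hm).2
    simpa using this
  · have := congrArg Prod.snd (h1.l x m)
    simpa [epz_self] using this
  · have := congrArg Prod.snd (h1.r x m)
    simpa [epz_self] using this
  · have := congrArg Prod.snd (h2 m)
    simp at this
    simp [this]; abel

theorem Proj.lift {P : DGBimod A} (hP : Proj P) {N N' : Tgt A} {φ : N.M →ₗ[k] N'.M}
    (hφ : IsMor N N' φ) (hq : QI N N' φ) {f : P.M →ₗ[k] N'.M} (hf : IsMor (tg P) N' f) :
    ∃ g, IsMor (tg P) N g ∧ Null (tg P) N' (f - φ ∘ₗ g) :=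
  lift_aux hφ (fun f hf => hP _ ((hq.fib hφ).sh 1) f hf) hf

theorem Proj.inj {P : DGBimod A} (hP : Proj P) {N N' : Tgt A} {φ : N.M →ₗ[k] N'.M}
    (hφ : IsMor N N' φ) (hq : TAc (Fib φ hφ)) {g : P.M →ₗ[k] N.M} (hg : IsMor (tg P) N g)
    (hn : Null (tg P) N' (φ ∘ₗ g)) : Null (tg P) N g := by
  obtain ⟨γ, hγ, hγ'⟩ := hn
  have r1 := hg.l; have r2 := hg.r; have r3 := hg.dd
  have r4 := hγ.l; have r5 := hγ.r
  simp only at r1 r2 r3 r4 r5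
  obtain ⟨h, h1, h2⟩ := hP (Fib φ hφ) hq (LinearMap.prod g γ)
    ⟨fun j m hm => ⟨hg.deg j m hm, hγ.deg j m hm⟩, fun x m => by simp [r1, r4],
      fun x m => by simp [r2, r5], fun m => by
        have := hγ' m
        simp at this
        simp [r3, this]⟩
  refine ⟨LinearMap.fst k N.M N'.M ∘ₗ h, ⟨fun j m hm => (h1.deg j m hm).1, fun x m => ?_,
    fun x m => ?_⟩, fun m => ?_⟩
  · have := congrArg Prod.fst (h1.l x m)
    simpa [epz_self] using this
  · have := congrArg Prod.fst (h1.r x m)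
    simpa [epz_self] using this
  · have := congrArg Prod.fst (h2 m)
    simpa using this

/-- `x ⊗ y ↦ (φ x) n y` -/
def thet (N : Tgt A) (m : ℤ) (n : N.M) : (A.R ⊗[k] A.R) →ₗ[k] N.M :=
  TensorProduct.lift (LinearMap.mk₂ k (fun x y => N.L (epz A m x) (N.R y n))
    (by intros; simp) (by intros; simp) (by intros; simp) (by intros; simp))

@[simp] theorem thet_tmul (N : Tgt A) (m : ℤ) (n : N.M) (x y : A.R) :
    thet N m n (x ⊗ₜ y) = N.L (epz A m x) (N.R y n) := by simp [thet]

theorem biact_eq (T : DGBimod A) {q : ℤ} {e : T.M} (he : e ∈ T.gm q) (t : A.R ⊗[k] A.R) :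
    biact T t e = thet (tg T) q e t := by
  induction t with
  | zero => simp
  | add a b ha hb => simp [ha, hb]
  | tmul x y =>
    refine gr_ext A.gr (f := (biact T).flip e ∘ₗ (TensorProduct.mk k A.R A.R).flip y)
      (g := thet (tg T) q e ∘ₗ (TensorProduct.mk k A.R A.R).flip y) (fun i x hx => ?_) x
    have : DirectSum.decomposeLinearEquiv A.gr x
        = DirectSum.lof k ℤ (fun i => A.gr i) i ⟨x, hx⟩ := by
      exact DirectSum.decompose_of_mem A.gr hx
    simp [biact, this, biactAux, gop_of_mem T.gm _ he, epz_of_mem q hx, mul_comm]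
    rw [thet_tmul, epz_of_mem q hx]; simp

/-- Unsigned data of a twisted bimodule -/
structure Tw (T : DGBimod A) where
  s : ℕ
  q : Fin s → ℤ
  e : Fin s → T.M
  e_deg : ∀ j, e j ∈ T.gm (q j)
  tri : ∀ j, T.D (e j) ∈ biSpan T (e '' {i | i < j})
  bij : Function.Bijective (fun v : Fin s → A.R ⊗[k] A.R => ∑ j, thet (tg T) 0 (e j) (v j))

theorem IsTwistedB.tw {T : DGBimod A} (h : IsTwistedB T) : Nonempty (Tw T) := by
  obtain ⟨s, r, e, h1, h2, h3⟩ := h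
  refine ⟨⟨s, fun j => -(r j), e, h1, h2, ?_⟩⟩
  set τ : (Fin s → A.R ⊗[k] A.R) → (Fin s → A.R ⊗[k] A.R) := fun v j =>
    TensorProduct.map (epz A (-(r j))) LinearMap.id (v j) with hτ
  have hinv : Function.Involutive τ := by
    intro v
    funext j
    simp only [hτ]
    rw [← LinearMap.comp_apply, ← TensorProduct.map_comp]
    have : epz A (-(r j)) ∘ₗ epz A (-(r j)) = LinearMap.id := by
      ext x; simp [epz_self]
    rw [this]; simp
  have : (fun v : Fin s → A.R ⊗[k] A.R => ∑ j, thet (tg T) 0 (e j) (v j)) =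
      (fun v : Fin s → A.R ⊗[k] A.R => ∑ j, biact T (v j) (e j)) ∘ τ := by
    funext v
    simp only [Function.comp]
    refine Finset.sum_congr rfl fun j _ => ?_
    rw [biact_eq T (h1 j)]
    simp only [hτ]
    generalize v j = t
    induction t with
    | zero => simp
    | add a b ha hb => simp only [map_add, ha, hb]
    | tmul x y =>
      rw [TensorProduct.map_tmul, thet_tmul, thet_tmul, epz_self, epz_zero]; rfl
  rw [this]
  exact h3.comp hinv.bijective

theorem mem_biSpan_of {T : DGBimod A} {S : Set T.M} {t : T.M} (ht : t ∈ biSpan T S)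
    (p : Submodule k T.M) (hS : S ⊆ p) (hl : ∀ (x : A.R) (m : T.M), m ∈ p → T.actL x m ∈ p)
    (hr : ∀ (x : A.R) (m : T.M), m ∈ p → T.actR x m ∈ p) : t ∈ p := by
  rw [biSpan, Submodule.mem_sInf] at ht
  exact ht p ⟨hS, hl, hr⟩

namespace Tw
variable {T : DGBimod A} (W : Tw T)

/-- basis isomorphism -/
def iso : (Fin W.s → A.R ⊗[k] A.R) ≃ₗ[k] T.M :=
  LinearEquiv.ofBijective (∑ j, thet (tg T) 0 (W.e j) ∘ₗ LinearMap.proj j) (by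
    convert W.bij using 1
    funext v; simp)

theorem iso_apply (v) : W.iso v = ∑ j, thet (tg T) 0 (W.e j) (v j) := by
  simp [iso]

theorem iso_single (j : Fin W.s) (t : A.R ⊗[k] A.R) :
    W.iso (Pi.single j t) = thet (tg T) 0 (W.e j) t := by
  rw [iso_apply, Finset.sum_eq_single j]
  · simp
  · intro b _ hb; simp [Pi.single_eq_of_ne hb]
  · simp

theorem symm_gen (j : Fin W.s) (x y : A.R) :
    W.iso.symm (T.actL x (T.actR y (W.e j))) = Pi.single j (x ⊗ₜ y) := by
  rw [LinearEquiv.symm_apply_eq, iso_single, thet_tmul, epz_zero]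

theorem symm_e (j : Fin W.s) : W.iso.symm (W.e j) = Pi.single j (1 ⊗ₜ 1) := by
  rw [← symm_gen, T.actR_one, T.actL_one]

theorem ind_h (p : Submodule k T.M) (h : ∀ (j : Fin W.s) (a b : ℤ) (x y : A.R), x ∈ A.gr a →
    y ∈ A.gr b → T.actL x (T.actR y (W.e j)) ∈ p) (t : T.M) : t ∈ p := by
  obtain ⟨v, rfl⟩ := W.iso.surjective t
  rw [iso_apply]
  refine Submodule.sum_mem _ fun j _ => ?_
  generalize v j = u
  induction u with
  | zero => simp
  | add a b ha hb => rw [map_add]; exact add_mem ha hb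
  | tmul x y =>
    rw [thet_tmul, epz_zero]
    refine gr_le A.gr (p := p.comap ((tg T).L.flip ((tg T).R y (W.e j)))) (fun a x hx => ?_) x
    refine gr_le A.gr (p := p.comap ((tg T).L x ∘ₗ (tg T).R.flip (W.e j))) (fun b y hy => ?_) y
    exact h j a b x y hx hy

theorem gm_le (i : ℤ) (p : Submodule k T.M) (h : ∀ (j : Fin W.s) (a b : ℤ) (x y : A.R), x ∈ A.gr a →
    y ∈ A.gr b → a + b + W.q j = i → T.actL x (T.actR y (W.e j)) ∈ p) : T.gm i ≤ p := by
  intro t ht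
  rw [← gpr_same T.gm ht]
  refine W.ind_h (p.comap (gpr T.gm i)) (fun j a b x y hx hy => ?_) t
  simp only [Submodule.mem_comap]
  have hm := T.actL_deg a _ x _ hx (T.actR_deg b _ y _ hy (W.e_deg j))
  by_cases hi : a + (W.q j + b) = i
  · subst hi
    rw [gpr_same T.gm hm]
    exact h j a b x y hx hy (by ring)
  · rw [gpr_ne T.gm hi hm]; exact zero_mem _

/-- homotopy extension -/
def ext (N : Tgt A) (m : ℤ) (n : Fin W.s → N.M) : T.M →ₗ[k] N.M :=
  (∑ j, thet N m (n j) ∘ₗ LinearMap.proj j) ∘ₗ W.iso.symm.toLinearMap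

theorem ext_gen (N : Tgt A) (m : ℤ) (n : Fin W.s → N.M) (j : Fin W.s) (x y : A.R) :
    W.ext N m n (T.actL x (T.actR y (W.e j))) = N.L (epz A m x) (N.R y (n j)) := by
  simp only [ext, LinearMap.comp_apply, LinearEquiv.coe_coe, symm_gen]
  simp only [LinearMap.sum_apply, LinearMap.comp_apply, LinearMap.proj_apply]
  rw [Finset.sum_eq_single j]
  · simp
  · intro b _ hb; simp [Pi.single_eq_of_ne hb]
  · simp

theorem ext_e (N : Tgt A) (m : ℤ) (n : Fin W.s → N.M) (j : Fin W.s) :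
    W.ext N m n (W.e j) = n j := by
  have := W.ext_gen N m n j 1 1
  simpa [T.actR_one, T.actL_one, epz_one, N.L_one, N.R_one] using this

theorem ext_l (N : Tgt A) (m : ℤ) (n : Fin W.s → N.M) (x : A.R) (t : T.M) :
    W.ext N m n (T.actL x t) = N.L (epz A m x) (W.ext N m n t) := by
  refine W.ind_h (LinearMap.eqLocus (W.ext N m n ∘ₗ T.actL x) (N.L (epz A m x) ∘ₗ W.ext N m n))
    (fun j a b u v hu hv => ?_) t
  simp [LinearMap.mem_eqLocus, ← T.actL_mul, ext_gen, epz_mul, N.L_mul]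

theorem ext_r (N : Tgt A) (m : ℤ) (n : Fin W.s → N.M) (x : A.R) (t : T.M) :
    W.ext N m n (T.actR x t) = N.R x (W.ext N m n t) := by
  refine W.ind_h (LinearMap.eqLocus (W.ext N m n ∘ₗ T.actR x) (N.R x ∘ₗ W.ext N m n))
    (fun j a b u v hu hv => ?_) t
  simp [LinearMap.mem_eqLocus, ← T.actLR, ← T.actR_mul, ext_gen, ← N.LR, N.R_mul]

theorem ext_deg (N : Tgt A) (m c : ℤ) (n : Fin W.s → N.M) (hn : ∀ j, n j ∈ N.gm (W.q j + c))
    (i : ℤ) (t : T.M) (ht : t ∈ T.gm i) : W.ext N m n t ∈ N.gm (i + c) := by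
  refine W.gm_le i ((N.gm (i + c)).comap (W.ext N m n)) (fun j a b x y hx hy hs => ?_) ht
  simp only [Submodule.mem_comap, ext_gen]
  have := N.L_deg a _ _ _ (epz_deg m hx) (N.R_deg b _ y _ hy (hn j))
  rwa [show a + (W.q j + c + b) = i + c by rw [← hs]; ring] at this

theorem ext_ht (N : Tgt A) (n : Fin W.s → N.M) (hn : ∀ j, n j ∈ N.gm (W.q j - 1)) :
    IsHt (tg T) N (W.ext N 1 n) :=
  ⟨fun i t ht => W.ext_deg N 1 (-1) n hn i t ht, W.ext_l N 1 n, W.ext_r N 1 n⟩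

theorem ht_zero {N : Tgt A} {h : T.M →ₗ[k] N.M} (m : ℤ)
    (hl : ∀ x t, h (T.actL x t) = N.L (epz A m x) (h t))
    (hr : ∀ x t, h (T.actR x t) = N.R x (h t)) {S : Set T.M} (hS : ∀ t ∈ S, h t = 0)
    {t : T.M} (ht : t ∈ biSpan T S) : h t = 0 :=
  mem_biSpan_of ht (LinearMap.ker h) hS (fun x m hm => by simp_all) (fun x m hm => by simp_all)

theorem proj {T : DGBimod A} (W : Tw T) : Proj T := by
  intro N hN f hf
  have key : ∀ J : ℕ, J ≤ W.s → ∃ h, IsHt (tg T) N h ∧ ∀ l : Fin W.s, l.val < J →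
      f (W.e l) = N.D (h (W.e l)) + h (T.D (W.e l)) := by
    intro J
    induction J with
    | zero => exact fun _ => ⟨0, IsHt.zero _ _, fun l hl => absurd hl (by omega)⟩
    | succ J ih =>
      intro hJ
      obtain ⟨h, h1, h2⟩ := ih (by omega)
      set jj : Fin W.s := ⟨J, by omega⟩ with hjj
      set g := f - (N.D ∘ₗ h + h ∘ₗ T.D) with hg
      have hgm : IsMor (tg T) N g := hf.sub (ht_mor h1)
      have hg0 : g (T.D (W.e jj)) = 0 := by
        refine ht_zero (N := N) 0 (fun x t => by rw [epz_zero]; exact hgm.l x t) hgm.r ?_ (W.tri jj)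
        rintro _ ⟨l, hl, rfl⟩
        have := h2 l hl
        simp [hg, this]
      obtain ⟨w, hw1, hw2⟩ := hN (W.q jj) (g (W.e jj)) (hgm.deg _ _ (W.e_deg jj))
        (by rw [← hgm.dd]; exact hg0)
      set δ := W.ext N 1 (Pi.single jj w) with hδ
      have hδh : IsHt (tg T) N δ := W.ext_ht N _ (fun j => by
        by_cases hj : j = jj
        · subst hj; simpa using hw1
        · simp [Pi.single_eq_of_ne hj])
      have hδ0 : ∀ l : Fin W.s, l.val ≤ J → δ (T.D (W.e l)) = 0 := by
        intro l hl
        refine ht_zero (N := N) 1 (W.ext_l N 1 _) (W.ext_r N 1 _) ?_ (W.tri l)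
        rintro _ ⟨i, hi, rfl⟩
        have hne : i ≠ jj := by
          rintro rfl
          have : J < l.val := hi
          omega
        rw [ext_e, Pi.single_eq_of_ne hne]
      refine ⟨h + δ, h1.add hδh, fun l hl => ?_⟩
      have e1 : (h + δ) (T.D (W.e l)) = h (T.D (W.e l)) := by
        rw [LinearMap.add_apply, hδ0 l (by omega), add_zero]
      rw [e1]
      by_cases hlj : l = jj
      · subst hlj
        have : δ (W.e jj) = w := by rw [hδ, ext_e]; simp
        rw [LinearMap.add_apply, this, map_add, hw2, hg]
        simp; abel
      · have : δ (W.e l) = 0 := by rw [hδ, ext_e, Pi.single_eq_of_ne hlj]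
        rw [LinearMap.add_apply, this, add_zero]
        refine h2 l ?_
        have : l.val ≠ J := fun h => hlj (Fin.ext h)
        omega
  obtain ⟨h, h1, h2⟩ := key W.s le_rfl
  refine ⟨h, h1, fun t => ?_⟩
  have hgm : IsMor (tg T) N (f - (N.D ∘ₗ h + h ∘ₗ T.D)) := hf.sub (ht_mor h1)
  have e1 := hgm.l; have e2 := hgm.r
  have : t ∈ LinearMap.ker (f - (N.D ∘ₗ h + h ∘ₗ T.D)) := by
    refine W.ind_h _ (fun j a b x y hx hy => ?_) t
    rw [LinearMap.mem_ker]
    simp only at e1 e2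
    rw [e1, e2]
    have : (f - (N.D ∘ₗ h + h ∘ₗ T.D)) (W.e j) = 0 := by simp [h2 j j.2]
    rw [this]; simp
  simpa [sub_eq_zero] using this

end Tw

theorem Proj.summand {P T : DGBimod A} (hT : Proj T) {ι : P.M →ₗ[k] T.M} {ρ : T.M →ₗ[k] P.M}
    (hι : IsMor (tg P) (tg T) ι) (hρ : IsMor (tg T) (tg P) ρ)
    (hn : Null (tg P) (tg P) (ρ ∘ₗ ι - LinearMap.id)) : Proj P := by
  intro N hN f hf
  have h1 : Null (tg P) N ((f ∘ₗ ρ) ∘ₗ ι) := (hT N hN _ (hf.comp hρ)).comp hι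
  have h2 : Null (tg P) N (f ∘ₗ (ρ ∘ₗ ι - LinearMap.id)) := hf.compNull hn
  have : f = (f ∘ₗ ρ) ∘ₗ ι - f ∘ₗ (ρ ∘ₗ ι - LinearMap.id) := by ext; simp
  rw [this]; exact h1.sub h2

theorem b_gpr_D (X : DGBimod A) (j : ℤ) (x : X.M) :
    gpr X.gm (j + 1) (X.D x) = X.D (gpr X.gm j x) := by
  refine gr_ext X.gm (f := gpr X.gm (j + 1) ∘ₗ X.D) (g := X.D ∘ₗ gpr X.gm j) (fun i x hx => ?_) x
  by_cases h : i = j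
  · subst h
    simp [gpr_same X.gm hx, gpr_same X.gm (X.D_deg _ _ hx)]
  · have : i + 1 ≠ j + 1 := by omega
    simp [gpr_ne X.gm h hx, gpr_ne X.gm this (X.D_deg _ _ hx)]

theorem b_exact (X : DGBimod A) {j : ℤ} {x : X.M} (hx : x ∈ Bg X.gm X.D j) :
    ∃ y ∈ X.gm (j - 1), X.D y = x := by
  obtain ⟨h1, y, rfl⟩ := hx
  refine ⟨gpr X.gm (j - 1) y, gpr_mem _ _ _, ?_⟩
  rw [← b_gpr_D, sub_add_cancel, gpr_same X.gm h1]

theorem QIsoData.qi {X Y : DGBimod A} {f : X.M →ₗ[k] Y.M} (h : QIsoData X.gm X.D Y.gm Y.D f) :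
    QI (tg X) (tg Y) f := by
  obtain ⟨h1, h2, h3⟩ := h
  constructor
  · intro j n hn hD n' hn' hD'
    refine b_exact X ((h3 j).2 n ⟨hn, hD⟩ ⟨(h1 j n ⟨hn, hD⟩).1, ⟨n', hD'⟩⟩)
  · intro j n' hn' hD'
    obtain ⟨w, ⟨hw1, hw2⟩, hw3⟩ := (h3 j).1 n' ⟨hn', hD'⟩
    obtain ⟨y, hy1, hy2⟩ := b_exact Y hw3
    exact ⟨w, hw1, hw2, y, hy1, hy2.symm⟩

theorem qi_of_comp {N₀ N N' : Tgt A} {f₀ : N₀.M →ₗ[k] N'.M} {f : N.M →ₗ[k] N'.M}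
    {g : N₀.M →ₗ[k] N.M} (hf : IsMor N N' f) (hg : IsMor N₀ N g) (q₀ : QI N₀ N' f₀) (q : QI N N' f)
    (hn : Null N₀ N' (f₀ - f ∘ₗ g)) : QI N₀ N g := by
  obtain ⟨h, h1, h2⟩ := hn
  constructor
  · intro j n hn hD n' hn' hD'
    refine q₀.inj j n hn hD (f n' + h n) (add_mem (hf.deg _ _ hn') (h1.deg _ _ hn)) ?_
    have := h2 n
    rw [hD, map_zero, add_zero] at this
    simp at this
    rw [map_add, ← this, ← hf.dd, hD']; abel
  · intro j n' hn' hD'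
    obtain ⟨n, a1, a2, w, a3, a4⟩ := q₀.surj j (f n') (hf.deg _ _ hn') (by rw [← hf.dd, hD', map_zero])
    have := h2 n
    rw [a2, map_zero, add_zero] at this
    simp at this
    obtain ⟨n₀, b1, b2⟩ := q.inj j (g n - n') (sub_mem (hg.deg _ _ a1) hn')
      (by rw [map_sub, ← hg.dd, a2, hD']; simp) (w - h n) (sub_mem a3 (h1.deg _ _ a1)) (by
        rw [map_sub, ← this, ← a4, map_sub]; abel)
    exact ⟨n, a1, a2, n₀, b1, b2.symm⟩

/-- a target with a decomposition is a bimodule -/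
@[reducible] def toB (N : Tgt A) [DirectSum.Decomposition N.gm] : DGBimod A where
  M := N.M
  gm := N.gm
  actL := N.L
  actR := N.R
  actL_one := N.L_one
  actR_one := N.R_one
  actL_mul := N.L_mul
  actR_mul := N.R_mul
  actLR := N.LR
  actL_deg := N.L_deg
  actR_deg := N.R_deg
  D := N.D
  D_deg := N.D_deg
  D_sq := N.DD
  leibnizL := fun i j x m hx hm => by
    rw [N.DL, ep_of_mem hx, sgnz_smul (k := k)]; simp
  leibnizR := fun i j x m hx hm => by
    rw [N.DR, N.E_deg j m hm, sgnz_smul (k := k)]; simp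

theorem HoProj.null {P : DGBimod A} (hP : IsHoProjB P) (N : Tgt A) [DirectSum.Decomposition N.gm]
    (hN : TAc N) (f) (hf : IsMor (tg P) N f) : Null (tg P) N f := by
  have h := hP (toB N) (fun n x hx => by
    obtain ⟨y, hy, hy'⟩ := hN n x hx.1 hx.2
    exact ⟨hx.1, y, hy'⟩) ⟨f, hf.deg, hf.l, hf.r, hf.dd⟩
  rw [homotopic_iff] at h
  obtain ⟨h, h1, h2⟩ := h
  refine ⟨h, ⟨h1.deg, h1.l, h1.r⟩, fun m => ?_⟩
  have := h2 m
  exact (sub_zero (f m)).symm.trans this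

theorem exists_dec {M : Type} [AddCommGroup M] [Module k M] (gm : ℤ → Submodule k M)
    (π : ℤ → M →ₗ[k] M) (h1 : ∀ j, ∀ x ∈ gm j, π j x = x)
    (h2 : ∀ i j, i ≠ j → ∀ x ∈ gm i, π j x = 0)
    (h3 : ∀ p : Submodule k M, (∀ j, gm j ≤ p) → ∀ x, x ∈ p) :
    Nonempty (DirectSum.Decomposition gm) := by
  classical
  have : DirectSum.IsInternal gm := by
    rw [DirectSum.isInternal_submodule_iff_iSupIndep_and_iSup_eq_top]
    refine ⟨fun i => ?_, ?_⟩
    · rw [Submodule.disjoint_def]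
      intro x hx hx'
      rw [← h1 i x hx]
      have : (⨆ j, ⨆ (_ : j ≠ i), gm j) ≤ LinearMap.ker (π i) :=
        iSup_le fun j => iSup_le fun hj => fun x hx => h2 j i hj x hx
      exact this hx'
    · rw [eq_top_iff]
      intro x _
      exact h3 _ (fun j => le_iSup gm j) x
  exact ⟨this.chooseDecomposition⟩

theorem fib_dec {X Y : DGBimod A} {φ : X.M →ₗ[k] Y.M} (hφ : IsMor (tg X) (tg Y) φ) :
    Nonempty (DirectSum.Decomposition (Sh 1 (Fib (N := tg X) (N' := tg Y) φ hφ)).gm) := by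
  refine exists_dec _ (fun j => LinearMap.prodMap (gpr X.gm (j + 1)) (gpr Y.gm (j + 1 - 1))) ?_ ?_ ?_
  · rintro j ⟨x, y⟩ ⟨h1, h2⟩
    simp only [LinearMap.prodMap_apply]
    rw [gpr_same X.gm h1, gpr_same Y.gm h2]
  · rintro i j hij ⟨x, y⟩ ⟨h1, h2⟩
    simp only [LinearMap.prodMap_apply]
    rw [gpr_ne X.gm (by omega) h1, gpr_ne Y.gm (by omega) h2]; rfl
  · rintro p hp ⟨x, y⟩
    have : ((x, y) : X.M × Y.M) = LinearMap.inl k _ _ x + LinearMap.inr k _ _ y := by simp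
    rw [this]
    refine add_mem ?_ ?_
    · refine gr_le X.gm (p := p.comap (LinearMap.inl k X.M Y.M)) (fun j z hz => ?_) x
      refine hp (j - 1) ⟨?_, zero_mem _⟩
      simpa using hz
    · refine gr_le Y.gm (p := p.comap (LinearMap.inr k X.M Y.M)) (fun j z hz => ?_) y
      refine hp j ⟨zero_mem _, ?_⟩
      simpa using hz

/-- the diagonal as a target -/
@[reducible] def dT (A : DGAlgebra k) : Tgt A where
  M := A.R
  gm := A.gr
  E := epz A 1
  D := A.d
  L := LinearMap.mul k A.R
  R := (LinearMap.mul k A.R).flip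
  L_one := fun m => by simp
  R_one := fun m => by simp
  L_mul := fun x y m => by simp [mul_assoc]
  R_mul := fun x y m => by simp [mul_assoc]
  LR := fun x y m => by simp [mul_assoc]
  DD := A.d_sq
  DL := fun x m => by simp [d_mul]
  DR := fun x m => by simp [d_mul]
  E_deg := fun j m h => ep_of_mem h
  L_deg := fun i j x m hx hm => A.mul_mem hx hm
  R_deg := fun i j x m hx hm => A.mul_mem hm hx
  D_deg := A.d_deg

/-- Data about the resolution extracted from smoothness -/
theorem smooth_data (hs : IsSmooth A) (P : DGBimod A) (F : BimodHom P (diagBimod A))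
    (hPF : IsDiagResolution P F) : ∃ (T : DGBimod A) (W : Tw T) (ι : P.M →ₗ[k] T.M)
      (ρ : T.M →ₗ[k] P.M), IsMor (tg P) (tg T) ι ∧ IsMor (tg T) (tg P) ρ ∧
      Null (tg P) (tg P) (ρ ∘ₗ ι - LinearMap.id) ∧ Proj P ∧
      ∃ f : P.M →ₗ[k] A.R, IsMor (tg P) (dT A) f ∧ QI (tg P) (dT A) f := by
  obtain ⟨T, P₀, hT, ⟨ι₀, ρ₀, hn₀⟩, F₀, hF₀⟩ := hs
  obtain ⟨W⟩ := hT.tw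
  rw [homotopic_iff] at hn₀
  have hP₀ : Proj P₀ := W.proj.summand ι₀.mor ρ₀.mor hn₀
  have qF := hPF.2.qi
  have qF₀ := hF₀.qi
  obtain ⟨G', hG', hn'⟩ := hP₀.lift F.mor qF F₀.mor
  have qG := qi_of_comp F.mor hG' qF₀ qF hn'
  obtain ⟨dec⟩ := fib_dec hG'
  have key : ∃ g, IsMor (tg P) (tg P₀) g ∧ Null (tg P) (tg P) (LinearMap.id - G' ∘ₗ g) := by
    refine lift_aux hG' ?_ (IsMor.id _)
    exact fun f hf => HoProj.null hPF.1 _ ((qG.fib hG').sh 1) f hf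
  obtain ⟨G, hG, hGn⟩ := key
  have e : Null (tg P) (tg P) ((G' ∘ₗ ρ₀.f) ∘ₗ (ι₀.f ∘ₗ G) - LinearMap.id) := by
    have h1 := (hG'.compNull hn₀).comp hG
    have h2 : (G' ∘ₗ ρ₀.f) ∘ₗ (ι₀.f ∘ₗ G) - LinearMap.id
      = (G' ∘ₗ ((ρ₀.comp ι₀).f - (BimodHom.id P₀).f)) ∘ₗ G - (LinearMap.id - G' ∘ₗ G) := by
      ext x
      simp [BimodHom.comp, BimodHom.id]
    rw [h2]; exact h1.sub hGn
  exact ⟨T, W, _, _, ι₀.mor.comp hG, hG'.comp ρ₀.mor, e,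
    W.proj.summand (ι₀.mor.comp hG) (hG'.comp ρ₀.mor) e,
    F.f, ⟨F.deg, F.actLc, F.actRc, F.comm⟩, ⟨qF.inj, qF.surj⟩⟩

theorem HH_subsing {P : DGBimod A} {n : ℤ}
    (h : ∀ x ∈ HHZ P n, x ∈ commSub P ⊔ LinearMap.range P.D) : Subsingleton (HHspace P n) := by
  unfold HHspace
  rw [Submodule.Quotient.subsingleton_iff, eq_top_iff]
  rintro ⟨x, hx⟩ _
  exact ⟨⟨hx.1, h x hx⟩, hx⟩

theorem ht_comm {P : DGBimod A} {h : P.M →ₗ[k] P.M} (hh : IsHt (tg P) (tg P) h) {x : P.M}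
    (hx : x ∈ commSub P) : h x ∈ commSub P := by
  have : commSub P ≤ (commSub P).comap h := by
    conv_lhs => rw [commSub]
    rw [Submodule.span_le]
    rintro _ ⟨i, j, x, m, hx, hm, rfl⟩
    have e : h (P.actL x m - sgnz (i * j) • P.actR x m)
        = sgnk k i • (P.actL x (h m) - sgnz (i * (j - 1)) • P.actR x (h m)) := by
      have e1 := hh.l x m; have e2 := hh.r x m
      simp only at e1 e2
      rw [map_sub, sgnz_smul (k := k), sgnz_smul (k := k), map_smul, e1, e2, ep_of_mem hx]
      rw [smul_sub, smul_smul, mul_sub, mul_one, sub_eq_add_neg (i * j), sgnk_add, sgnk_neg]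
      rw [mul_left_comm, sgnk_sq, mul_one]; simp
    simp only [Submodule.comap_coe, Set.mem_preimage, SetLike.mem_coe]
    rw [e]
    exact Submodule.smul_mem _ _ (Submodule.subset_span ⟨i, j - 1, x, h m, hx, hh.deg j m hm, rfl⟩)
  exact this hx

/-- truncated grading -/
def trg (P : DGBimod A) (j : ℤ) : Submodule k P.M :=
  if j < 0 then P.gm j else if j = 0 then P.gm 0 ⊓ LinearMap.ker P.D else ⊥

theorem trg_neg (P : DGBimod A) {j : ℤ} (h : j < 0) : trg P j = P.gm j := by simp [trg, h]
theorem trg_zero (P : DGBimod A) : trg P 0 = P.gm 0 ⊓ LinearMap.ker P.D := by simp [trg]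
theorem trg_pos (P : DGBimod A) {j : ℤ} (h : 0 < j) : trg P j = ⊥ := by
  simp [trg, not_lt.2 h.le, h.ne']

theorem trg_le (P : DGBimod A) (j : ℤ) : trg P j ≤ P.gm j := by
  rcases lt_trichotomy j 0 with h | h | h
  · rw [trg_neg P h]
  · subst h; rw [trg_zero]; exact inf_le_left
  · rw [trg_pos P h]; exact bot_le

/-- truncation -/
@[reducible] def trunc (hconc : ∀ i : ℤ, 0 < i → A.gr i = ⊥) (P : DGBimod A) : Tgt A :=
  { tg P with
    gm := trg P
    E_deg := fun j m h => bE_of_mem P (trg_le P j h)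
    L_deg := fun i j x m hx hm => by
      rcases lt_or_ge 0 i with hi | hi
      · rw [hconc i hi, Submodule.mem_bot] at hx
        subst hx; simp
      rcases lt_trichotomy j 0 with h | h | h
      · rw [trg_neg P (by omega)]
        exact P.actL_deg i j x m hx (trg_le P j hm)
      · subst h
        have := P.actL_deg i 0 x m hx (trg_le P 0 hm)
        rcases hi.lt_or_eq with hi | hi
        · rw [trg_neg P (by omega)]; exact this
        · subst hi
          rw [trg_zero] at hm
          have hd : A.d x = 0 := by
            have := A.d_deg 0 x hx
            rwa [hconc _ (by norm_num), Submodule.mem_bot] at this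
          rw [add_zero, trg_zero]
          refine ⟨by simpa using this, ?_⟩
          change P.D _ = 0
          rw [b_DL, hd, show P.D m = 0 from hm.2]; simp
      · rw [trg_pos P h, Submodule.mem_bot] at hm
        subst hm; simp
    R_deg := fun i j x m hx hm => by
      rcases lt_or_ge 0 i with hi | hi
      · rw [hconc i hi, Submodule.mem_bot] at hx
        subst hx; simp
      rcases lt_trichotomy j 0 with h | h | h
      · rw [trg_neg P (by omega)]
        exact P.actR_deg i j x m hx (trg_le P j hm)
      · subst h
        have := P.actR_deg i 0 x m hx (trg_le P 0 hm)
        rcases hi.lt_or_eq with hi | hi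
        · rw [trg_neg P (by omega)]; exact this
        · subst hi
          rw [trg_zero] at hm
          have hd : A.d x = 0 := by
            have := A.d_deg 0 x hx
            rwa [hconc _ (by norm_num), Submodule.mem_bot] at this
          rw [add_zero, trg_zero]
          refine ⟨by simpa using this, ?_⟩
          change P.D _ = 0
          rw [b_DR, hd, show P.D m = 0 from hm.2]; simp
      · rw [trg_pos P h, Submodule.mem_bot] at hm
        subst hm; simp
    D_deg := fun j m hm => by
      have h1 := P.D_deg j m (trg_le P j hm)
      rcases lt_trichotomy j 0 with h | h | h
      · rcases (show j + 1 ≤ 0 by omega).lt_or_eq with h' | h'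
        · rw [trg_neg P h']; exact h1
        · rw [h'] at h1 ⊢
          rw [trg_zero]
          exact ⟨h1, P.D_sq m⟩
      · subst h
        rw [trg_zero] at hm
        have : P.D m = 0 := hm.2
        simp only [this]; exact zero_mem _
      · rw [trg_pos P h, Submodule.mem_bot] at hm
        subst hm; simp }

theorem trunc_mor (hconc : ∀ i : ℤ, 0 < i → A.gr i = ⊥) (P : DGBimod A) :
    IsMor (trunc hconc P) (tg P) LinearMap.id :=
  ⟨fun j m h => trg_le P j h, fun _ _ => rfl, fun _ _ => rfl, fun _ => rfl⟩

theorem trunc_qi (hconc : ∀ i : ℤ, 0 < i → A.gr i = ⊥) (P : DGBimod A)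
    (F : P.M →ₗ[k] A.R) (hF : IsMor (tg P) (dT A) F) (q : QI (tg P) (dT A) F) :
    QI (trunc hconc P) (tg P) LinearMap.id := by
  constructor
  · intro j n hn hD n' hn' hD'
    rcases lt_or_ge 0 j with hj | hj
    · refine ⟨0, zero_mem _, ?_⟩
      change n ∈ trg P j at hn
      rw [trg_pos P hj, Submodule.mem_bot] at hn
      rw [hn]; simp
    · refine ⟨n', ?_, hD'⟩
      change n' ∈ trg P (j - 1)
      rw [trg_neg P (by omega)]; exact hn'
  · intro j n' hn' hD'
    rcases lt_or_ge 0 j with hj | hj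
    · have hF : F n' = 0 := by
        have : F n' ∈ A.gr j := hF.deg j n' hn'
        rwa [hconc j hj, Submodule.mem_bot] at this
      obtain ⟨n₀, h1, h2⟩ := q.inj j n' hn' hD' 0 (zero_mem _) (by rw [hF]; simp)
      exact ⟨0, zero_mem _, by simp, -n₀, neg_mem h1, by rw [map_neg, h2]; simp⟩
    · refine ⟨n', ?_, hD', 0, zero_mem _, by simp⟩
      change n' ∈ trg P j
      rcases hj.lt_or_eq with h | h
      · rw [trg_neg P h]; exact hn'
      · subst h; rw [trg_zero]; exact ⟨hn', hD'⟩

theorem HH_pos (hconc : ∀ i : ℤ, 0 < i → A.gr i = ⊥) (P : DGBimod A)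
    (F : P.M →ₗ[k] A.R) (hF : IsMor (tg P) (dT A) F) (q : QI (tg P) (dT A) F) (hP : Proj P)
    (n : ℤ) (hn : 0 < n) : Subsingleton (HHspace P n) := by
  refine HH_subsing fun x hx => ?_
  obtain ⟨g, hg, h, h1, h2⟩ := hP.lift (trunc_mor hconc P) (trunc_qi hconc P F hF q) (IsMor.id _)
  have hgx : g x = 0 := by
    have := hg.deg n x hx.1
    change g x ∈ trg P n at this
    rwa [trg_pos P hn, Submodule.mem_bot] at this
  have := h2 x
  simp [hgx] at this
  rw [this, add_comm]
  exact Submodule.add_mem_sup (ht_comm h1 hx.2) ⟨_, rfl⟩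

/-- the dual bimodule -/
@[reducible] def Adual (A : DGAlgebra k) : Tgt A where
  M := A.R →ₗ[k] k
  gm := dualGrade A.gr
  E := LinearMap.lcomp k k (epz A 1)
  D := -LinearMap.lcomp k k (A.d ∘ₗ epz A 1)
  L := LinearMap.mk₂ k (fun x ν => ν ∘ₗ (LinearMap.mul k A.R).flip x)
    (by intros; ext; simp) (by intros; ext; simp) (by intros; ext; simp) (by intros; ext; simp)
  R := LinearMap.mk₂ k (fun x ν => ν ∘ₗ (LinearMap.mul k A.R) (epz A 1 x))
    (by intros; ext; simp) (by intros; ext; simp) (by intros; ext; simp) (by intros; ext; simp)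
  L_one := fun ν => by ext c; simp
  R_one := fun ν => by ext c; simp [epz_one]
  L_mul := fun x y ν => by ext c; simp [mul_assoc]
  R_mul := fun x y ν => by ext c; simp [mul_assoc, epz_mul]
  LR := fun x y ν => by ext c; simp [mul_assoc]
  DD := fun ν => by ext c; simp [ep_d, A.d_sq]
  DL := fun x ν => by
    ext c; simp [epz_mul, d_mul, epz_self]
  DR := fun x ν => by
    ext c; simp [epz_mul, d_mul, epz_self]
  E_deg := fun j ν h => by
    ext c
    refine gr_ext A.gr (f := ν ∘ₗ epz A 1) (g := sgnk k j • ν) (fun l c hc => ?_) c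
    simp only [LinearMap.comp_apply, ep_of_mem hc, map_smul, LinearMap.smul_apply]
    by_cases hl : l = -j
    · rw [hl, sgnk_neg]
    · rw [h l hl c hc]; simp
  L_deg := fun i j x ν hx h l hl c hc => by
    simp only [LinearMap.mk₂_apply, LinearMap.comp_apply, LinearMap.flip_apply,
      LinearMap.mul_apply']
    exact h (l + i) (by omega) _ (A.mul_mem hc hx)
  R_deg := fun i j x ν hx h l hl c hc => by
    simp only [LinearMap.mk₂_apply, LinearMap.comp_apply, LinearMap.mul_apply']
    exact h (i + l) (by omega) _ (A.mul_mem (epz_deg 1 hx) hc)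
  D_deg := fun j ν h l hl c hc => by
    have := h (l + 1) (by omega) _ (A.d_deg l _ (epz_deg 1 hc))
    simp [this]

theorem HH_neg {P : DGBimod A} (m : ℤ)
    (hyp : ∀ f, IsMor (tg P) (Sh m (Adual A)) f → Null (tg P) (Sh m (Adual A)) f) :
    Subsingleton (HHspace P (-m)) := by
  refine HH_subsing fun x hx => ?_
  by_contra hxn
  obtain ⟨τ₀, h1, h2⟩ := Submodule.exists_le_ker_of_notMem hxn
  have hcomm : ∀ z ∈ commSub P, τ₀ z = 0 := fun z hz => h2 (Submodule.mem_sup_left hz)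
  have hDz : ∀ z, τ₀ (P.D z) = 0 := fun z => h2 (Submodule.mem_sup_right ⟨z, rfl⟩)
  set τ : P.M →ₗ[k] k := τ₀ ∘ₗ gpr P.gm (-m) with hτ
  have τD : ∀ z, τ (P.D z) = 0 := by
    intro z
    have := b_gpr_D P (-m - 1) z
    rw [sub_add_cancel] at this
    rw [hτ, LinearMap.comp_apply, this, hDz]
  have τne : ∀ {j : ℤ} {z : P.M}, j ≠ -m → z ∈ P.gm j → τ z = 0 := by
    intro j z hj hz
    rw [hτ, LinearMap.comp_apply, gpr_ne P.gm hj hz, map_zero]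
  have τc : ∀ (x : A.R) (p : P.M), τ (P.actL x p) = τ (P.actR (epz A (m + 1) x) p) := by
    intro x p
    refine gr_ext A.gr (f := τ ∘ₗ P.actL.flip p) (g := τ ∘ₗ P.actR.flip p ∘ₗ epz A (m + 1))
      (fun i x hx => ?_) x
    refine gr_ext P.gm (f := τ ∘ₗ P.actL x) (g := τ ∘ₗ P.actR (epz A (m + 1) x))
      (fun j p hp => ?_) p
    have e1 := P.actL_deg i j x p hx hp
    have e2 := P.actR_deg i j x p hx hp
    simp only [LinearMap.comp_apply, epz_of_mem _ hx, map_smul, LinearMap.smul_apply]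
    by_cases hij : i + j = -m
    · rw [hτ, LinearMap.comp_apply, LinearMap.comp_apply]
      rw [add_comm j i] at e2
      rw [hij] at e1 e2
      rw [gpr_same P.gm e1, gpr_same P.gm e2]
      have := hcomm _ (Submodule.subset_span ⟨i, j, x, p, hx, hp, rfl⟩)
      rw [map_sub, sub_eq_zero, sgnz_smul (k := k), map_smul] at this
      rw [this]
      congr 1
      unfold sgnk
      have hj : j = -m - i := by omega
      have : Even (i * j) ↔ Even ((m + 1) * i) := by
        rw [hj]; simp only [Int.even_mul, Int.even_sub, Int.even_add, even_neg, Int.not_even_one]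
        tauto
      simp only [this]
    · rw [τne hij e1, τne (by omega) e2, smul_zero]
  set f : P.M →ₗ[k] (A.R →ₗ[k] k) := LinearMap.mk₂ k (fun p c => τ (P.actL (epz A m c) p))
    (by intros; simp) (by intros; simp) (by intros; simp) (by intros; simp) with hf
  have hfa : ∀ p c, f p c = τ (P.actL (epz A m c) p) := fun p c => rfl
  have hfm : IsMor (tg P) (Sh m (Adual A)) f := by
    refine ⟨fun j p hp l hl c hc => ?_, fun x p => ?_, fun x p => ?_, fun p => ?_⟩
    · rw [hfa]
      exact τne (by omega) (P.actL_deg l j _ p (epz_deg m hc) hp)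
    · ext c
      simp only [hfa, LinearMap.comp_apply, LinearMap.mk₂_apply, LinearMap.flip_apply,
        LinearMap.mul_apply', epz_mul, epz_self, P.actL_mul]
    · ext c
      simp only [hfa, LinearMap.comp_apply, LinearMap.mk₂_apply, LinearMap.flip_apply,
        LinearMap.mul_apply', epz_mul, P.actL_mul, epz_epz]
      rw [τc (epz A (m + 1) x), epz_self, P.actLR]
    · ext c
      simp only [hfa, LinearMap.smul_apply, LinearMap.neg_apply, LinearMap.lcomp_apply,
        LinearMap.comp_apply]
      have e := τD (P.actL (epz A 1 (epz A m c)) p)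
      rw [b_DL, epz_self, map_add, epz_epz, add_comm 1 m, ← epz_epz, epz_d] at e
      simp only [map_smul, LinearMap.smul_apply] at e
      rw [smul_neg]
      exact eq_neg_of_add_eq_zero_right e
  obtain ⟨h, hh1, hh2⟩ := hyp f hfm
  have hτσ : ∀ p, τ p = h (P.D p) 1 := by
    intro p
    have := congrArg (fun ν : A.R →ₗ[k] k => ν 1) (hh2 p)
    simpa [hfa, epz_one, P.actL_one, d_one] using this
  have hσ : ∀ z ∈ commSub P, h z 1 = 0 := by
    intro z hz
    have : commSub P ≤ LinearMap.ker ((LinearMap.applyₗ (1 : A.R)) ∘ₗ h) := by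
      rw [commSub, Submodule.span_le]
      rintro _ ⟨i, j, x, p, hx, hp, rfl⟩
      have e1 : h (P.actL x p) 1 = h p (1 * epz A m (epz A 1 x)) :=
        congrArg (fun ν : A.R →ₗ[k] k => ν 1) (hh1.l x p)
      have e2 : h (P.actR x p) 1 = h p (epz A 1 x * 1) :=
        congrArg (fun ν : A.R →ₗ[k] k => ν 1) (hh1.r x p)
      rw [one_mul, epz_epz, epz_of_mem _ hx, map_smul] at e1
      rw [mul_one, epz_of_mem _ hx, map_smul] at e2
      rw [SetLike.mem_coe, LinearMap.mem_ker, LinearMap.comp_apply, map_sub, sgnz_smul (k := k),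
        map_smul, map_sub, map_smul]
      change h (P.actL x p) 1 - _ • (h (P.actR x p) 1) = 0
      rw [e1, e2]
      simp only [smul_eq_mul]
      by_cases hij : i = -(j - 1 + m)
      · have : sgnk k ((m + 1) * i) = sgnk k (i * j) * sgnk k (1 * i) := by
          rw [← sgnk_add]
          unfold sgnk
          have hj : j = -m - i + 1 := by omega
          have : Even ((m + 1) * i) ↔ Even (i * j + 1 * i) := by
            rw [hj]; simp only [Int.even_mul, Int.even_sub, Int.even_add, even_neg, Int.not_even_one]
            tauto
          simp only [this]
        rw [this]; ring
      · rw [hh1.deg j p hp i hij x hx]; simp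
    exact this hz
  apply h1
  have : τ x = τ₀ x := by rw [hτ, LinearMap.comp_apply, gpr_same P.gm hx.1]
  rw [← this, hτσ]
  exact hσ _ hx.2

section gsumsec
variable {M W : Type} [AddCommGroup M] [Module k M] [AddCommGroup W] [Module k W]
  (gm : ℤ → Submodule k M) [DirectSum.Decomposition gm]

/-- degreewise definition of a linear map -/
def gsum (c : ℤ → (M →ₗ[k] W)) : M →ₗ[k] W :=
  (DirectSum.toModule k ℤ W (fun j => c j ∘ₗ (gm j).subtype)) ∘ₗ
    (DirectSum.decomposeLinearEquiv gm).toLinearMap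

theorem gsum_of_mem (c : ℤ → (M →ₗ[k] W)) {j : ℤ} {x : M} (hx : x ∈ gm j) :
    gsum gm c x = c j x := by
  have : DirectSum.decomposeLinearEquiv gm x = DirectSum.lof k ℤ (fun i => gm i) j ⟨x, hx⟩ := by
    exact DirectSum.decompose_of_mem gm hx
  simp [gsum, this]

end gsumsec

theorem exists_sect {M : Type} [AddCommGroup M] [Module k M] (D : M →ₗ[k] M)
    (U V : Submodule k M) (h : ∀ x ∈ V, ∃ y ∈ U, D y = x) :
    ∃ σ : M →ₗ[k] M, ∀ x ∈ V, σ x ∈ U ∧ D (σ x) = x := by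
  let b := Module.Basis.ofVectorSpace k V
  choose y hy hD using fun i => h (b i) (b i).2
  obtain ⟨q, hq⟩ := V.subtype.exists_leftInverse_of_injective V.ker_subtype
  have e : ∀ v : V, (b.constr k y v) ∈ U ∧ D (b.constr k y v) = v := by
    intro v
    constructor
    · have : (⊤ : Submodule k V) ≤ U.comap (b.constr k y) := by
        rw [← b.span_eq, Submodule.span_le]
        rintro _ ⟨i, rfl⟩
        simpa using hy i
      exact this trivial
    · have : D ∘ₗ b.constr k y = V.subtype := b.ext fun i => by simp [hD]
      exact congrArg (fun f => f v) this
  refine ⟨b.constr k y ∘ₗ q, fun x hx => ?_⟩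
  have : q x = ⟨x, hx⟩ := congrArg (fun f => f ⟨x, hx⟩) hq
  rw [LinearMap.comp_apply, this]
  exact e ⟨x, hx⟩

theorem exists_contr {M : Type} [AddCommGroup M] [Module k M] (D : M →ₗ[k] M)
    (gm : ℤ → Submodule k M) (hD : ∀ j, ∀ m ∈ gm j, D m ∈ gm (j + 1)) (hDD : ∀ m, D (D m) = 0)
    (h : ∀ j, ∀ x ∈ gm j, D x = 0 → ∃ y ∈ gm (j - 1), D y = x) :
    ∃ s : ℤ → (M →ₗ[k] M), ∀ j, ∀ x ∈ gm j, s j x ∈ gm (j - 1) ∧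
      D (s j x) + s (j + 1) (D x) = x := by
  choose σ hσ using fun j => exists_sect D (gm (j - 1)) (gm j ⊓ LinearMap.ker D)
    (fun x hx => h j x hx.1 hx.2)
  refine ⟨fun j => σ j ∘ₗ (LinearMap.id - σ (j + 1) ∘ₗ D), fun j x hx => ?_⟩
  have h1 := hσ (j + 1) (D x) ⟨hD j x hx, hDD x⟩
  rw [add_sub_cancel_right] at h1
  have h2 := hσ j (x - σ (j + 1) (D x)) ⟨sub_mem hx h1.1, by simp [h1.2]⟩
  refine ⟨h2.1, ?_⟩
  simp only [LinearMap.comp_apply, LinearMap.sub_apply, LinearMap.id_apply, h2.2, hDD, map_zero,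
    sub_zero, sub_add_cancel]

theorem bE_actL (X : DGBimod A) (x : A.R) (m : X.M) :
    bE X (X.actL x m) = X.actL (epz A 1 x) (bE X m) := by
  refine gr_ext A.gr (f := bE X ∘ₗ X.actL.flip m)
    (g := X.actL.flip (bE X m) ∘ₗ epz A 1) (fun i x hx => ?_) x
  refine gr_ext X.gm (f := bE X ∘ₗ X.actL x)
    (g := X.actL (epz A 1 x) ∘ₗ bE X) (fun j m hm => ?_) m
  simp [bE_of_mem X (X.actL_deg i j x m hx hm), ep_of_mem hx, bE_of_mem X hm, sgnk_add, smul_smul,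
    mul_comm]

theorem bE_actR (X : DGBimod A) (x : A.R) (m : X.M) :
    bE X (X.actR x m) = X.actR (epz A 1 x) (bE X m) := by
  refine gr_ext A.gr (f := bE X ∘ₗ X.actR.flip m)
    (g := X.actR.flip (bE X m) ∘ₗ epz A 1) (fun i x hx => ?_) x
  refine gr_ext X.gm (f := bE X ∘ₗ X.actR x)
    (g := X.actR (epz A 1 x) ∘ₗ bE X) (fun j m hm => ?_) m
  simp [bE_of_mem X (X.actR_deg i j x m hx hm), ep_of_mem hx, bE_of_mem X hm, sgnk_add, smul_smul,
    mul_comm]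

theorem bE_D (X : DGBimod A) (m : X.M) : X.D (bE X m) = - bE X (X.D m) := by
  refine gr_ext X.gm (f := X.D ∘ₗ bE X) (g := -(bE X ∘ₗ X.D)) (fun j m hm => ?_) m
  simp [bE_of_mem X hm, bE_of_mem X (X.D_deg j m hm), sgnk_succ]

/-- left modules -/
structure LM (A : DGAlgebra k) : Type 1 where
  M : Type
  [acg : AddCommGroup M]
  [kmod : Module k M]
  gm : ℤ → Submodule k M
  E : M →ₗ[k] M
  D : M →ₗ[k] M
  L : A.R →ₗ[k] M →ₗ[k] M
  L_one : ∀ m : M, L 1 m = m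
  L_mul : ∀ (x y : A.R) (m : M), L (x * y) m = L x (L y m)
  DD : ∀ m : M, D (D m) = 0
  DL : ∀ (x : A.R) (m : M), D (L x m) = L (A.d x) m + L (epz A 1 x) (D m)
  DE : ∀ m : M, D (E m) = - E (D m)
  EL : ∀ (x : A.R) (m : M), E (L x m) = L (epz A 1 x) (E m)
  E_deg : ∀ (j : ℤ), ∀ m ∈ gm j, E m = sgnk k j • m
  L_deg : ∀ (i j : ℤ) (x : A.R) (m : M), x ∈ A.gr i → m ∈ gm j → L x m ∈ gm (i + j)
  D_deg : ∀ (j : ℤ), ∀ m ∈ gm j, D m ∈ gm (j + 1)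

attribute [instance] LM.acg LM.kmod

/-- right modules -/
structure RM (A : DGAlgebra k) : Type 1 where
  M : Type
  [acg : AddCommGroup M]
  [kmod : Module k M]
  gm : ℤ → Submodule k M
  E : M →ₗ[k] M
  D : M →ₗ[k] M
  R : A.R →ₗ[k] M →ₗ[k] M
  R_one : ∀ m : M, R 1 m = m
  R_mul : ∀ (x y : A.R) (m : M), R (x * y) m = R y (R x m)
  DD : ∀ m : M, D (D m) = 0
  DR : ∀ (x : A.R) (m : M), D (R x m) = R x (D m) + R (A.d x) (E m)
  E_deg : ∀ (j : ℤ), ∀ m ∈ gm j, E m = sgnk k j • m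
  R_deg : ∀ (i j : ℤ) (x : A.R) (m : M), x ∈ A.gr i → m ∈ gm j → R x m ∈ gm (j + i)
  D_deg : ∀ (j : ℤ), ∀ m ∈ gm j, D m ∈ gm (j + 1)

attribute [instance] RM.acg RM.kmod

/-- graded homs -/
def homGr {M : Type} [AddCommGroup M] [Module k M] (A : DGAlgebra k) (gm : ℤ → Submodule k M)
    (j : ℤ) : Submodule k (A.R →ₗ[k] M) where
  carrier := {φ | ∀ i, ∀ c ∈ A.gr i, φ c ∈ gm (i + j)}
  add_mem' := fun hf hg i c hc => add_mem (hf i c hc) (hg i c hc)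
  zero_mem' := fun i c hc => zero_mem _
  smul_mem' := fun a f hf i c hc => Submodule.smul_mem _ _ (hf i c hc)

/-- Hom from A to a left module -/
@[reducible] def HomL (C : LM A) : Tgt A where
  M := A.R →ₗ[k] C.M
  gm := homGr A C.gm
  E := LinearMap.lcomp k C.M (epz A 1) ∘ₗ C.E.compRight k
  D := C.D.compRight k - LinearMap.lcomp k C.M (epz A 1 ∘ₗ A.d) ∘ₗ C.E.compRight k
  L := LinearMap.mk₂ k (fun x φ => C.L x ∘ₗ φ)
    (by intros; ext; simp) (by intros; ext; simp) (by intros; ext; simp) (by intros; ext; simp)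
  R := LinearMap.mk₂ k (fun x φ => φ ∘ₗ (LinearMap.mul k A.R) x)
    (by intros; ext; simp) (by intros; ext; simp) (by intros; ext; simp) (by intros; ext; simp)
  L_one := fun φ => by ext c; simp [C.L_one]
  R_one := fun φ => by ext c; simp
  L_mul := fun x y φ => by ext c; simp [C.L_mul]
  R_mul := fun x y φ => by ext c; simp [mul_assoc]
  LR := fun x y φ => by ext c; simp
  DD := fun φ => by ext c; simp [C.DD, ep_d, A.d_sq, C.DE]
  DL := fun x φ => by ext c; simp [C.DL, C.EL]; abel
  DR := fun x φ => by ext c; simp [d_mul, epz_mul, epz_self]; abel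
  E_deg := fun j φ h => by
    ext c
    refine gr_ext A.gr (f := C.E ∘ₗ φ ∘ₗ epz A 1) (g := sgnk k j • φ) (fun l c hc => ?_) c
    simp only [LinearMap.comp_apply, ep_of_mem hc, map_smul, LinearMap.smul_apply,
      C.E_deg _ _ (h l c hc), sgnk_add, mul_smul, sgnk_smul_smul]
  L_deg := fun i j x φ hx h l c hc => by
    have := C.L_deg _ _ x _ hx (h l c hc)
    rwa [show i + (l + j) = l + (i + j) by ring] at this
  R_deg := fun i j x φ hx h l c hc => by
    have := h _ _ (A.mul_mem hx hc)
    rwa [show i + l + j = l + (j + i) by ring] at this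
  D_deg := fun j φ h l c hc => by
    have h1 := C.D_deg _ _ (h l c hc)
    have h2 := h _ _ (epz_deg 1 (A.d_deg l c hc))
    have h3 := C.E_deg _ _ h2
    simp only [LinearMap.sub_apply, LinearMap.comp_apply, LinearMap.compRight_apply,
      LinearMap.lcomp_apply, h3]
    rw [show l + 1 + j = l + (j + 1) by ring] at h2
    rw [add_assoc] at h1
    exact sub_mem h1 (Submodule.smul_mem _ _ h2)

/-- Hom from A to a right module -/
@[reducible] def HomR (C : RM A) : Tgt A where
  M := A.R →ₗ[k] C.M
  gm := homGr A C.gm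
  E := LinearMap.lcomp k C.M (epz A 1) ∘ₗ C.E.compRight k
  D := LinearMap.lcomp k C.M (epz A 1) ∘ₗ C.D.compRight k - LinearMap.lcomp k C.M (A.d ∘ₗ epz A 1)
  L := LinearMap.mk₂ k (fun x φ => φ ∘ₗ (LinearMap.mul k A.R).flip x)
    (by intros; ext; simp) (by intros; ext; simp) (by intros; ext; simp) (by intros; ext; simp)
  R := LinearMap.mk₂ k (fun x φ => C.R x ∘ₗ φ)
    (by intros; ext; simp) (by intros; ext; simp) (by intros; ext; simp) (by intros; ext; simp)
  L_one := fun φ => by ext c; simp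
  R_one := fun φ => by ext c; simp [C.R_one]
  L_mul := fun x y φ => by ext c; simp [mul_assoc]
  R_mul := fun x y φ => by ext c; simp [C.R_mul]
  LR := fun x y φ => by ext c; simp
  DD := fun φ => by ext c; simp [C.DD, ep_d, A.d_sq, epz_self]
  DL := fun x φ => by ext c; simp [d_mul, epz_mul, epz_self]; abel
  DR := fun x φ => by ext c; simp [C.DR]; abel
  E_deg := fun j φ h => by
    ext c
    refine gr_ext A.gr (f := C.E ∘ₗ φ ∘ₗ epz A 1) (g := sgnk k j • φ) (fun l c hc => ?_) c
    simp only [LinearMap.comp_apply, ep_of_mem hc, map_smul, LinearMap.smul_apply,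
      C.E_deg _ _ (h l c hc), sgnk_add, mul_smul, sgnk_smul_smul]
  L_deg := fun i j x φ hx h l c hc => by
    have := h _ _ (A.mul_mem hc hx)
    rwa [add_assoc] at this
  R_deg := fun i j x φ hx h l c hc => by
    have := C.R_deg _ _ x _ hx (h l c hc)
    rwa [add_assoc] at this
  D_deg := fun j φ h l c hc => by
    have h1 := C.D_deg _ _ (h l _ (epz_deg 1 hc))
    have h2 := h _ _ (A.d_deg _ _ (epz_deg 1 hc))
    rw [show l + 1 + j = l + (j + 1) by ring] at h2
    rw [add_assoc] at h1
    exact sub_mem h1 h2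

theorem HomL_ac (C : LM A) (hC : ∀ j, ∀ x ∈ C.gm j, C.D x = 0 → ∃ y ∈ C.gm (j - 1), C.D y = x) :
    TAc (HomL C) := by
  obtain ⟨s, hs⟩ := exists_contr C.D C.gm C.D_deg C.DD hC
  intro j φ hφ hD
  have key : ∀ i, ∀ c ∈ A.gr i, C.D (φ c) = sgnk k j • φ (A.d c) := by
    intro i c hc
    have e := congrArg (fun f : A.R →ₗ[k] C.M => f c) hD
    simp only [LinearMap.sub_apply, LinearMap.comp_apply, LinearMap.compRight_apply,
      LinearMap.lcomp_apply, LinearMap.zero_apply, ep_of_mem (A.d_deg i c hc), map_smul,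
      C.E_deg _ _ (hφ _ _ (A.d_deg i c hc)), sgnk_add (i + 1) j, mul_smul, sgnk_smul_smul] at e
    exact sub_eq_zero.mp e
  refine ⟨gsum A.gr fun i => s (i + j) ∘ₗ φ, fun i c hc => ?_, ?_⟩
  · rw [gsum_of_mem _ _ hc, ← add_sub_assoc]
    exact (hs _ _ (hφ i c hc)).1
  · ext c
    refine gr_ext A.gr (f := (HomL C).D (gsum A.gr fun i => s (i + j) ∘ₗ φ)) (fun i c hc => ?_) c
    have h1 := (hs _ _ (hφ i c hc)).2
    have h2 := C.E_deg _ _ (hs _ _ (hφ _ _ (A.d_deg i c hc))).1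
    simp only [LinearMap.sub_apply, LinearMap.comp_apply, LinearMap.compRight_apply,
      LinearMap.lcomp_apply, ep_of_mem (A.d_deg i c hc), map_smul, gsum_of_mem _ _ hc,
      gsum_of_mem _ _ (A.d_deg i c hc), h2, sgnk_pred, sgnk_add (i + 1) j, neg_smul, mul_smul,
      smul_neg, sgnk_smul_smul, sub_neg_eq_add]
    rw [key i c hc, map_smul, show i + j + 1 = i + 1 + j by ring] at h1
    exact h1

theorem HomR_ac (C : RM A) (hC : ∀ j, ∀ x ∈ C.gm j, C.D x = 0 → ∃ y ∈ C.gm (j - 1), C.D y = x) :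
    TAc (HomR C) := by
  obtain ⟨s, hs⟩ := exists_contr C.D C.gm C.D_deg C.DD hC
  intro j φ hφ hD
  have key : ∀ i, ∀ c ∈ A.gr i, C.D (φ c) = φ (A.d c) := by
    intro i c hc
    have e := congrArg (fun f : A.R →ₗ[k] C.M => f (epz A 1 c)) hD
    simp only [LinearMap.sub_apply, LinearMap.comp_apply, LinearMap.compRight_apply,
      LinearMap.lcomp_apply, LinearMap.zero_apply, epz_self] at e
    exact sub_eq_zero.mp e
  refine ⟨gsum A.gr fun i => sgnk k i • (s (i + j) ∘ₗ φ), fun i c hc => ?_, ?_⟩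
  · rw [gsum_of_mem _ _ hc, ← add_sub_assoc]
    exact Submodule.smul_mem _ _ (hs _ _ (hφ i c hc)).1
  · ext c
    refine gr_ext A.gr (f := (HomR C).D (gsum A.gr fun i => sgnk k i • (s (i + j) ∘ₗ φ)))
      (fun i c hc => ?_) c
    have h1 := (hs _ _ (hφ i c hc)).2
    simp only [LinearMap.sub_apply, LinearMap.comp_apply, LinearMap.compRight_apply,
      LinearMap.lcomp_apply, ep_of_mem hc, map_smul, gsum_of_mem _ _ hc, LinearMap.smul_apply,
      gsum_of_mem _ _ (A.d_deg i c hc), sgnk_succ, neg_smul,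
      LinearMap.neg_apply, smul_neg, sgnk_smul_smul, sub_neg_eq_add]
    rw [key i c hc, show i + j + 1 = i + 1 + j by ring] at h1
    exact h1

/-- left cone -/
@[reducible] def coneL (P : DGBimod A) (s0 : P.M) (h0 : s0 ∈ P.gm 0) (hD : P.D s0 = 0) : LM A where
  M := A.R × P.M
  gm := fun j => (A.gr (j + 1)).prod (P.gm j)
  E := LinearMap.prodMap (-epz A 1) (bE P)
  D := LinearMap.prod (-(A.d ∘ₗ LinearMap.fst _ _ _))
    (P.actL.flip s0 ∘ₗ LinearMap.fst _ _ _ + P.D ∘ₗ LinearMap.snd _ _ _)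
  L := (LinearMap.prodMapLinear k A.R P.M A.R P.M k) ∘ₗ
    ((LinearMap.mul k A.R ∘ₗ epz A 1).prod P.actL)
  L_one := fun ⟨a, p⟩ => by simp [epz_one, P.actL_one]
  L_mul := fun x y ⟨a, p⟩ => by simp [epz_mul, P.actL_mul, mul_assoc]
  DD := fun ⟨a, p⟩ => by simp [A.d_sq, P.D_sq, b_DL, hD]
  DL := fun x ⟨a, p⟩ => by
    simp [d_mul, b_DL, ep_d, epz_self, P.actL_mul]
    constructor <;> abel
  DE := fun ⟨a, p⟩ => by
    have : bE P s0 = s0 := by rw [bE_of_mem P h0, sgnk_zero, one_smul]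
    simp [ep_d, bE_D, bE_actL, this]; abel
  EL := fun x ⟨a, p⟩ => by simp [epz_mul, bE_actL]
  E_deg := fun j ⟨a, p⟩ h => by
    obtain ⟨h1, h2⟩ := h
    simp only at h1 h2
    simp [ep_of_mem h1, bE_of_mem P h2, sgnk_succ]
  L_deg := fun i j x ⟨a, p⟩ hx h => by
    refine ⟨?_, P.actL_deg i j x p hx h.2⟩
    have := A.mul_mem (epz_deg 1 hx) h.1
    rwa [← add_assoc] at this
  D_deg := fun j ⟨a, p⟩ h => by
    refine ⟨neg_mem (A.d_deg _ a h.1), add_mem ?_ (P.D_deg j p h.2)⟩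
    have := P.actL_deg _ _ a s0 h.1 h0
    simpa using this

/-- right cone -/
@[reducible] def coneR (P : DGBimod A) (s0 : P.M) (h0 : s0 ∈ P.gm 0) (hD : P.D s0 = 0) : RM A where
  M := A.R × P.M
  gm := fun j => (A.gr (j + 1)).prod (P.gm j)
  E := LinearMap.prodMap (-epz A 1) (bE P)
  D := LinearMap.prod (-(A.d ∘ₗ LinearMap.fst _ _ _))
    (P.actR.flip s0 ∘ₗ LinearMap.fst _ _ _ + P.D ∘ₗ LinearMap.snd _ _ _)
  R := (LinearMap.prodMapLinear k A.R P.M A.R P.M k) ∘ₗ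
    ((LinearMap.mul k A.R).flip.prod P.actR)
  R_one := fun ⟨a, p⟩ => by simp [P.actR_one]
  R_mul := fun x y ⟨a, p⟩ => by simp [P.actR_mul, mul_assoc]
  DD := fun ⟨a, p⟩ => by
    have : bE P s0 = s0 := by rw [bE_of_mem P h0, sgnk_zero, one_smul]
    simp [A.d_sq, P.D_sq, b_DR, hD, this]
  DR := fun x ⟨a, p⟩ => by
    simp [d_mul, b_DR, P.actR_mul]
    constructor <;> abel
  E_deg := fun j ⟨a, p⟩ h => by
    obtain ⟨h1, h2⟩ := h
    simp only at h1 h2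
    simp [ep_of_mem h1, bE_of_mem P h2, sgnk_succ]
  R_deg := fun i j x ⟨a, p⟩ hx h => by
    refine ⟨?_, P.actR_deg i j x p hx h.2⟩
    have := A.mul_mem h.1 hx
    rwa [show j + 1 + i = j + i + 1 by ring] at this
  D_deg := fun j ⟨a, p⟩ h => by
    refine ⟨neg_mem (A.d_deg _ a h.1), add_mem ?_ (P.D_deg j p h.2)⟩
    have := P.actR_deg _ _ a s0 h.1 h0
    simpa using this

theorem coneL_ac {P : DGBimod A} {F : P.M →ₗ[k] A.R} (hF : IsMor (tg P) (dT A) F)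
    (hq : QI (tg P) (dT A) F) {s0 : P.M} (h0 : s0 ∈ P.gm 0) (hD : P.D s0 = 0) {a₁ : A.R}
    (h1 : a₁ ∈ A.gr (-1)) (hs : F s0 = 1 + A.d a₁) :
    ∀ j, ∀ x ∈ (coneL P s0 h0 hD).gm j, (coneL P s0 h0 hD).D x = 0 →
      ∃ y ∈ (coneL P s0 h0 hD).gm (j - 1), (coneL P s0 h0 hD).D y = x := by
  rintro j ⟨a, p⟩ ⟨ha, hp⟩ hDx
  simp only at ha hp
  simp at hDx
  obtain ⟨hda, hap⟩ := hDx
  have Fl : ∀ x m, F (P.actL x m) = x * F m := hF.l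
  have Fd : ∀ m, F (P.D m) = A.d (F m) := hF.dd
  have da1 : ∀ {i : ℤ} {z : A.R}, z ∈ A.gr i → A.d z = 0 →
      z * A.d a₁ = A.d (sgnk k i • (z * a₁)) := by
    intro i z hz hdz
    rw [map_smul, d_mul, hdz, ep_of_mem hz]; simp [sgnk_smul_smul]
  have e1 : a = A.d (-(sgnk k (j + 1) • (a * a₁)) - F p) := by
    rw [map_sub, map_neg, ← da1 ha hda, ← Fd]
    have := congrArg F hap
    rw [map_add, Fl, hs, map_zero, mul_add, mul_one] at this
    rw [add_assoc] at this
    refine (eq_neg_of_add_eq_zero_left this).trans ?_; abel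
  set b := -(sgnk k (j + 1) • (a * a₁)) - F p with hb
  have hbm : b ∈ A.gr j := by
    refine sub_mem (neg_mem (Submodule.smul_mem _ _ ?_)) (hF.deg j p hp)
    have := A.mul_mem ha h1
    rwa [show j + 1 + -1 = j by ring] at this
  have hbs : P.actL b s0 ∈ P.gm j := by simpa using P.actL_deg _ _ b s0 hbm h0
  set z := F (p + P.actL b s0) with hz
  have hzm : z ∈ A.gr j := hF.deg j _ (add_mem hp hbs)
  have hDp : P.D (p + P.actL b s0) = 0 := by
    rw [map_add, b_DL, hD, ← e1, map_zero, add_zero, add_comm]; exact hap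
  have hdz : A.d z = 0 := by rw [hz, ← Fd, hDp, map_zero]
  have hzs : P.actL z s0 ∈ P.gm j := by simpa using P.actL_deg _ _ z s0 hzm h0
  obtain ⟨q, hq1, hq2⟩ := hq.inj j (p + P.actL b s0 - P.actL z s0) (sub_mem (add_mem hp hbs) hzs)
    (by
      show P.D _ = 0
      rw [map_sub, hDp, b_DL, hD, hdz]; simp)
    (-(sgnk k j • (z * a₁))) (by
      refine neg_mem (Submodule.smul_mem _ _ ?_)
      have := A.mul_mem hzm h1
      rwa [← sub_eq_add_neg] at this)
    (by
      show A.d _ = _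
      rw [map_neg, ← da1 hzm hdz, map_sub, Fl, hs, ← hz, mul_add, mul_one]; abel)
  refine ⟨(-b + z, q), ⟨?_, hq1⟩, ?_⟩
  · simp only [sub_add_cancel]; exact add_mem (neg_mem hbm) hzm
  · have hq2' : P.D q = p + P.actL b s0 - P.actL z s0 := hq2
    simp [hdz, ← e1, hq2']

theorem coneR_ac {P : DGBimod A} {F : P.M →ₗ[k] A.R} (hF : IsMor (tg P) (dT A) F)
    (hq : QI (tg P) (dT A) F) {s0 : P.M} (h0 : s0 ∈ P.gm 0) (hD : P.D s0 = 0) {a₁ : A.R}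
    (h1 : a₁ ∈ A.gr (-1)) (hs : F s0 = 1 + A.d a₁) :
    ∀ j, ∀ x ∈ (coneR P s0 h0 hD).gm j, (coneR P s0 h0 hD).D x = 0 →
      ∃ y ∈ (coneR P s0 h0 hD).gm (j - 1), (coneR P s0 h0 hD).D y = x := by
  rintro j ⟨a, p⟩ ⟨ha, hp⟩ hDx
  simp only at ha hp
  simp at hDx
  obtain ⟨hda, hap⟩ := hDx
  have Fl : ∀ x m, F (P.actR x m) = F m * x := hF.r
  have Fd : ∀ m, F (P.D m) = A.d (F m) := hF.dd
  have da1 : ∀ {z : A.R}, A.d z = 0 → A.d a₁ * z = A.d (a₁ * z) := by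
    intro z hdz
    rw [d_mul, hdz]; simp
  have bs : bE P s0 = s0 := by rw [bE_of_mem P h0, sgnk_zero, one_smul]
  have e1 : a = A.d (-(a₁ * a) - F p) := by
    rw [map_sub, map_neg, ← da1 hda, ← Fd]
    have := congrArg F hap
    rw [map_add, Fl, hs, map_zero, add_mul, one_mul] at this
    rw [add_assoc] at this
    refine (eq_neg_of_add_eq_zero_left this).trans ?_; abel
  set b := -(a₁ * a) - F p with hb
  have hbm : b ∈ A.gr j := by
    refine sub_mem (neg_mem ?_) (hF.deg j p hp)
    have := A.mul_mem h1 ha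
    rwa [show -1 + (j + 1) = j by ring] at this
  have hbs : P.actR b s0 ∈ P.gm j := by simpa using P.actR_deg _ _ b s0 hbm h0
  set z := F (p + P.actR b s0) with hz
  have hzm : z ∈ A.gr j := hF.deg j _ (add_mem hp hbs)
  have hDp : P.D (p + P.actR b s0) = 0 := by
    rw [map_add, b_DR, hD, ← e1, map_zero, zero_add, bs, add_comm]; exact hap
  have hdz : A.d z = 0 := by rw [hz, ← Fd, hDp, map_zero]
  have hzs : P.actR z s0 ∈ P.gm j := by simpa using P.actR_deg _ _ z s0 hzm h0
  obtain ⟨q, hq1, hq2⟩ := hq.inj j (p + P.actR b s0 - P.actR z s0) (sub_mem (add_mem hp hbs) hzs)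
    (by
      show P.D _ = 0
      rw [map_sub, hDp, b_DR, hD, hdz]; simp)
    (-(a₁ * z)) (by
      refine neg_mem ?_
      have := A.mul_mem h1 hzm
      rwa [show -1 + j = j - 1 by ring] at this)
    (by
      show A.d _ = _
      rw [map_neg, ← da1 hdz, map_sub, Fl, hs, ← hz, add_mul, one_mul]; abel)
  refine ⟨(-b + z, q), ⟨?_, hq1⟩, ?_⟩
  · simp only [sub_add_cancel]; exact add_mem (neg_mem hbm) hzm
  · have hq2' : P.D q = p + P.actR b s0 - P.actR z s0 := hq2
    simp [hdz, ← e1, hq2']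

/-- left contraction data -/
theorem left_data {P : DGBimod A} (hP : Proj P) {F : P.M →ₗ[k] A.R} (hF : IsMor (tg P) (dT A) F)
    (hq : QI (tg P) (dT A) F) {s0 : P.M} (h0 : s0 ∈ P.gm 0) (hD : P.D s0 = 0) {a₁ : A.R}
    (h1 : a₁ ∈ A.gr (-1)) (hs : F s0 = 1 + A.d a₁) :
    ∃ (t : P.M →ₗ[k] A.R) (h : P.M →ₗ[k] P.M), (∀ j, ∀ p ∈ P.gm j, t p ∈ A.gr j) ∧
      (∀ j, ∀ p ∈ P.gm j, h p ∈ P.gm (j - 1)) ∧ (∀ x p, t (P.actL x p) = x * t p) ∧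
      (∀ x p, h (P.actL x p) = P.actL (epz A 1 x) (h p)) ∧ (∀ p, t (P.D p) = A.d (t p)) ∧
      ∀ p, p = P.actL (t p) s0 + P.D (h p) + h (P.D p) := by
  have hf : IsMor (tg P) (HomL (coneL P s0 h0 hD))
      (LinearMap.mk₂ k (fun (p : P.M) (c : A.R) => ((0 : A.R), P.actR c p))
        (by intros; simp) (by intros; simp) (by intros; simp) (by intros; simp)) := by
    refine ⟨fun j p hp i c hc => ⟨zero_mem _, ?_⟩, fun x p => ?_, fun x p => ?_, fun p => ?_⟩
    · have := P.actR_deg _ _ c p hc hp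
      rwa [add_comm] at this
    · ext c <;> simp [P.actLR]
    · ext c <;> simp [P.actR_mul]
    · ext c <;> simp [b_DR, bE_actR, epz_self]
  obtain ⟨H, hH1, hH2⟩ := hP _ (HomL_ac _ (coneL_ac hF hq h0 hD h1 hs)) _ hf
  have key : ∀ p, ((0 : A.R), p) = (coneL P s0 h0 hD).D (H p 1) + H (P.D p) 1 := by
    intro p
    have := congrArg (fun φ : A.R →ₗ[k] (A.R × P.M) => φ 1) (hH2 p)
    simpa [P.actR_one, d_one] using this
  have hl : ∀ x p, H (P.actL x p) 1 = (coneL P s0 h0 hD).L (epz A 1 x) (H p 1) := fun x p =>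
    congrArg (fun φ : A.R →ₗ[k] (A.R × P.M) => φ 1) (hH1.l x p)
  have hd : ∀ j, ∀ p ∈ P.gm j, H p 1 ∈ (coneL P s0 h0 hD).gm (j - 1) := by
    intro j p hp
    have := hH1.deg j p hp 0 1 A.one_mem
    rwa [zero_add] at this
  refine ⟨LinearMap.fst k _ _ ∘ₗ H.flip 1, LinearMap.snd k _ _ ∘ₗ H.flip 1, fun j p hp => ?_,
    fun j p hp => ?_, fun x p => ?_, fun x p => ?_, fun p => ?_, fun p => ?_⟩
  · have := (hd j p hp).1
    simpa using this
  · have := (hd j p hp).2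
    simpa using this
  · have := congrArg Prod.fst (hl x p)
    simpa [epz_self] using this
  · have := congrArg Prod.snd (hl x p)
    simpa [epz_self] using this
  · have := congrArg Prod.fst (key p)
    simp at this
    simpa using (neg_add_eq_zero.mp this.symm).symm
  · have := congrArg Prod.snd (key p)
    simpa using this

/-- right contraction data -/
theorem right_data {P : DGBimod A} (hP : Proj P) {F : P.M →ₗ[k] A.R} (hF : IsMor (tg P) (dT A) F)
    (hq : QI (tg P) (dT A) F) {s0 : P.M} (h0 : s0 ∈ P.gm 0) (hD : P.D s0 = 0) {a₁ : A.R}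
    (h1 : a₁ ∈ A.gr (-1)) (hs : F s0 = 1 + A.d a₁) :
    ∃ (t : P.M →ₗ[k] A.R) (h : P.M →ₗ[k] P.M), (∀ j, ∀ p ∈ P.gm j, t p ∈ A.gr j) ∧
      (∀ j, ∀ p ∈ P.gm j, h p ∈ P.gm (j - 1)) ∧ (∀ x p, t (P.actR x p) = t p * x) ∧
      (∀ x p, h (P.actR x p) = P.actR x (h p)) ∧ (∀ p, t (P.D p) = A.d (t p)) ∧
      ∀ p, p = P.actR (t p) s0 + P.D (h p) + h (P.D p) := by
  have hf : IsMor (tg P) (HomR (coneR P s0 h0 hD))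
      (LinearMap.mk₂ k (fun (p : P.M) (c : A.R) => ((0 : A.R), P.actL c p))
        (by intros; simp) (by intros; simp) (by intros; simp) (by intros; simp)) := by
    refine ⟨fun j p hp i c hc => ⟨zero_mem _, P.actL_deg _ _ c p hc hp⟩, fun x p => ?_,
      fun x p => ?_, fun p => ?_⟩
    · ext c <;> simp [P.actL_mul]
    · ext c <;> simp [P.actLR]
    · ext c <;> simp [b_DL, epz_self]
  obtain ⟨H, hH1, hH2⟩ := hP _ (HomR_ac _ (coneR_ac hF hq h0 hD h1 hs)) _ hf
  have key : ∀ p, ((0 : A.R), p) = (coneR P s0 h0 hD).D (H p 1) + H (P.D p) 1 := by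
    intro p
    have := congrArg (fun φ : A.R →ₗ[k] (A.R × P.M) => φ 1) (hH2 p)
    simpa [P.actL_one, d_one, epz_one] using this
  have hl : ∀ x p, H (P.actR x p) 1 = (coneR P s0 h0 hD).R x (H p 1) := fun x p =>
    congrArg (fun φ : A.R →ₗ[k] (A.R × P.M) => φ 1) (hH1.r x p)
  have hd : ∀ j, ∀ p ∈ P.gm j, H p 1 ∈ (coneR P s0 h0 hD).gm (j - 1) := by
    intro j p hp
    have := hH1.deg j p hp 0 1 A.one_mem
    rwa [zero_add] at this
  refine ⟨LinearMap.fst k _ _ ∘ₗ H.flip 1, LinearMap.snd k _ _ ∘ₗ H.flip 1, fun j p hp => ?_,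
    fun j p hp => ?_, fun x p => ?_, fun x p => ?_, fun p => ?_, fun p => ?_⟩
  · have := (hd j p hp).1
    simpa using this
  · have := (hd j p hp).2
    simpa using this
  · have := congrArg Prod.fst (hl x p)
    simpa [epz_self] using this
  · have := congrArg Prod.snd (hl x p)
    simpa [epz_self] using this
  · have := congrArg Prod.fst (key p)
    simp at this
    simpa using (neg_add_eq_zero.mp this.symm).symm
  · have := congrArg Prod.snd (key p)
    simpa using this

/-- sign compatibility -/
structure SgnOK (Y : Tgt A) : Prop where
  DE : ∀ m, Y.D (Y.E m) = - Y.E (Y.D m)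
  EL : ∀ x m, Y.E (Y.L x m) = Y.L (epz A 1 x) (Y.E m)
  ER : ∀ x m, Y.E (Y.R x m) = Y.R (epz A 1 x) (Y.E m)
  EE : ∀ m, Y.E (Y.E m) = m

theorem Adual_ok : SgnOK (Adual A) :=
  ⟨fun m => by ext c; simp [ep_d], fun x m => by ext c; simp [epz_mul, epz_self],
    fun x m => by ext c; simp [epz_mul, epz_self], fun m => by ext c; simp [epz_self]⟩

theorem bE_bE (X : DGBimod A) (m : X.M) : bE X (bE X m) = m := by
  refine gr_ext X.gm (f := bE X ∘ₗ bE X) (g := LinearMap.id) (fun j m hm => ?_) m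
  simp [bE_of_mem X hm, sgnk_smul_smul]

theorem tg_ok (X : DGBimod A) : SgnOK (tg X) :=
  ⟨bE_D X, bE_actL X, bE_actR X, bE_bE X⟩

theorem dT_ok : SgnOK (dT A) :=
  ⟨fun m => by simp [ep_d], fun x m => by simp [epz_mul],
    fun x m => by simp [epz_mul], fun m => by simp [epz_self]⟩

theorem tt_ext {M N W : Type} [AddCommGroup M] [Module k M] [AddCommGroup N] [Module k N]
    [AddCommGroup W] [Module k W] {f g : M ⊗[k] N →ₗ[k] W}
    (h : ∀ x y, f (x ⊗ₜ y) = g (x ⊗ₜ y)) (t : M ⊗[k] N) : f t = g t := by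
  have : f = g := TensorProduct.ext' h
  rw [this]

/-- tensor grading -/
def ttGr (Y X : Tgt A) (n : ℤ) : Submodule k (Y.M ⊗[k] X.M) :=
  Submodule.span k {t | ∃ i j ν x, i + j = n ∧ ν ∈ Y.gm i ∧ x ∈ X.gm j ∧ t = ν ⊗ₜ x}

theorem tmul_ttGr {Y X : Tgt A} {i j n : ℤ} {ν : Y.M} {x : X.M} (h : i + j = n) (hν : ν ∈ Y.gm i)
    (hx : x ∈ X.gm j) : ν ⊗ₜ[k] x ∈ ttGr Y X n := Submodule.subset_span ⟨i, j, ν, x, h, hν, hx, rfl⟩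

theorem ttGr_le {Y X : Tgt A} {n : ℤ} {W : Type} [AddCommGroup W] [Module k W]
    (f : Y.M ⊗[k] X.M →ₗ[k] W) (U : Submodule k W)
    (h : ∀ i j ν x, i + j = n → ν ∈ Y.gm i → x ∈ X.gm j → f (ν ⊗ₜ x) ∈ U)
    {t : Y.M ⊗[k] X.M} (ht : t ∈ ttGr Y X n) : f t ∈ U := by
  have : ttGr Y X n ≤ U.comap f := by
    rw [ttGr, Submodule.span_le]
    rintro _ ⟨i, j, ν, x, h1, h2, h3, rfl⟩
    exact h i j ν x h1 h2 h3
  exact this ht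

/-- tensor product over k -/
@[reducible] def TT (Y X : Tgt A) (hY : SgnOK Y) : Tgt A where
  M := Y.M ⊗[k] X.M
  gm := ttGr Y X
  E := TensorProduct.map Y.E X.E
  D := TensorProduct.map Y.D LinearMap.id + TensorProduct.map Y.E X.D
  L := LinearMap.rTensorHom X.M ∘ₗ Y.L
  R := LinearMap.lTensorHom Y.M ∘ₗ X.R
  L_one := fun t => by
    refine tt_ext (g := LinearMap.id) (fun ν x => ?_) t
    simp [Y.L_one]
  R_one := fun t => by
    refine tt_ext (g := LinearMap.id) (fun ν x => ?_) t
    simp [X.R_one]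
  L_mul := fun x y t => by
    refine tt_ext (g := ((LinearMap.rTensorHom X.M ∘ₗ Y.L) x) ∘ₗ
      ((LinearMap.rTensorHom X.M ∘ₗ Y.L) y)) (fun ν x => ?_) t
    simp [Y.L_mul]
  R_mul := fun x y t => by
    refine tt_ext (g := ((LinearMap.lTensorHom Y.M ∘ₗ X.R) y) ∘ₗ
      ((LinearMap.lTensorHom Y.M ∘ₗ X.R) x)) (fun ν x => ?_) t
    simp [X.R_mul]
  LR := fun x y t => by
    refine tt_ext (f := ((LinearMap.rTensorHom X.M ∘ₗ Y.L) x) ∘ₗ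
      ((LinearMap.lTensorHom Y.M ∘ₗ X.R) y)) (g := ((LinearMap.lTensorHom Y.M ∘ₗ X.R) y) ∘ₗ
      ((LinearMap.rTensorHom X.M ∘ₗ Y.L) x)) (fun ν x => ?_) t
    simp
  DD := fun t => by
    refine tt_ext (f := (TensorProduct.map Y.D LinearMap.id + TensorProduct.map Y.E X.D) ∘ₗ
      (TensorProduct.map Y.D LinearMap.id + TensorProduct.map Y.E X.D)) (g := 0) (fun ν x => ?_) t
    simp [Y.DD, X.DD, hY.DE, TensorProduct.neg_tmul]
  DL := fun a t => by
    refine tt_ext (f := (TensorProduct.map Y.D LinearMap.id + TensorProduct.map Y.E X.D) ∘ₗ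
      ((LinearMap.rTensorHom X.M ∘ₗ Y.L) a)) (g := ((LinearMap.rTensorHom X.M ∘ₗ Y.L) (A.d a)) +
      ((LinearMap.rTensorHom X.M ∘ₗ Y.L) (epz A 1 a)) ∘ₗ
      (TensorProduct.map Y.D LinearMap.id + TensorProduct.map Y.E X.D)) (fun ν x => ?_) t
    simp [Y.DL, hY.EL, TensorProduct.add_tmul]; abel
  DR := fun a t => by
    refine tt_ext (f := (TensorProduct.map Y.D LinearMap.id + TensorProduct.map Y.E X.D) ∘ₗ
      ((LinearMap.lTensorHom Y.M ∘ₗ X.R) a)) (g := ((LinearMap.lTensorHom Y.M ∘ₗ X.R) a) ∘ₗ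
      (TensorProduct.map Y.D LinearMap.id + TensorProduct.map Y.E X.D) +
      ((LinearMap.lTensorHom Y.M ∘ₗ X.R) (A.d a)) ∘ₗ TensorProduct.map Y.E X.E) (fun ν x => ?_) t
    simp [X.DR, TensorProduct.tmul_add]; abel
  E_deg := fun n t ht => by
    have := ttGr_le (TensorProduct.map Y.E X.E - sgnk k n • LinearMap.id) ⊥
      (fun i j ν x h hν hx => ?_) ht
    · simpa [sub_eq_zero] using this
    · simp [Y.E_deg _ _ hν, X.E_deg _ _ hx, ← h, sgnk_add, sub_eq_zero, TensorProduct.smul_tmul',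
        TensorProduct.tmul_smul, smul_smul, mul_comm]
  L_deg := fun i j a t ha ht => by
    refine ttGr_le _ (ttGr Y X (i + j)) (fun i' j' ν x h hν hx => ?_) ht
    exact tmul_ttGr (by omega) (Y.L_deg _ _ a ν ha hν) hx
  R_deg := fun i j a t ha ht => by
    refine ttGr_le _ (ttGr Y X (j + i)) (fun i' j' ν x h hν hx => ?_) ht
    exact tmul_ttGr (by omega) hν (X.R_deg _ _ a x ha hx)
  D_deg := fun j t ht => by
    refine ttGr_le _ (ttGr Y X (j + 1)) (fun i' j' ν x h hν hx => ?_) ht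
    have e := Y.E_deg _ _ hν
    simp only [LinearMap.add_apply, TensorProduct.map_tmul, LinearMap.id_apply, e]
    refine add_mem (tmul_ttGr (by omega) (Y.D_deg _ _ hν) hx)
      (tmul_ttGr (by omega) (Submodule.smul_mem _ _ hν) (X.D_deg _ _ hx))

theorem TT_D_tmul (Y X : Tgt A) (hY : SgnOK Y) (ν : Y.M) (x : X.M) :
    (TT Y X hY).D (ν ⊗ₜ x) = Y.D ν ⊗ₜ x + Y.E ν ⊗ₜ X.D x := by
  simp

/-- A as right module -/
@[reducible] def rA (A : DGAlgebra k) : RM A where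
  M := A.R
  gm := A.gr
  E := epz A 1
  D := A.d
  R := (LinearMap.mul k A.R).flip
  R_one := fun m => by simp
  R_mul := fun x y m => by simp [mul_assoc]
  DD := A.d_sq
  DR := fun x m => by simp [d_mul]
  E_deg := fun j m h => ep_of_mem h
  R_deg := fun i j x m hx hm => A.mul_mem hm hx
  D_deg := A.d_deg

/-- operators from tensors -/
def op (A : DGAlgebra k) : ((A.R →ₗ[k] k) ⊗[k] A.R) →ₗ[k] (A.R →ₗ[k] A.R) :=
  dualTensorHom k A.R A.R

theorem op_tmul (ν : A.R →ₗ[k] k) (a c : A.R) : op A (ν ⊗ₜ a) c = ν c • a := by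
  simp [op]

theorem op_inj : Function.Injective (op A) := by
  classical
  let b := Module.Basis.ofVectorSpace k A.R
  have key : ∀ (t : (A.R →ₗ[k] k) ⊗[k] A.R) (c : A.R) i,
      (TensorProduct.equivFinsuppOfBasisRight b t) i c = b.repr (op A t c) i := by
    intro t c i
    refine tt_ext (f := (LinearMap.applyₗ c ∘ₗ Finsupp.lapply i) ∘ₗ
      (TensorProduct.equivFinsuppOfBasisRight b).toLinearMap) (g := (Finsupp.lapply i ∘ₗ
      b.repr.toLinearMap ∘ₗ LinearMap.applyₗ c ∘ₗ op A)) (fun ν x => ?_) t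
    simp [op_tmul, TensorProduct.equivFinsuppOfBasisRight_apply_tmul_apply, mul_comm]
  intro t t' h
  apply (TensorProduct.equivFinsuppOfBasisRight b).injective
  ext i c
  rw [key, key, h]

/-- the tensor bimodule -/
@[reducible] def N1 (A : DGAlgebra k) : Tgt A := TT (Adual A) (dT A) Adual_ok

theorem op_mor : IsMor (N1 A) (HomR (rA A)) (op A) := by
  refine ⟨fun n t ht => ?_, fun x t => ?_, fun x t => ?_, fun t => ?_⟩
  · refine ttGr_le (Y := Adual A) (X := dT A) (op A) (homGr A A.gr n)
      (fun i j ν a h hν ha l c hc => ?_) ht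
    rw [op_tmul]
    by_cases hl : l = -i
    · have : l + n = j := by omega
      rw [this]; exact Submodule.smul_mem _ _ ha
    · rw [hν l hl c hc, zero_smul]; exact zero_mem _
  · refine tt_ext (f := op A ∘ₗ (N1 A).L x) (g := (HomR (rA A)).L x ∘ₗ op A) (fun ν a => ?_) t
    ext c; simp [op_tmul]
  · refine tt_ext (f := op A ∘ₗ (N1 A).R x) (g := (HomR (rA A)).R x ∘ₗ op A) (fun ν a => ?_) t
    ext c; simp [op_tmul]
  · refine tt_ext (f := op A ∘ₗ (N1 A).D) (g := (HomR (rA A)).D ∘ₗ op A) (fun ν a => ?_) t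
    ext c; simp [op_tmul]; abel

theorem a_gpr_d (i : ℤ) (x : A.R) : A.d (gpr A.gr i x) = gpr A.gr (i + 1) (A.d x) := by
  refine gr_ext A.gr (f := A.d ∘ₗ gpr A.gr i) (g := gpr A.gr (i + 1) ∘ₗ A.d) (fun j x hx => ?_) x
  by_cases h : j = i
  · subst h
    simp [gpr_same A.gr hx, gpr_same A.gr (A.d_deg _ x hx)]
  · simp [gpr_ne A.gr h hx, gpr_ne A.gr (show j + 1 ≠ i + 1 by omega) (A.d_deg _ x hx)]

theorem exists_kappa (hc : IsCompactAlg A) : ∃ (κ : A.R →ₗ[k] A.R)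
    (π : (A.R →ₗ[k] k) ⊗[k] A.R), (∀ j, ∀ x ∈ A.gr j, κ x ∈ A.gr (j - 1)) ∧
    π ∈ (N1 A).gm 0 ∧ ∀ x, x - A.d (κ x) - κ (A.d x) = op A π x := by
  classical
  choose σ hσ using fun j => exists_sect A.d (A.gr (j - 1)) (Bg A.gr A.d j) (fun x hx => by
    obtain ⟨h1, y, rfl⟩ := hx
    refine ⟨gpr A.gr (j - 1) y, gpr_mem A.gr _ _, ?_⟩
    rw [a_gpr_d, sub_add_cancel, gpr_same A.gr h1])
  choose q hq using fun j => (Bg A.gr A.d j).subtype.exists_leftInverse_of_injective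
    (Bg A.gr A.d j).ker_subtype
  set ρ : ℤ → (A.R →ₗ[k] A.R) := fun j => (Bg A.gr A.d j).subtype ∘ₗ q j with hρ
  have ρB : ∀ j x, ρ j x ∈ Bg A.gr A.d j := fun j x => (q j x).2
  have ρid : ∀ j, ∀ x ∈ Bg A.gr A.d j, ρ j x = x := fun j x hx => by
    have : q j x = ⟨x, hx⟩ := congrArg (fun f => f ⟨x, hx⟩) (hq j)
    simp [hρ, this]
  set y : ℤ → (A.R →ₗ[k] A.R) := fun j => LinearMap.id - σ (j + 1) ∘ₗ A.d with hy
  have dB : ∀ j, ∀ x ∈ A.gr j, A.d x ∈ Bg A.gr A.d (j + 1) :=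
    fun j x hx => ⟨A.d_deg j x hx, x, rfl⟩
  have yZ : ∀ j, ∀ x ∈ A.gr j, y j x ∈ Zg A.gr A.d j := fun j x hx => by
    have h1 := hσ (j + 1) _ (dB j x hx)
    rw [add_sub_cancel_right] at h1
    exact ⟨sub_mem hx h1.1, by simp [hy, h1.2]⟩
  set p : ℤ → (A.R →ₗ[k] A.R) := fun j => (LinearMap.id - ρ j) ∘ₗ y j with hp
  have loc : ∀ j, ∃ τ : (A.R →ₗ[k] k) ⊗[k] A.R, τ ∈ (N1 A).gm 0 ∧
      ∀ x, op A τ x = p j (gpr A.gr j x) := by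
    intro j
    let Z := Zg A.gr A.d j
    let B := Submodule.comap Z.subtype (Bg A.gr A.d j)
    have hfin : FiniteDimensional k (Z ⧸ B) := hc.1 j
    let θ : (Z ⧸ B) →ₗ[k] A.R := B.liftQ ((LinearMap.id - ρ j) ∘ₗ Z.subtype) (fun z hz => by
      have : ρ j z = z := ρid j _ hz
      simp [this])
    let S := LinearMap.range θ
    have hS : ∀ x, p j (gpr A.gr j x) ∈ S := fun x =>
      ⟨B.mkQ ⟨y j (gpr A.gr j x), yZ j _ (gpr_mem A.gr j x)⟩, by simp [θ, hp]⟩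
    have hSj : ∀ s : S, (s : A.R) ∈ A.gr j := by
      rintro ⟨_, w, rfl⟩
      obtain ⟨z, rfl⟩ := B.mkQ_surjective w
      simp only [θ, Submodule.mkQ_apply, Submodule.liftQ_apply]
      exact sub_mem z.2.1 (ρB j z).1
    let b := Module.finBasis k S
    refine ⟨∑ l, (b.coord l ∘ₗ (p j ∘ₗ gpr A.gr j).codRestrict S hS) ⊗ₜ (b l : A.R), ?_, ?_⟩
    · refine sum_mem fun l _ => tmul_ttGr (Y := Adual A) (X := dT A) (neg_add_cancel j) ?_ (hSj _)
      intro i hi x hx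
      have : (p j ∘ₗ gpr A.gr j).codRestrict S hS x = 0 := by
        apply Subtype.ext
        simp [gpr_ne A.gr (show i ≠ j by omega) hx]
      rw [LinearMap.comp_apply, this, map_zero]
    · intro x
      have := congrArg S.subtype (b.sum_repr ((p j ∘ₗ gpr A.gr j).codRestrict S hS x))
      rw [map_sum] at this
      simp only [map_sum, LinearMap.sum_apply, op_tmul]
      exact this
  choose τ hτ1 hτ2 using loc
  have pz : ∀ j, Subsingleton (Hg A.gr A.d j) → ∀ x ∈ A.gr j, p j x = 0 := by
    intro j hj x hx
    have h1 := yZ j x hx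
    have h2 : Subsingleton (Zg A.gr A.d j ⧸
      Submodule.comap (Zg A.gr A.d j).subtype (Bg A.gr A.d j)) := hj
    rw [Submodule.Quotient.subsingleton_iff] at h2
    have h3 : (⟨y j x, h1⟩ : Zg A.gr A.d j) ∈
      Submodule.comap (Zg A.gr A.d j).subtype (Bg A.gr A.d j) := by rw [h2]; trivial
    have h4 := ρid j _ h3
    simp only [Submodule.subtype_apply] at h4
    simp [hp, h4]
  refine ⟨gsum A.gr fun j => σ j ∘ₗ ρ j ∘ₗ y j, ∑ j ∈ hc.2.toFinset, τ j, fun j x hx => ?_,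
    sum_mem fun j _ => hτ1 j, fun x => ?_⟩
  · rw [gsum_of_mem _ _ hx]
    exact (hσ j _ (ρB j _)).1
  · refine gr_ext A.gr (f := LinearMap.id - A.d ∘ₗ (gsum A.gr fun j => σ j ∘ₗ ρ j ∘ₗ y j) -
      (gsum A.gr fun j => σ j ∘ₗ ρ j ∘ₗ y j) ∘ₗ A.d) (fun j x hx => ?_) x
    have e1 : y (j + 1) (A.d x) = A.d x := by simp [hy, A.d_sq]
    simp only [LinearMap.sub_apply, LinearMap.comp_apply, LinearMap.id_apply, gsum_of_mem _ _ hx,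
      gsum_of_mem _ _ (A.d_deg j x hx), (hσ j _ (ρB j _)).2, e1, ρid _ _ (dB j x hx), map_sum,
      LinearMap.sum_apply, hτ2]
    have e2 : x - ρ j (y j x) - σ (j + 1) (A.d x) = p j x := by simp [hp, hy]; abel
    rw [e2, Finset.sum_eq_single j]
    · rw [gpr_same A.gr hx]
    · intro i _ hij
      rw [gpr_ne A.gr (Ne.symm hij) hx, map_zero]
    · intro hj
      have : Subsingleton (Hg A.gr A.d j) := by
        by_contra h; exact hj (by simpa using h)
      rw [pz j this _ (gpr_mem A.gr j x)]

theorem op_QI (hc : IsCompactAlg A) : QI (N1 A) (HomR (rA A)) (op A) := by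
  obtain ⟨κ, π, hκ, hπ, hκπ⟩ := exists_kappa hc
  -- composition with the homotopy
  have κε : ∀ x, epz A 1 (κ (epz A 1 x)) = - κ x := by
    intro x
    refine gr_ext A.gr (f := epz A 1 ∘ₗ κ ∘ₗ epz A 1) (g := -κ) (fun j x hx => ?_) x
    simp [ep_of_mem hx, ep_of_mem (hκ j x hx), sgnk_pred, sgnk_smul_smul]
  set K2 : (A.R →ₗ[k] A.R) →ₗ[k] (A.R →ₗ[k] A.R) := LinearMap.lcomp k A.R (κ ∘ₗ epz A 1) with hK2
  set K1 : ((A.R →ₗ[k] k) ⊗[k] A.R) →ₗ[k] ((A.R →ₗ[k] k) ⊗[k] A.R) :=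
    TensorProduct.map (LinearMap.lcomp k k (κ ∘ₗ epz A 1)) LinearMap.id with hK1
  have hK : ∀ t, op A (K1 t) = K2 (op A t) := by
    intro t
    refine tt_ext (f := op A ∘ₗ K1) (g := K2 ∘ₗ op A) (fun ν a => ?_) t
    ext c; simp [hK1, hK2, op_tmul]
  have K1d : ∀ j, ∀ t ∈ (N1 A).gm j, K1 t ∈ (N1 A).gm (j - 1) := by
    intro j t ht
    refine ttGr_le (Y := Adual A) (X := dT A) K1 ((N1 A).gm (j - 1)) (fun i i' ν a h hν ha => ?_) ht
    simp only [hK1, TensorProduct.map_tmul, LinearMap.id_apply]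
    refine tmul_ttGr (Y := Adual A) (X := dT A) (i := i - 1) (by omega) ?_ ha
    intro l hl c hcc
    simp only [LinearMap.lcomp_apply, LinearMap.comp_apply]
    exact hν _ (by omega) _ (hκ _ _ (epz_deg 1 hcc))
  have K2d : ∀ j, ∀ t ∈ (HomR (rA A)).gm j, K2 t ∈ (HomR (rA A)).gm (j - 1) := by
    intro j t ht i c hcc
    have := ht _ _ (hκ _ _ (epz_deg 1 hcc))
    rwa [show i - 1 + j = i + (j - 1) by ring] at this
  set Pr : (A.R →ₗ[k] A.R) → ((A.R →ₗ[k] k) ⊗[k] A.R) :=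
    fun ψ => TensorProduct.map LinearMap.id ψ π with hPr
  have opPr : ∀ ψ, op A (Pr ψ) = ψ ∘ₗ op A π := by
    intro ψ
    refine tt_ext (f := op A ∘ₗ TensorProduct.map LinearMap.id ψ)
      (g := ψ.compRight k ∘ₗ op A) (fun ν a => ?_) π
    ext c; simp [op_tmul]
  have Prd : ∀ j, ∀ ψ ∈ (HomR (rA A)).gm j, Pr ψ ∈ (N1 A).gm j := by
    intro j ψ hψ
    refine ttGr_le (Y := Adual A) (X := dT A) (TensorProduct.map LinearMap.id ψ)
      ((N1 A).gm j) (fun i i' ν a h hν ha => ?_) hπ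
    exact tmul_ttGr (Y := Adual A) (X := dT A) (by omega) hν (hψ i' a ha)
  have hom : ∀ ψ, op A (Pr ψ) + (HomR (rA A)).D (K2 ψ) + K2 ((HomR (rA A)).D ψ) = ψ := by
    intro ψ
    rw [opPr]
    ext c
    simp only [hK2, LinearMap.add_apply, LinearMap.comp_apply, LinearMap.sub_apply,
      LinearMap.lcomp_apply, LinearMap.compRight_apply, ← hκπ, κε, epz_self, map_sub, map_neg,
      ep_d]
    abel
  constructor
  · intro j Φ hΦ hD ψ hψ hψD
    refine ⟨Pr ψ + K1 Φ, add_mem (Prd _ _ hψ) (K1d _ _ hΦ), op_inj ?_⟩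
    have : op A (Pr ψ + K1 Φ) = ψ - (HomR (rA A)).D (K2 ψ) := by
      rw [map_add, hK, ← hψD]
      have := hom ψ
      rw [add_right_comm] at this
      exact eq_sub_of_add_eq this
    rw [op_mor.dd, this, map_sub, (HomR (rA A)).DD, sub_zero, hψD]
  · intro j ψ hψ hψD
    have e : op A (Pr ψ) = ψ - (HomR (rA A)).D (K2 ψ) := by
      have := hom ψ
      rw [hψD, map_zero, add_zero] at this
      exact eq_sub_of_add_eq this
    refine ⟨Pr ψ, Prd _ _ hψ, op_inj ?_, -(K2 ψ), neg_mem (K2d _ _ hψ), ?_⟩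
    · rw [op_mor.dd, e, map_sub, (HomR (rA A)).DD, hψD, sub_zero, map_zero]
    · rw [e, map_neg]; abel

theorem N1_null (hconc : ∀ i : ℤ, 0 < i → A.gr i = ⊥) (hc : IsCompactAlg A) {P : DGBimod A}
    (hP : Proj P) {F : P.M →ₗ[k] A.R} (hF : IsMor (tg P) (dT A) F)
    (hq : QI (tg P) (dT A) F) {s0 : P.M} (h0 : s0 ∈ P.gm 0) (hD : P.D s0 = 0) {a₁ : A.R}
    (h1 : a₁ ∈ A.gr (-1)) (hs : F s0 = 1 + A.d a₁) {m : ℤ} (hm : 0 < m) {g : P.M →ₗ[k] (N1 A).M}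
    (hg : IsMor (tg P) (Sh m (N1 A)) g) : Null (tg P) (Sh m (N1 A)) g := by
  obtain ⟨t, h, ht, hh, tr, hr, td, key⟩ := right_data hP hF hq h0 hD h1 hs
  refine hP.inj (op_mor.sh m) (((op_QI hc).sh m).fib (op_mor.sh m)) hg ?_
  have hog := (op_mor.sh m).comp hg
  set f : P.M →ₗ[k] (A.R →ₗ[k] A.R) := op A ∘ₗ g with hf
  have fl : ∀ x p c, f (P.actL x p) c = f p (c * epz A m x) := fun x p c =>
    congrArg (fun φ : A.R →ₗ[k] A.R => φ c) (hog.l x p)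
  have fr : ∀ x p c, f (P.actR x p) c = f p c * x := fun x p c =>
    congrArg (fun φ : A.R →ₗ[k] A.R => φ c) (hog.r x p)
  have fD : ∀ p c, f (P.D p) c = sgnk k m • (A.d (f p (epz A 1 c)) - f p (A.d (epz A 1 c))) :=
    fun p c => congrArg (fun φ : A.R →ₗ[k] A.R => φ c) (hog.dd p)
  have fdeg : ∀ j, ∀ p ∈ P.gm j, ∀ i, ∀ c ∈ A.gr i, f p c ∈ A.gr (i + (j + m)) :=
    fun j p hp i c hc => hog.deg j p hp i c hc
  set β : P.M →ₗ[k] A.R := f.flip 1 with hβ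
  have fβ : ∀ p c, f p c = β (P.actL (epz A m c) p) := fun p c => by
    rw [hβ, LinearMap.flip_apply, fl, one_mul, epz_self]
  have βr : ∀ x p, β (P.actR x p) = β p * x := fun x p => fr x p 1
  have βD : ∀ p, β (P.D p) = sgnk k m • A.d (β p) := fun p => by
    have := fD p 1
    rw [epz_one, d_one, map_zero, sub_zero] at this
    exact this
  have βs : β s0 = 0 := by
    have := fdeg 0 s0 h0 0 1 A.one_mem
    rw [zero_add, zero_add, hconc m hm] at this
    exact this
  have βk : ∀ p, β p = sgnk k m • A.d (β (h p)) + β (h (P.D p)) := fun p => by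
    have := congrArg β (key p)
    rwa [map_add, map_add, βr, βs, zero_mul, zero_add, βD] at this
  set γ : P.M →ₗ[k] (A.R →ₗ[k] A.R) :=
    LinearMap.mk₂ k (fun p c => β (h (P.actL (epz A (m + 1) c) p)))
    (by intros; simp) (by intros; simp) (by intros; simp) (by intros; simp) with hγ
  have γa : ∀ p c, γ p c = β (h (P.actL (epz A (m + 1) c) p)) := fun p c => rfl
  refine ⟨γ, ⟨fun j p hp i c hc => ?_, fun x p => ?_, fun x p => ?_⟩, fun p => ?_⟩
  · rw [γa]
    have e1 := hh _ _ (P.actL_deg i j _ p (epz_deg (m + 1) hc) hp)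
    have e2 := fdeg _ _ e1 0 1 A.one_mem
    rw [show 0 + (i + j - 1 + m) = i + (j - 1 + m) by ring] at e2
    exact e2
  · ext c
    show γ (P.actL x p) c = γ p (c * epz A m (epz A 1 x))
    rw [γa, γa, epz_mul, epz_epz m 1, epz_self, P.actL_mul]
  · ext c
    show γ (P.actR x p) c = γ p c * x
    rw [γa, γa, P.actLR, hr, βr]
  · ext c
    show f p c = sgnk k m • (A.d (γ p (epz A 1 c)) - γ p (A.d (epz A 1 c))) + γ (P.D p) c
    rw [γa, γa, γa, fβ]
    set x := epz A m c with hx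
    have hc : c = epz A m x := by rw [hx, epz_self]
    have e1 : epz A (m + 1) (epz A 1 c) = x := by
      rw [hc, epz_epz, epz_epz]; exact epz_even ⟨m + 1, by ring⟩ x
    have e2 : epz A (m + 1) c = epz A 1 x := by
      rw [hx, epz_epz, add_comm]
    have e3 : epz A (m + 1) (A.d (epz A 1 c)) = - (sgnk k m • A.d x) := by
      have : epz A 1 c = epz A (m + 1) x := by rw [← e1, epz_self]
      rw [this, epz_d, map_smul, epz_self, sgnk_succ, neg_smul]
    rw [e1, e2, e3, βk]
    simp only [map_neg, map_smul, LinearMap.neg_apply, LinearMap.smul_apply, sub_neg_eq_add,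
      smul_add, sgnk_smul_smul, b_DL, map_add]
    rw [add_assoc]

/-- quotient targets -/
@[reducible] def Quo (N : Tgt A) (K : Submodule k N.M) (hE : K ≤ K.comap N.E)
    (hD : K ≤ K.comap N.D) (hL : ∀ a, K ≤ K.comap (N.L a)) (hR : ∀ a, K ≤ K.comap (N.R a)) :
    Tgt A where
  M := N.M ⧸ K
  gm := fun j => (N.gm j).map K.mkQ
  E := K.mapQ K N.E hE
  D := K.mapQ K N.D hD
  L := { toFun := fun a => K.mapQ K (N.L a) (hL a)
         map_add' := fun a b => by ext; simp
         map_smul' := fun a b => by ext; simp }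
  R := { toFun := fun a => K.mapQ K (N.R a) (hR a)
         map_add' := fun a b => by ext; simp
         map_smul' := fun a b => by ext; simp }
  L_one := fun m => by
    obtain ⟨m, rfl⟩ := K.mkQ_surjective m
    simp [N.L_one]
  R_one := fun m => by
    obtain ⟨m, rfl⟩ := K.mkQ_surjective m
    simp [N.R_one]
  L_mul := fun x y m => by
    obtain ⟨m, rfl⟩ := K.mkQ_surjective m
    simp [N.L_mul]
  R_mul := fun x y m => by
    obtain ⟨m, rfl⟩ := K.mkQ_surjective m
    simp [N.R_mul]
  LR := fun x y m => by
    obtain ⟨m, rfl⟩ := K.mkQ_surjective m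
    simp [N.LR]
  DD := fun m => by
    obtain ⟨m, rfl⟩ := K.mkQ_surjective m
    simp [N.DD]
  DL := fun x m => by
    obtain ⟨m, rfl⟩ := K.mkQ_surjective m
    simp [N.DL]
  DR := fun x m => by
    obtain ⟨m, rfl⟩ := K.mkQ_surjective m
    simp [N.DR]
  E_deg := fun j m hm => by
    obtain ⟨m, hm, rfl⟩ := hm
    simp [N.E_deg _ _ hm]
  L_deg := fun i j x m hx hm => by
    obtain ⟨m, hm, rfl⟩ := hm
    exact ⟨_, N.L_deg i j x m hx hm, rfl⟩
  R_deg := fun i j x m hx hm => by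
    obtain ⟨m, hm, rfl⟩ := hm
    exact ⟨_, N.R_deg i j x m hx hm, rfl⟩
  D_deg := fun j m hm => by
    obtain ⟨m, hm, rfl⟩ := hm
    exact ⟨_, N.D_deg j m hm, rfl⟩

/-- relations of the tensor product over A -/
def KK (Y X : Tgt A) : Submodule k (Y.M ⊗[k] X.M) :=
  Submodule.span k {z | ∃ ν a x, z = Y.R a ν ⊗ₜ[k] x - ν ⊗ₜ[k] X.L a x}

theorem KK_gen (Y X : Tgt A) (a : A.R) (ν : Y.M) (x : X.M) :
    Y.R a ν ⊗ₜ[k] x - ν ⊗ₜ[k] X.L a x ∈ KK Y X := Submodule.subset_span ⟨ν, a, x, rfl⟩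

theorem KK_le (Y X : Tgt A) {W : Type} [AddCommGroup W] [Module k W] (f : Y.M ⊗[k] X.M →ₗ[k] W)
    (U : Submodule k W) (h : ∀ a ν x, f (Y.R a ν ⊗ₜ x - ν ⊗ₜ X.L a x) ∈ U) :
    KK Y X ≤ U.comap f := by
  rw [KK, Submodule.span_le]
  rintro _ ⟨ν, a, x, rfl⟩
  exact h a ν x

/-- tensor product over A -/
def QQ (Y X : Tgt A) (hY : SgnOK Y) (hX : SgnOK X) : Tgt A :=
  Quo (TT Y X hY) (KK Y X)
    (KK_le Y X _ _ fun a ν x => by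
      have := KK_gen Y X (epz A 1 a) (Y.E ν) (X.E x)
      simpa [hY.ER, hX.EL] using this)
    (KK_le Y X _ _ fun a ν x => by
      have h1 := KK_gen Y X a (Y.D ν) x
      have h2 := KK_gen Y X (A.d a) (Y.E ν) x
      have h3 := KK_gen Y X (epz A 1 a) (Y.E ν) (X.D x)
      have := add_mem (add_mem h1 h2) h3
      convert this using 1
      simp [hY.ER, Y.DR, X.DL, TensorProduct.add_tmul, TensorProduct.tmul_add]
      abel)
    (fun b => KK_le Y X _ _ fun a ν x => by
      have := KK_gen Y X a (Y.L b ν) x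
      simpa [Y.LR] using this)
    (fun b => KK_le Y X _ _ fun a ν x => by
      have := KK_gen Y X a ν (X.R b x)
      simpa [X.LR] using this)

/-- class of a pure tensor -/
def qm (Y X : Tgt A) (hY : SgnOK Y) (hX : SgnOK X) : Y.M →ₗ[k] X.M →ₗ[k] (QQ Y X hY hX).M :=
  (TensorProduct.mk k Y.M X.M).compr₂ (KK Y X).mkQ

section
variable {Y X : Tgt A} {hY : SgnOK Y} {hX : SgnOK X}

theorem qm_bal (a : A.R) (ν : Y.M) (x : X.M) :
    qm Y X hY hX (Y.R a ν) x = qm Y X hY hX ν (X.L a x) := by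
  have := KK_gen Y X a ν x
  exact (Submodule.Quotient.eq _).2 this

theorem qm_D (ν : Y.M) (x : X.M) :
    (QQ Y X hY hX).D (qm Y X hY hX ν x) = qm Y X hY hX (Y.D ν) x + qm Y X hY hX (Y.E ν) (X.D x) :=
  rfl

theorem qm_L (a : A.R) (ν : Y.M) (x : X.M) :
    (QQ Y X hY hX).L a (qm Y X hY hX ν x) = qm Y X hY hX (Y.L a ν) x := rfl

theorem qm_R (a : A.R) (ν : Y.M) (x : X.M) :
    (QQ Y X hY hX).R a (qm Y X hY hX ν x) = qm Y X hY hX ν (X.R a x) := rfl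

theorem qm_deg {i j n : ℤ} {ν : Y.M} {x : X.M} (h : i + j = n) (hν : ν ∈ Y.gm i) (hx : x ∈ X.gm j) :
    qm Y X hY hX ν x ∈ (QQ Y X hY hX).gm n := ⟨_, tmul_ttGr h hν hx, rfl⟩

theorem q_ext {W : Type} [AddCommGroup W] [Module k W] {f g : (QQ Y X hY hX).M →ₗ[k] W}
    (h : ∀ ν x, f (qm Y X hY hX ν x) = g (qm Y X hY hX ν x)) (z : (QQ Y X hY hX).M) : f z = g z := by
  obtain ⟨t, rfl⟩ := (KK Y X).mkQ_surjective z
  exact tt_ext (f := f ∘ₗ (KK Y X).mkQ) (g := g ∘ₗ (KK Y X).mkQ) h t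

theorem q_deg {W : Type} [AddCommGroup W] [Module k W] (f : (QQ Y X hY hX).M →ₗ[k] W)
    (U : Submodule k W) {n : ℤ}
    (h : ∀ i j ν x, i + j = n → ν ∈ Y.gm i → x ∈ X.gm j → f (qm Y X hY hX ν x) ∈ U)
    {z : (QQ Y X hY hX).M} (hz : z ∈ (QQ Y X hY hX).gm n) : f z ∈ U := by
  obtain ⟨t, ht, rfl⟩ := hz
  exact ttGr_le (f ∘ₗ (KK Y X).mkQ) U h ht

/-- maps out of the tensor product over A -/
def qlift (hY : SgnOK Y) (hX : SgnOK X) {W : Type} [AddCommGroup W] [Module k W]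
    (b : Y.M →ₗ[k] X.M →ₗ[k] W)
    (hb : ∀ a ν x, b (Y.R a ν) x = b ν (X.L a x)) : (QQ Y X hY hX).M →ₗ[k] W :=
  (KK Y X).liftQ (TensorProduct.lift b) (by
    have := KK_le Y X (TensorProduct.lift b) ⊥ (fun a ν x => by simp [hb])
    exact this)

theorem qlift_qm {W : Type} [AddCommGroup W] [Module k W] (b : Y.M →ₗ[k] X.M →ₗ[k] W)
    (hb : ∀ a ν x, b (Y.R a ν) x = b ν (X.L a x)) (ν : Y.M) (x : X.M) :
    qlift hY hX b hb (qm Y X hY hX ν x) = b ν x := rfl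

/-- ν ⊗ x ↦ ν Λ(x) -/
def phi (hY : SgnOK Y) (hX : SgnOK X) (Λ : X.M →ₗ[k] A.R) (hl : ∀ a x, Λ (X.L a x) = a * Λ x) :
    (QQ Y X hY hX).M →ₗ[k] Y.M :=
  qlift hY hX (Y.R.flip.compl₂ Λ) (fun a ν x => by simp [hl, Y.R_mul])

theorem phi_qm (Λ : X.M →ₗ[k] A.R) (hl : ∀ a x, Λ (X.L a x) = a * Λ x) (ν : Y.M) (x : X.M) :
    phi hY hX Λ hl (qm Y X hY hX ν x) = Y.R (Λ x) ν := rfl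

theorem phi_dd (Λ : X.M →ₗ[k] A.R) (hl : ∀ a x, Λ (X.L a x) = a * Λ x)
    (hd : ∀ x, Λ (X.D x) = A.d (Λ x)) (z : (QQ Y X hY hX).M) :
    phi hY hX Λ hl ((QQ Y X hY hX).D z) = Y.D (phi hY hX Λ hl z) := by
  refine q_ext (f := phi hY hX Λ hl ∘ₗ (QQ Y X hY hX).D) (g := Y.D ∘ₗ phi hY hX Λ hl)
    (fun ν x => ?_) z
  simp only [LinearMap.comp_apply, qm_D, map_add, phi_qm, hd, Y.DR]

theorem phi_deg (Λ : X.M →ₗ[k] A.R) (hl : ∀ a x, Λ (X.L a x) = a * Λ x)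
    (hd : ∀ j, ∀ x ∈ X.gm j, Λ x ∈ A.gr j) {n : ℤ} {z : (QQ Y X hY hX).M}
    (hz : z ∈ (QQ Y X hY hX).gm n) : phi hY hX Λ hl z ∈ Y.gm n := by
  refine q_deg _ (Y.gm n) (fun i j ν x h hν hx => ?_) hz
  rw [phi_qm, ← h]
  exact Y.R_deg _ _ _ _ (hd j x hx) hν

theorem phi_mor {Λ : X.M →ₗ[k] A.R} (hΛ : IsMor X (dT A) Λ)
    (hl : ∀ a x, Λ (X.L a x) = a * Λ x) :
    IsMor (QQ Y X hY hX) Y (phi hY hX Λ hl) := by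
  refine ⟨fun j z hz => phi_deg Λ hl hΛ.deg hz, fun a z => ?_, fun a z => ?_,
    phi_dd Λ hl hΛ.dd⟩
  · refine q_ext (f := phi hY hX Λ hl ∘ₗ (QQ Y X hY hX).L a) (g := Y.L a ∘ₗ phi hY hX Λ hl)
      (fun ν x => ?_) z
    simp only [LinearMap.comp_apply, qm_L, phi_qm, Y.LR]
  · refine q_ext (f := phi hY hX Λ hl ∘ₗ (QQ Y X hY hX).R a) (g := Y.R a ∘ₗ phi hY hX Λ hl)
      (fun ν x => ?_) z
    have e : Λ (X.R a x) = Λ x * a := hΛ.r a x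
    simp only [LinearMap.comp_apply, qm_R, phi_qm, e, Y.R_mul]

/-- homotopy version -/
def eta (hY : SgnOK Y) (hX : SgnOK X) (h : X.M →ₗ[k] A.R)
    (hl : ∀ a x, h (X.L a x) = epz A 1 a * h x) : (QQ Y X hY hX).M →ₗ[k] Y.M :=
  qlift hY hX ((Y.R.flip.compl₂ h) ∘ₗ Y.E) (fun a ν x => by simp [hl, hY.ER, Y.R_mul])

theorem eta_qm (h : X.M →ₗ[k] A.R) (hl : ∀ a x, h (X.L a x) = epz A 1 a * h x) (ν : Y.M)
    (x : X.M) : eta hY hX h hl (qm Y X hY hX ν x) = Y.R (h x) (Y.E ν) := rfl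

theorem eta_deg (h : X.M →ₗ[k] A.R) (hl : ∀ a x, h (X.L a x) = epz A 1 a * h x)
    (hd : ∀ j, ∀ x ∈ X.gm j, h x ∈ A.gr (j - 1)) {n : ℤ} {z : (QQ Y X hY hX).M}
    (hz : z ∈ (QQ Y X hY hX).gm n) : eta hY hX h hl z ∈ Y.gm (n - 1) := by
  refine q_deg _ (Y.gm (n - 1)) (fun i j ν x e hν hx => ?_) hz
  rw [eta_qm, ← e, add_sub_assoc, Y.E_deg _ _ hν]
  exact Y.R_deg _ _ _ _ (hd j x hx) (Submodule.smul_mem _ _ hν)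

theorem eta_eq (Λ : X.M →ₗ[k] A.R) (hΛ : ∀ a x, Λ (X.L a x) = a * Λ x) (h : X.M →ₗ[k] A.R)
    (hl : ∀ a x, h (X.L a x) = epz A 1 a * h x) (he : ∀ x, Λ x = A.d (h x) + h (X.D x))
    (z : (QQ Y X hY hX).M) : phi hY hX Λ hΛ z =
      Y.D (eta hY hX h hl z) + eta hY hX h hl ((QQ Y X hY hX).D z) := by
  refine q_ext (g := Y.D ∘ₗ eta hY hX h hl + eta hY hX h hl ∘ₗ (QQ Y X hY hX).D)
    (fun ν x => ?_) z
  simp only [LinearMap.add_apply, LinearMap.comp_apply, qm_D, map_add, phi_qm, eta_qm, he, Y.DR,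
    hY.EE, hY.DE, map_neg]
  abel

theorem phi_null {Λ : X.M →ₗ[k] A.R} (hl : ∀ a x, Λ (X.L a x) = a * Λ x) (hn : Null X (dT A) Λ) :
    Null (QQ Y X hY hX) Y (phi hY hX Λ hl) := by
  obtain ⟨h, hh, he⟩ := hn
  have hr : ∀ a x, h (X.L a x) = epz A 1 a * h x := hh.l
  refine ⟨eta hY hX h hr, ⟨fun j z hz => eta_deg h hr hh.deg hz, fun a z => ?_, fun a z => ?_⟩,
    eta_eq Λ hl h hr he⟩
  · refine q_ext (f := eta hY hX h hr ∘ₗ (QQ Y X hY hX).L a)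
      (g := Y.L (epz A 1 a) ∘ₗ eta hY hX h hr) (fun ν x => ?_) z
    simp only [LinearMap.comp_apply, qm_L, eta_qm, Y.LR, hY.EL]
  · refine q_ext (f := eta hY hX h hr ∘ₗ (QQ Y X hY hX).R a) (g := Y.R a ∘ₗ eta hY hX h hr)
      (fun ν x => ?_) z
    have e : h (X.R a x) = h x * a := hh.r a x
    simp only [LinearMap.comp_apply, qm_R, eta_qm, e, Y.R_mul]

/-- functoriality -/
def qmap (hY : SgnOK Y) (hX : SgnOK X) {X' : Tgt A} (hX' : SgnOK X') (u : X.M →ₗ[k] X'.M)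
    (hu : IsMor X X' u) : (QQ Y X hY hX).M →ₗ[k] (QQ Y X' hY hX').M :=
  qlift hY hX ((qm Y X' hY hX').compl₂ u) (fun a ν x => by simp [hu.l, qm_bal])

theorem qmap_qm {X' : Tgt A} {hX' : SgnOK X'} {u : X.M →ₗ[k] X'.M} (hu : IsMor X X' u) (ν : Y.M)
    (x : X.M) : qmap hY hX hX' u hu (qm Y X hY hX ν x) = qm Y X' hY hX' ν (u x) := rfl

theorem qmap_mor {X' : Tgt A} {hX' : SgnOK X'} {u : X.M →ₗ[k] X'.M} (hu : IsMor X X' u) :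
    IsMor (QQ Y X hY hX) (QQ Y X' hY hX') (qmap hY hX hX' u hu) := by
  refine ⟨fun n z hz => ?_, fun a z => ?_, fun a z => ?_, fun z => ?_⟩
  · refine q_deg _ ((QQ Y X' hY hX').gm n) (fun i j ν x e hν hx => ?_) hz
    rw [qmap_qm]; exact qm_deg e hν (hu.deg j x hx)
  · refine q_ext (f := qmap hY hX hX' u hu ∘ₗ (QQ Y X hY hX).L a)
      (g := (QQ Y X' hY hX').L a ∘ₗ qmap hY hX hX' u hu) (fun ν x => ?_) z
    simp only [LinearMap.comp_apply, qm_L, qmap_qm]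
  · refine q_ext (f := qmap hY hX hX' u hu ∘ₗ (QQ Y X hY hX).R a)
      (g := (QQ Y X' hY hX').R a ∘ₗ qmap hY hX hX' u hu) (fun ν x => ?_) z
    simp only [LinearMap.comp_apply, qm_R, qmap_qm, hu.r]
  · refine q_ext (f := qmap hY hX hX' u hu ∘ₗ (QQ Y X hY hX).D)
      (g := (QQ Y X' hY hX').D ∘ₗ qmap hY hX hX' u hu) (fun ν x => ?_) z
    simp only [LinearMap.comp_apply, qm_D, qmap_qm, hu.dd, map_add]
end

/-- ν ⊗ p ↦ Eν ⊗ h p -/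
def qht {Y : Tgt A} (hY : SgnOK Y) {X : Tgt A} (hX : SgnOK X) (h : X.M →ₗ[k] X.M)
    (hl : ∀ x p, h (X.L x p) = X.L (epz A 1 x) (h p)) :
    (QQ Y X hY hX).M →ₗ[k] (QQ Y X hY hX).M :=
  qlift hY hX (((qm Y X hY hX).compl₂ h) ∘ₗ Y.E) (fun a ν x => by
    simp [hl, hY.ER, qm_bal])

theorem qht_qm {Y : Tgt A} {hY : SgnOK Y} {X : Tgt A} {hX : SgnOK X} (h : X.M →ₗ[k] X.M)
    (hl : ∀ x p, h (X.L x p) = X.L (epz A 1 x) (h p)) (ν : Y.M) (p : X.M) :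
    qht hY hX h hl (qm Y X hY hX ν p) = qm Y X hY hX (Y.E ν) (h p) := rfl

theorem phi_QI {Y : Tgt A} {hY : SgnOK Y} {X : Tgt A} {hX : SgnOK X} {F : X.M →ₗ[k] A.R}
    (Fdeg : ∀ j, ∀ p ∈ X.gm j, F p ∈ A.gr j) (FD : ∀ p, F (X.D p) = A.d (F p)) {s0 : X.M} (h0 : s0 ∈ X.gm 0) (hD : X.D s0 = 0) {a₁ : A.R}
    (h1 : a₁ ∈ A.gr (-1)) (hs : F s0 = 1 + A.d a₁)
    (Fl : ∀ x p, F (X.L x p) = x * F p) {t : X.M →ₗ[k] A.R} {h : X.M →ₗ[k] X.M}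
    (ht : ∀ j, ∀ p ∈ X.gm j, t p ∈ A.gr j)
    (hh : ∀ j, ∀ p ∈ X.gm j, h p ∈ X.gm (j - 1)) (tl : ∀ x p, t (X.L x p) = x * t p)
    (hl : ∀ x p, h (X.L x p) = X.L (epz A 1 x) (h p)) (td : ∀ p, t (X.D p) = A.d (t p))
    (key : ∀ p, p = X.L (t p) s0 + X.D (h p) + h (X.D p)) :
    QI (QQ Y X hY hX) Y (phi hY hX F Fl) := by
  set S := (qm Y X hY hX).flip s0 with hS
  have SD : ∀ ν, (QQ Y X hY hX).D (S ν) = S (Y.D ν) := fun ν => by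
    simp only [hS, LinearMap.flip_apply, qm_D]
    rw [hD, map_zero, add_zero]
  have Sdeg : ∀ j, ∀ ν ∈ Y.gm j, S ν ∈ (QQ Y X hY hX).gm j := fun j ν hν =>
    qm_deg (add_zero j) hν h0
  have aD : ∀ ν, Y.D ν = 0 → Y.D (Y.R a₁ (Y.E ν)) = Y.R (A.d a₁) ν := fun ν hν => by
    rw [Y.DR, hY.DE, hν, hY.EE]; simp
  have adeg : ∀ j, ∀ ν ∈ Y.gm j, Y.R a₁ (Y.E ν) ∈ Y.gm (j - 1) := fun j ν hν => by
    rw [Y.E_deg _ _ hν]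
    exact Y.R_deg _ _ _ _ h1 (Submodule.smul_mem _ _ hν)
  constructor
  · intro j n hn hDn n' hn' he
    set u := phi hY hX t tl n with hu
    have uD : Y.D u = 0 := by
      rw [hu, ← phi_dd t tl td, hDn, map_zero]
    have udeg : u ∈ Y.gm j := phi_deg t tl ht hn
    have FHl : ∀ x p, (F ∘ₗ h) (X.L x p) = epz A 1 x * (F ∘ₗ h) p := fun x p => by
      simp only [LinearMap.comp_apply, hl, Fl]
    have Λl : ∀ x p, (F - (LinearMap.mul k A.R).flip (F s0) ∘ₗ t) (X.L x p) =
        x * (F - (LinearMap.mul k A.R).flip (F s0) ∘ₗ t) p := fun x p => by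
      simp [Fl, tl, mul_sub, mul_assoc]
    have e1 := eta_eq (hY := hY) (hX := hX) _ Λl (F ∘ₗ h) FHl (fun p => by
      have := congrArg F (key p)
      rw [map_add, map_add, Fl, FD] at this
      simp only [LinearMap.sub_apply, LinearMap.comp_apply, LinearMap.flip_apply,
        LinearMap.mul_apply']
      rw [sub_eq_iff_eq_add, this]; abel) n
    have e2 : phi hY hX _ Λl n = phi hY hX F Fl n - Y.R (F s0) u := by
      refine q_ext (g := phi hY hX F Fl - Y.R (F s0) ∘ₗ phi hY hX t tl)
        (fun ν x => ?_) n
      simp only [LinearMap.sub_apply, LinearMap.comp_apply, phi_qm, map_sub, LinearMap.flip_apply,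
        LinearMap.mul_apply', Y.R_mul]
    have e3 : n = S u + (QQ Y X hY hX).D (qht hY hX h hl n) +
        qht hY hX h hl ((QQ Y X hY hX).D n) := by
      refine q_ext (f := LinearMap.id) (g := S ∘ₗ phi hY hX t tl +
        (QQ Y X hY hX).D ∘ₗ qht hY hX h hl + qht hY hX h hl ∘ₗ
        (QQ Y X hY hX).D) (fun ν x => ?_) n
      simp only [LinearMap.add_apply, LinearMap.comp_apply, phi_qm, qht_qm, qm_D, map_add,
        LinearMap.id_apply, hS, LinearMap.flip_apply, qm_bal, hY.DE, hY.EE]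
      conv_lhs => rw [key x]
      simp only [map_add, map_neg, LinearMap.neg_apply]
      abel
    set E1 := eta hY hX (F ∘ₗ h) FHl n with hE1
    have E1deg : E1 ∈ Y.gm (j - 1) := eta_deg _ FHl (fun j p hp => Fdeg _ _ (hh j p hp)) hn
    rw [e2, hDn, map_zero, add_zero, hs, map_add, LinearMap.add_apply, Y.R_one, ← aD u uD,
      ← he] at e1
    have e4 : u = Y.D (n' - E1 - Y.R a₁ (Y.E u)) := by
      rw [map_sub, map_sub, ← e1]; abel
    refine ⟨S (n' - E1 - Y.R a₁ (Y.E u)) + qht hY hX h hl n, add_mem (Sdeg _ _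
      (sub_mem (sub_mem hn' E1deg) (adeg _ _ udeg))) ?_, ?_⟩
    · refine q_deg _ ((QQ Y X hY hX).gm (j - 1)) (fun a b ν x e hν hx => ?_) hn
      rw [qht_qm, Y.E_deg _ _ hν]
      exact qm_deg (by omega) (Submodule.smul_mem _ _ hν) (hh b x hx)
    · rw [map_add, SD, ← e4]
      conv_rhs => rw [e3, hDn, map_zero, add_zero]
  · intro j ν hν hDν
    refine ⟨S ν, Sdeg j ν hν, by rw [SD, hDν, map_zero], Y.R a₁ (Y.E ν), adeg j ν hν, ?_⟩
    rw [aD ν hDν]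
    show Y.R (F s0) ν - ν = _
    rw [hs, map_add, LinearMap.add_apply, Y.R_one]; abel

theorem comp_T {Y : Tgt A} (hY : SgnOK Y) {B X X' : Tgt A} (hX : SgnOK X) (hX' : SgnOK X')
    {F : X.M →ₗ[k] A.R} (hF : IsMor X (dT A) F) {ι : X.M →ₗ[k] X'.M}
    {ρ : X'.M →ₗ[k] X.M} (hι : IsMor X X' ι) (hρ : IsMor X' X ρ)
    (hn : Null X X (ρ ∘ₗ ι - LinearMap.id)) {m : ℤ} {f : B.M →ₗ[k] Y.M}
    (Fl : ∀ x p, F (X.L x p) = x * F p) (Λ : X'.M →ₗ[k] A.R) (hΛ : Λ = F ∘ₗ ρ)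
    (Λl : ∀ x t, Λ (X'.L x t) = x * Λ t) {g : B.M →ₗ[k] (QQ Y X hY hX).M}
    (hg : IsMor B (Sh m (QQ Y X hY hX)) g)
    (hgn : Null B (Sh m Y) (f - phi hY hX F Fl ∘ₗ g)) :
    Null B (Sh m Y) (f - phi hY hX' Λ Λl ∘ₗ qmap hY hX hX' ι hι ∘ₗ g) := by
  have hn2 := hF.compNull hn
  have Δl : ∀ x p, (F ∘ₗ (ρ ∘ₗ ι - LinearMap.id)) (X.L x p) =
      x * (F ∘ₗ (ρ ∘ₗ ι - LinearMap.id)) p := fun x p => by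
    simp [hι.l, hρ.l, Fl, mul_sub]
  have h3 := ((phi_null (hY := hY) (hX := hX) Δl hn2).sh m).comp hg
  have h4 : ∀ z, phi hY hX _ Δl z = phi hY hX' Λ Λl
      (qmap hY hX hX' ι hι z) - phi hY hX F Fl z := fun z => by
    refine q_ext (g := phi hY hX' Λ Λl ∘ₗ (qmap hY hX hX' ι hι)
      - phi hY hX F Fl) (fun ν x => ?_) z
    simp only [LinearMap.sub_apply, LinearMap.comp_apply, qmap_qm, phi_qm, hΛ, map_sub,
      LinearMap.id_apply]
  convert hgn.sub h3 using 1
  ext p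
  simp only [LinearMap.sub_apply, LinearMap.comp_apply, h4]
  abel

theorem lift_T {Y : Tgt A} (hY : SgnOK Y) {X : Tgt A} (hX : SgnOK X)
    (hL : ∀ (N N' : Tgt A) (φ : N.M →ₗ[k] N'.M), IsMor N N' φ → QI N N' φ →
      ∀ f : X.M →ₗ[k] N'.M, IsMor X N' f → ∃ g, IsMor X N g ∧ Null X N' (f - φ ∘ₗ g))
    {F : X.M →ₗ[k] A.R} (hF : IsMor X (dT A) F) {s0 : X.M} (h0 : s0 ∈ X.gm 0) (hD : X.D s0 = 0)
    {a₁ : A.R} (h1 : a₁ ∈ A.gr (-1)) (hs : F s0 = 1 + A.d a₁)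
    (Fl : ∀ x p, F (X.L x p) = x * F p) {t : X.M →ₗ[k] A.R} {h : X.M →ₗ[k] X.M}
    (ht : ∀ j, ∀ p ∈ X.gm j, t p ∈ A.gr j)
    (hh : ∀ j, ∀ p ∈ X.gm j, h p ∈ X.gm (j - 1)) (tl : ∀ x p, t (X.L x p) = x * t p)
    (hl : ∀ x p, h (X.L x p) = X.L (epz A 1 x) (h p)) (td : ∀ p, t (X.D p) = A.d (t p))
    (key : ∀ p, p = X.L (t p) s0 + X.D (h p) + h (X.D p))
    {T : Tgt A} (hT : SgnOK T)
    {ι : X.M →ₗ[k] T.M} {ρ : T.M →ₗ[k] X.M} (hι : IsMor X T ι) (hρ : IsMor T X ρ)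
    (hn : Null X X (ρ ∘ₗ ι - LinearMap.id)) {m : ℤ} {f : X.M →ₗ[k] Y.M}
    (hf : IsMor X (Sh m Y) f) (Λ : T.M →ₗ[k] A.R) (hΛ : Λ = F ∘ₗ ρ)
    (Λl : ∀ x t, Λ (T.L x t) = x * Λ t) :
    ∃ g, IsMor X (Sh m (QQ Y T hY hT)) g ∧
      Null X (Sh m Y) (f - phi hY hT Λ Λl ∘ₗ g) := by
  have q1 := phi_QI (Y := Y) (hY := hY) (X := X) (hX := hX) (F := F) hF.deg hF.dd h0 hD h1
    hs Fl ht hh tl hl td key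
  obtain ⟨g, hg, hgn⟩ := hL _ _ _ ((phi_mor (hY := hY) (hX := hX) hF Fl).sh m) (q1.sh m) f hf
  have c1 := ((qmap_mor (hY := hY) (hX := hX) (hX' := hT) hι).sh m).comp hg
  have c2 := comp_T (m := m) (f := f) hY hX hT hF hι hρ hn Fl Λ hΛ Λl hg hgn
  exact ⟨_, c1, c2⟩

theorem lift_P {Y : Tgt A} (hY : SgnOK Y) {P : DGBimod A} (hP : Proj P) {F : P.M →ₗ[k] A.R}
    (hF : IsMor (tg P) (dT A) F)
    (hq : QI (tg P) (dT A) F) {s0 : P.M} (h0 : s0 ∈ P.gm 0) (hD : P.D s0 = 0) {a₁ : A.R}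
    (h1 : a₁ ∈ A.gr (-1)) (hs : F s0 = 1 + A.d a₁) {T : Tgt A} (hT : SgnOK T)
    {ι : P.M →ₗ[k] T.M} {ρ : T.M →ₗ[k] P.M} (hι : IsMor (tg P) T ι) (hρ : IsMor T (tg P) ρ)
    (hn : Null (tg P) (tg P) (ρ ∘ₗ ι - LinearMap.id)) {m : ℤ} {f : P.M →ₗ[k] Y.M}
    (hf : IsMor (tg P) (Sh m Y) f) (Λ : T.M →ₗ[k] A.R) (hΛ : Λ = F ∘ₗ ρ)
    (Λl : ∀ x t, Λ (T.L x t) = x * Λ t) :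
    ∃ g, IsMor (tg P) (Sh m (QQ Y T hY hT)) g ∧
      Null (tg P) (Sh m Y) (f - phi hY hT Λ Λl ∘ₗ g) := by
  obtain ⟨t, h, ht, hh, tl, hl, td, key⟩ := left_data hP hF hq h0 hD h1 hs
  exact lift_T (X := tg P) hY (tg_ok P) (fun N N' φ h1 h2 f hf => hP.lift h1 h2 hf) hF h0 hD h1
    hs hF.l ht hh tl hl td key hT hι hρ hn hf Λ hΛ Λl

theorem devis {P : DGBimod A} {N B : Tgt A} {s : ℕ} (q : Fin s → ℤ) (c : Fin s → N.M →ₗ[k] B.M)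
    (i : Fin s → B.M →ₗ[k] N.M) (ci : ∀ j u, c j (i j u) = u)
    (ci0 : ∀ j l u, j ≠ l → c j (i l u) = 0) (ic : ∀ z, z = ∑ l, i l (c l z))
    (cdeg : ∀ j n, ∀ z ∈ N.gm n, c j z ∈ B.gm (n - q j))
    (ideg : ∀ j n, ∀ u ∈ B.gm n, i j u ∈ N.gm (n + q j))
    (cl : ∀ j x z, c j (N.L x z) = B.L (epz A (q j) x) (c j z))
    (cr : ∀ j x z, c j (N.R x z) = B.R x (c j z))
    (il : ∀ j x u, i j (B.L x u) = N.L (epz A (q j) x) (i j u))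
    (ir : ∀ j x u, i j (B.R x u) = N.R x (i j u))
    (cD : ∀ j u, c j (N.D (i j u)) = sgnk k (q j) • B.D u)
    (cD0 : ∀ j l u, l < j ∨ (j ≠ l ∧ q j < q l + 1) → c j (N.D (i l u)) = 0)
    (nul : ∀ m : ℤ, 0 < m → ∀ g, IsMor (tg P) (Sh m B) g → Null (tg P) (Sh m B) g)
    {m : ℤ} (hm : 0 < m) {g : P.M →ₗ[k] N.M} (hg : IsMor (tg P) (Sh m N) g) :
    ∃ g', Null (tg P) (Sh m N) (g - g') ∧ ∀ j, q j ≤ 0 → ∀ p, c j (g' p) = 0 := by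
  have key : ∀ r : ℕ, r ≤ s → ∃ g', IsMor (tg P) (Sh m N) g' ∧ Null (tg P) (Sh m N) (g - g') ∧
      ∀ j : Fin s, s - r ≤ j.val → q j ≤ 0 → ∀ p, c j (g' p) = 0 := by
    intro r
    induction r with
    | zero =>
      intro _
      exact ⟨g, hg, by rw [sub_self]; exact Null.zero _ _, fun j hj => absurd j.2 (by omega)⟩
    | succ r ih =>
      intro hr
      obtain ⟨g', h1, h2, h3⟩ := ih (by omega)
      set J : Fin s := ⟨s - (r + 1), by omega⟩ with hJ
      by_cases hq : q J ≤ 0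
      swap
      · refine ⟨g', h1, h2, fun j hj hqj p => ?_⟩
        have : j ≠ J := by rintro rfl; exact hq hqj
        have : j.val ≠ s - (r + 1) := fun e => this (Fin.ext e)
        exact h3 j (by omega) hqj p
      have gl : ∀ x p, g' (P.actL x p) = N.L (epz A m x) (g' p) := h1.l
      have gr : ∀ x p, g' (P.actR x p) = N.R x (g' p) := h1.r
      have gD : ∀ p, g' (P.D p) = sgnk k m • N.D (g' p) := h1.dd
      have hs : sgnk k (m - q J) = sgnk k m * sgnk k (q J) := by
        rw [sub_eq_add_neg, sgnk_add, sgnk_neg]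
      have he : ∀ x, epz A (q J) (epz A m x) = epz A (m - q J) x := fun x => by
        rw [epz_epz]
        have : epz A (q J + m) x = epz A ((m - q J) + (q J + q J)) x := by congr 2; ring
        rw [this, ← epz_epz, epz_even ⟨q J, rfl⟩]
      have he' : ∀ x, epz A (q J) (epz A (m - q J) (epz A 1 x)) = epz A m (epz A 1 x) := fun x => by
        rw [← he, epz_self]
      have cDg : ∀ p, c J (N.D (g' p)) = sgnk k (q J) • B.D (c J (g' p)) := by
        intro p
        conv_lhs => rw [ic (g' p)]
        rw [map_sum, map_sum, Finset.sum_eq_single J, cD]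
        · intro l _ hl
          by_cases hlt : l < J
          · exact cD0 _ _ _ (Or.inl hlt)
          · by_cases hql : q l ≤ 0
            · have hv : ¬ l.val < s - (r + 1) := hlt
              have hv2 : l.val ≠ s - (r + 1) := fun e => hl (Fin.ext e)
              rw [h3 l (by omega) hql, map_zero, map_zero, map_zero]
            · exact cD0 _ _ _ (Or.inr ⟨hl.symm, by omega⟩)
        · simp
      have hc : IsMor (tg P) (Sh (m - q J) B) (c J ∘ₗ g') := by
        refine ⟨fun j p hp => ?_, fun x p => ?_, fun x p => ?_, fun p => ?_⟩
        · have := cdeg J _ _ (h1.deg j p hp)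
          rw [add_sub_assoc] at this
          exact this
        · show c J (g' (P.actL x p)) = B.L (epz A (m - q J) x) (c J (g' p))
          rw [gl, cl, he]
        · show c J (g' (P.actR x p)) = B.R x (c J (g' p))
          rw [gr, cr]
        · show c J (g' (P.D p)) = sgnk k (m - q J) • B.D (c J (g' p))
          rw [gD, map_smul, cDg, smul_smul, hs]
      obtain ⟨γ, hγ, eγ⟩ := nul _ (by omega) _ hc
      have γl : ∀ x p, γ (P.actL x p) = B.L (epz A (m - q J) (epz A 1 x)) (γ p) := hγ.l
      have γr : ∀ x p, γ (P.actR x p) = B.R x (γ p) := hγ.r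
      have γe : ∀ p, c J (g' p) = sgnk k (m - q J) • B.D (γ p) + γ (P.D p) := eγ
      have hH : IsHt (tg P) (Sh m N) (i J ∘ₗ γ) := by
        refine ⟨fun j p hp => ?_, fun x p => ?_, fun x p => ?_⟩
        · have := ideg J _ _ (hγ.deg j p hp)
          rw [show j - 1 + (m - q J) + q J = j - 1 + m by ring] at this
          exact this
        · show i J (γ (P.actL x p)) = N.L (epz A m (epz A 1 x)) (i J (γ p))
          rw [γl, il, he']
        · show i J (γ (P.actR x p)) = N.R x (i J (γ p))
          rw [γr, ir]
      set δ := (Sh m N).D ∘ₗ (i J ∘ₗ γ) + (i J ∘ₗ γ) ∘ₗ P.D with hδ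
      have δe : ∀ p, δ p = sgnk k m • N.D (i J (γ p)) + i J (γ (P.D p)) := fun p => rfl
      have hδm : IsMor (tg P) (Sh m N) δ := ht_mor hH
      have hδn : Null (tg P) (Sh m N) δ := ⟨_, hH, fun p => rfl⟩
      refine ⟨g' - δ, h1.sub hδm, ?_, fun j hj hqj p => ?_⟩
      · have := h2.add hδn
        convert this using 1
        abel
      · rw [LinearMap.sub_apply, map_sub, δe, map_add, map_smul]
        by_cases hjJ : j = J
        · subst hjJ
          rw [cD, ci, γe, smul_smul, hs, sub_self]
        · have hv2 : j.val ≠ s - (r + 1) := fun e => hjJ (Fin.ext e)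
          have hlt : J < j := by
            show s - (r + 1) < j.val
            omega
          rw [h3 j (by omega) hqj, cD0 _ _ _ (Or.inl hlt), ci0 _ _ _ hjJ]
          simp
  obtain ⟨g', h1, h2, h3⟩ := key s le_rfl
  exact ⟨g', h2, fun j => h3 j (by omega)⟩

open Classical in
/-- powers of the sign operator -/
def Ez (Y : Tgt A) (q : ℤ) : Y.M →ₗ[k] Y.M := if Even q then LinearMap.id else Y.E

theorem epz_odd {q : ℤ} (h : ¬ Even q) (x : A.R) : epz A q x = epz A 1 x := by
  rw [Int.not_even_iff_odd] at h
  obtain ⟨r, rfl⟩ := h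
  rw [← epz_epz, epz_even ⟨r, by ring⟩]

theorem sgnk_odd' {q : ℤ} (h : ¬ Even q) : sgnk k q = -1 := by
  rw [Int.not_even_iff_odd] at h
  obtain ⟨r, rfl⟩ := h
  rw [sgnk_succ, sgnk_even ⟨r, by ring⟩]

theorem Ez_self {Y : Tgt A} (hY : SgnOK Y) (q : ℤ) (ν : Y.M) : Ez Y q (Ez Y q ν) = ν := by
  unfold Ez; split_ifs with h
  · rfl
  · exact hY.EE ν

theorem Ez_L {Y : Tgt A} (hY : SgnOK Y) (q : ℤ) (x : A.R) (ν : Y.M) : Ez Y q (Y.L x ν) = Y.L (epz A q x) (Ez Y q ν) := by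
  unfold Ez; split_ifs with h
  · rw [epz_even h]; rfl
  · rw [epz_odd h]; exact hY.EL x ν

theorem Ez_D {Y : Tgt A} (hY : SgnOK Y) (q : ℤ) (ν : Y.M) : Y.D (Ez Y q ν) = sgnk k q • Ez Y q (Y.D ν) := by
  unfold Ez; split_ifs with h
  · rw [sgnk_even h, one_smul]; rfl
  · rw [sgnk_odd' h, hY.DE, neg_smul, one_smul]

theorem Ez_E {Y : Tgt A} (hY : SgnOK Y) (q : ℤ) (ν : Y.M) : Y.E (Ez Y q ν) = Ez Y q (Y.E ν) := by
  unfold Ez; split_ifs with h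
  · rfl
  · rfl

theorem Ez_deg {Y : Tgt A} (hY : SgnOK Y) (q : ℤ) {n : ℤ} {ν : Y.M} (hν : ν ∈ Y.gm n) : Ez Y q ν ∈ Y.gm n := by
  unfold Ez; split_ifs with h
  · exact hν
  · rw [Y.E_deg _ _ hν]; exact Submodule.smul_mem _ _ hν

/-- contraction -/
def psi (Y : Tgt A) (q : ℤ) : Y.M →ₗ[k] (A.R ⊗[k] A.R) →ₗ[k] (Y.M ⊗[k] A.R) :=
  LinearMap.rTensorHom A.R ∘ₗ (Y.R.flip.compr₂ (Ez Y q))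

theorem psi_tmul (Y : Tgt A) (q : ℤ) (ν : Y.M) (x y : A.R) :
    psi Y q ν (x ⊗ₜ y) = Ez Y q (Y.R x ν) ⊗ₜ y := rfl

/-- left multiplication -/
def lmu (A : DGAlgebra k) (a : A.R) : (A.R ⊗[k] A.R) →ₗ[k] (A.R ⊗[k] A.R) :=
  TensorProduct.map (LinearMap.mul k A.R a) LinearMap.id

/-- right multiplication -/
def rmu (A : DGAlgebra k) (a : A.R) : (A.R ⊗[k] A.R) →ₗ[k] (A.R ⊗[k] A.R) :=
  TensorProduct.map LinearMap.id ((LinearMap.mul k A.R).flip a)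

theorem lmu_tmul (a x y : A.R) : lmu A a (x ⊗ₜ y) = (a * x) ⊗ₜ y := rfl
theorem rmu_tmul (a x y : A.R) : rmu A a (x ⊗ₜ y) = x ⊗ₜ (y * a) := rfl

/-- coordinates -/
structure Coo (X : Tgt A) where
  s : ℕ
  q : Fin s → ℤ
  e : Fin s → X.M
  κ : Fin s → X.M →ₗ[k] A.R ⊗[k] A.R
  e_deg : ∀ j, e j ∈ X.gm (q j)
  κl : ∀ j x t, κ j (X.L x t) = lmu A x (κ j t)
  κr : ∀ j x t, κ j (X.R x t) = rmu A x (κ j t)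
  κe : ∀ j, κ j (e j) = 1 ⊗ₜ 1
  κe0 : ∀ j l, j ≠ l → κ j (e l) = 0
  κs : ∀ t, t = ∑ l, thet X 0 (e l) (κ l t)
  κdeg : ∀ j n, ∀ t ∈ X.gm n, κ j t ∈ ttGr (dT A) (dT A) (n - q j)
  κ0 : ∀ j l, l ≤ j ∨ q j < q l + 1 → κ j (X.D (e l)) = 0

namespace Coo
variable {Y X : Tgt A} (hY : SgnOK Y) (hX : SgnOK X) (C : Coo X)

/-- projections -/
def c (j : Fin C.s) : (QQ Y X hY hX).M →ₗ[k] (TT Y (dT A) hY).M :=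
  qlift hY hX ((psi Y (C.q j)).compl₂ (C.κ j)) (fun a ν x => by
    simp only [LinearMap.compl₂_apply, C.κl]
    generalize C.κ j x = w
    refine tt_ext (g := psi Y (C.q j) ν ∘ₗ lmu A a) (fun x y => ?_) w
    rw [LinearMap.comp_apply, lmu_tmul, psi_tmul, psi_tmul, Y.R_mul])

/-- inclusions -/
def i (j : Fin C.s) : (TT Y (dT A) hY).M →ₗ[k] (QQ Y X hY hX).M :=
  TensorProduct.lift (((qm Y X hY hX).compl₂ (X.R.flip (C.e j))) ∘ₗ Ez Y (C.q j))

theorem c_qm (j : Fin C.s) (ν : Y.M) (x : X.M) :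
    C.c hY hX j (qm Y X hY hX ν x) = psi Y (C.q j) ν (C.κ j x) := rfl

theorem i_tmul (j : Fin C.s) (ν : Y.M) (a : A.R) :
    C.i hY hX j (ν ⊗ₜ a) = qm Y X hY hX (Ez Y (C.q j) ν) (X.R a (C.e j)) := rfl

theorem ci (j : Fin C.s) (u) : C.c hY hX j (C.i hY hX j u) = u := by
  refine tt_ext (f := C.c hY hX j ∘ₗ C.i hY hX j) (g := LinearMap.id) (fun ν a => ?_) u
  rw [LinearMap.comp_apply, i_tmul, c_qm, C.κr, C.κe, rmu_tmul, psi_tmul, Y.R_one, Ez_self hY,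
    one_mul, LinearMap.id_apply]

theorem ci0 (j l : Fin C.s) (u) (h : j ≠ l) : C.c hY hX j (C.i hY hX l u) = 0 := by
  refine tt_ext (f := C.c hY hX j ∘ₗ C.i hY hX l) (g := 0) (fun ν a => ?_) u
  rw [LinearMap.comp_apply, i_tmul, c_qm, C.κr, C.κe0 _ _ h, map_zero, map_zero,
    LinearMap.zero_apply]

theorem ic (z : (QQ Y X hY hX).M) : z = ∑ l, C.i hY hX l (C.c hY hX l z) := by
  have : ∀ l ν w, C.i hY hX l (psi Y (C.q l) ν w) = qm Y X hY hX ν (thet X 0 (C.e l) w) := by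
    intro l ν w
    refine tt_ext (f := C.i hY hX l ∘ₗ psi Y (C.q l) ν) (g := qm Y X hY hX ν ∘ₗ thet X 0 (C.e l))
      (fun x y => ?_) w
    rw [LinearMap.comp_apply, LinearMap.comp_apply, psi_tmul, i_tmul, Ez_self hY, thet_tmul,
      epz_zero, qm_bal]
  refine (q_ext (f := LinearMap.id) (g := ∑ l, C.i hY hX l ∘ₗ C.c hY hX l) (fun ν x => ?_) z).trans
    (by simp)
  simp only [LinearMap.id_apply, LinearMap.sum_apply, LinearMap.comp_apply]
  conv_lhs => rw [C.κs x]
  rw [map_sum]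
  exact Finset.sum_congr rfl fun l _ => (this l ν (C.κ l x)).symm

theorem cdeg (j : Fin C.s) (n : ℤ) (z) (hz : z ∈ (QQ Y X hY hX).gm n) :
    C.c hY hX j z ∈ (TT Y (dT A) hY).gm (n - C.q j) := by
  refine q_deg _ (ttGr Y (dT A) (n - C.q j)) (fun a b ν x e hν hx => ?_) hz
  rw [c_qm]
  refine ttGr_le (psi Y (C.q j) ν) (ttGr Y (dT A) (n - C.q j)) (fun a' b' x y e' hx hy => ?_)
    (C.κdeg j b x hx)
  rw [psi_tmul]
  exact tmul_ttGr (X := dT A) (by omega) (Ez_deg hY _ (Y.R_deg _ _ _ _ hx hν)) hy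

theorem ideg (j : Fin C.s) (n : ℤ) (u) (hu : u ∈ (TT Y (dT A) hY).gm n) :
    C.i hY hX j u ∈ (QQ Y X hY hX).gm (n + C.q j) := by
  refine ttGr_le (Y := Y) (X := dT A) _ ((QQ Y X hY hX).gm (n + C.q j))
    (fun a b ν x e hν hx => ?_) hu
  rw [i_tmul]
  exact qm_deg (j := C.q j + b) (by omega) (Ez_deg hY _ hν) (X.R_deg _ _ _ _ hx (C.e_deg j))

theorem cl (j : Fin C.s) (x : A.R) (z) : C.c hY hX j ((QQ Y X hY hX).L x z) =
    (TT Y (dT A) hY).L (epz A (C.q j) x) (C.c hY hX j z) := by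
  refine q_ext (f := C.c hY hX j ∘ₗ (QQ Y X hY hX).L x)
    (g := (TT Y (dT A) hY).L (epz A (C.q j) x) ∘ₗ C.c hY hX j) (fun ν t => ?_) z
  rw [LinearMap.comp_apply, LinearMap.comp_apply, qm_L, c_qm, c_qm]
  generalize C.κ j t = w
  refine tt_ext (g := (TT Y (dT A) hY).L (epz A (C.q j) x) ∘ₗ psi Y (C.q j) ν) (fun x' y => ?_) w
  show _ ⊗ₜ _ = _ ⊗ₜ _
  congr 1
  show Ez Y _ (Y.R x' (Y.L x ν)) = Y.L _ (Ez Y _ (Y.R x' ν))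
  rw [← Y.LR, Ez_L hY]

theorem cr (j : Fin C.s) (x : A.R) (z) : C.c hY hX j ((QQ Y X hY hX).R x z) =
    (TT Y (dT A) hY).R x (C.c hY hX j z) := by
  refine q_ext (f := C.c hY hX j ∘ₗ (QQ Y X hY hX).R x)
    (g := (TT Y (dT A) hY).R x ∘ₗ C.c hY hX j) (fun ν t => ?_) z
  rw [LinearMap.comp_apply, LinearMap.comp_apply, qm_R, c_qm, c_qm, C.κr]
  generalize C.κ j t = w
  exact tt_ext (f := psi Y (C.q j) ν ∘ₗ rmu A x)
    (g := (TT Y (dT A) hY).R x ∘ₗ psi Y (C.q j) ν) (fun x' y => rfl) w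

theorem il (j : Fin C.s) (x : A.R) (u) : C.i hY hX j ((TT Y (dT A) hY).L x u) =
    (QQ Y X hY hX).L (epz A (C.q j) x) (C.i hY hX j u) := by
  refine tt_ext (f := C.i hY hX j ∘ₗ (TT Y (dT A) hY).L x)
    (g := (QQ Y X hY hX).L (epz A (C.q j) x) ∘ₗ C.i hY hX j) (fun ν a => ?_) u
  show C.i hY hX j (Y.L x ν ⊗ₜ a) = (QQ Y X hY hX).L (epz A (C.q j) x) (C.i hY hX j (ν ⊗ₜ a))
  rw [i_tmul, i_tmul, qm_L, Ez_L hY]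

theorem ir (j : Fin C.s) (x : A.R) (u) : C.i hY hX j ((TT Y (dT A) hY).R x u) =
    (QQ Y X hY hX).R x (C.i hY hX j u) := by
  refine tt_ext (f := C.i hY hX j ∘ₗ (TT Y (dT A) hY).R x)
    (g := (QQ Y X hY hX).R x ∘ₗ C.i hY hX j) (fun ν a => ?_) u
  show C.i hY hX j (ν ⊗ₜ (a * x)) = (QQ Y X hY hX).R x (C.i hY hX j (ν ⊗ₜ a))
  rw [i_tmul, i_tmul, qm_R, X.R_mul]

theorem cDi (j l : Fin C.s) (h : C.κ j (X.D (C.e l)) = 0) (u) :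
    C.c hY hX j ((QQ Y X hY hX).D (C.i hY hX l u)) =
      sgnk k (C.q l) • C.c hY hX j (C.i hY hX l ((TT Y (dT A) hY).D u)) := by
  refine tt_ext (f := C.c hY hX j ∘ₗ (QQ Y X hY hX).D ∘ₗ C.i hY hX l)
    (g := sgnk k (C.q l) • C.c hY hX j ∘ₗ C.i hY hX l ∘ₗ (TT Y (dT A) hY).D) (fun ν a => ?_) u
  show C.c hY hX j ((QQ Y X hY hX).D (C.i hY hX l (ν ⊗ₜ a))) =
    sgnk k (C.q l) • C.c hY hX j (C.i hY hX l (Y.D ν ⊗ₜ a + Y.E ν ⊗ₜ A.d a))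
  rw [i_tmul, qm_D, X.DR, X.E_deg _ _ (C.e_deg l), Ez_D hY, Ez_E hY]
  simp only [map_add, i_tmul, map_smul, LinearMap.smul_apply, smul_add]
  rw [c_qm _ _ _ _ _ (X.R a (X.D (C.e l))), C.κr, h]
  simp
  rfl

theorem phi_i (j : Fin C.s) (Λ : X.M →ₗ[k] A.R) (Λl : ∀ x t, Λ (X.L x t) = x * Λ t)
    (Λr : ∀ x t, Λ (X.R x t) = Λ t * x) (h : Λ (C.e j) = 0) (u) :
    phi hY hX Λ Λl (C.i hY hX j u) = 0 := by
  refine tt_ext (f := phi hY hX Λ Λl ∘ₗ C.i hY hX j) (g := 0) (fun ν a => ?_) u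
  rw [LinearMap.comp_apply, i_tmul, phi_qm, Λr, h]
  simp

end Coo

theorem Tw.kap_l {T : DGBimod A} (W : Tw T) (j : Fin W.s) (x : A.R) (t : T.M) :
    (LinearMap.proj j ∘ₗ W.iso.symm.toLinearMap) (T.actL x t) =
      lmu A x ((LinearMap.proj j ∘ₗ W.iso.symm.toLinearMap) t) := by
  refine W.ind_h (LinearMap.eqLocus ((LinearMap.proj j ∘ₗ W.iso.symm.toLinearMap) ∘ₗ T.actL x)
    (lmu A x ∘ₗ (LinearMap.proj j ∘ₗ W.iso.symm.toLinearMap))) (fun l a b u v hu hv => ?_) t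
  simp only [LinearMap.mem_eqLocus, LinearMap.comp_apply, LinearEquiv.coe_coe, ← T.actL_mul,
    Tw.symm_gen, LinearMap.proj_apply]
  by_cases h : j = l
  · subst h; simp [lmu_tmul]
  · simp [Pi.single_eq_of_ne h]

theorem Tw.kap_r {T : DGBimod A} (W : Tw T) (j : Fin W.s) (x : A.R) (t : T.M) :
    (LinearMap.proj j ∘ₗ W.iso.symm.toLinearMap) (T.actR x t) =
      rmu A x ((LinearMap.proj j ∘ₗ W.iso.symm.toLinearMap) t) := by
  refine W.ind_h (LinearMap.eqLocus ((LinearMap.proj j ∘ₗ W.iso.symm.toLinearMap) ∘ₗ T.actR x)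
    (rmu A x ∘ₗ (LinearMap.proj j ∘ₗ W.iso.symm.toLinearMap))) (fun l a b u v hu hv => ?_) t
  simp only [LinearMap.mem_eqLocus, LinearMap.comp_apply, LinearEquiv.coe_coe, ← T.actLR,
    ← T.actR_mul, Tw.symm_gen, LinearMap.proj_apply]
  by_cases h : j = l
  · subst h; simp [rmu_tmul]
  · simp [Pi.single_eq_of_ne h]

/-- coordinates of a twisted bimodule -/
def Tw.coo (hconc : ∀ i : ℤ, 0 < i → A.gr i = ⊥) {T : DGBimod A} (W : Tw T) : Coo (tg T) where
  s := W.s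
  q := W.q
  e := W.e
  κ := fun j => LinearMap.proj j ∘ₗ W.iso.symm.toLinearMap
  e_deg := W.e_deg
  κl := W.kap_l
  κr := W.kap_r
  κe := fun j => by simp [Tw.symm_e]
  κe0 := fun j l h => by simp [Tw.symm_e, Pi.single_eq_of_ne h]
  κs := fun t => by
    have := W.iso_apply (W.iso.symm t)
    rwa [LinearEquiv.apply_symm_apply] at this
  κdeg := fun j n t ht => by
    refine W.gm_le n ((ttGr (dT A) (dT A) (n - W.q j)).comap
      (LinearMap.proj j ∘ₗ W.iso.symm.toLinearMap)) (fun l a b u v hu hv e => ?_) ht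
    simp only [Submodule.mem_comap, LinearMap.comp_apply, LinearEquiv.coe_coe, Tw.symm_gen,
      LinearMap.proj_apply]
    by_cases h : j = l
    · subst h
      rw [Pi.single_eq_same]
      exact tmul_ttGr (Y := dT A) (X := dT A) (by omega) hu hv
    · rw [Pi.single_eq_of_ne h]; exact zero_mem _
  κ0 := fun j l h => by
    rcases h with h | h
    · refine mem_biSpan_of (W.tri l) (LinearMap.ker (LinearMap.proj j ∘ₗ W.iso.symm.toLinearMap))
        ?_ ?_ ?_
      · rintro _ ⟨i, hi, rfl⟩
        have hi' : i < l := hi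
        have hne : j ≠ i := fun e => absurd hi' (by rw [← e]; exact not_lt.2 h)
        simp [Tw.symm_e, Pi.single_eq_of_ne hne]
      · intro x t ht
        rw [LinearMap.mem_ker] at ht ⊢
        rw [W.kap_l, ht, map_zero]
      · intro x t ht
        rw [LinearMap.mem_ker] at ht ⊢
        rw [W.kap_r, ht, map_zero]
    · refine W.gm_le (W.q l + 1) (LinearMap.ker (LinearMap.proj j ∘ₗ W.iso.symm.toLinearMap))
        (fun l' a b u v hu hv e => ?_) (T.D_deg _ _ (W.e_deg l))
      simp only [LinearMap.mem_ker, LinearMap.comp_apply, LinearEquiv.coe_coe, Tw.symm_gen,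
        LinearMap.proj_apply]
      by_cases h' : j = l'
      · subst h'
        rw [Pi.single_eq_same]
        rcases lt_or_ge 0 a with ha | ha
        · rw [hconc a ha] at hu
          rw [(Submodule.mem_bot k).1 hu, TensorProduct.zero_tmul]
        · rw [hconc b (by omega)] at hv
          rw [(Submodule.mem_bot k).1 hv, TensorProduct.tmul_zero]
      · rw [Pi.single_eq_of_ne h']

theorem main_gen (hconc : ∀ i : ℤ, 0 < i → A.gr i = ⊥) {Y : Tgt A} (hY : SgnOK Y) {P : DGBimod A}
    {X : Tgt A} (hX : SgnOK X) (C : Coo X) {m : ℤ} (hm : 0 < m)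
    (nul : ∀ m : ℤ, 0 < m → ∀ g, IsMor (tg P) (Sh m (TT Y (dT A) hY)) g →
      Null (tg P) (Sh m (TT Y (dT A) hY)) g)
    {Λ : X.M →ₗ[k] A.R} (hΛ : IsMor X (dT A) Λ) (Λl : ∀ x t, Λ (X.L x t) = x * Λ t)
    {f : P.M →ₗ[k] Y.M} {g : P.M →ₗ[k] (QQ Y X hY hX).M}
    (hg : IsMor (tg P) (Sh m (QQ Y X hY hX)) g)
    (hfg : Null (tg P) (Sh m Y) (f - phi hY hX Λ Λl ∘ₗ g)) : Null (tg P) (Sh m Y) f := by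
  have cD : ∀ j u, C.c hY hX j ((QQ Y X hY hX).D (C.i hY hX j u)) =
      sgnk k (C.q j) • (TT Y (dT A) hY).D u := fun j u => by
    rw [C.cDi hY hX j j (C.κ0 j j (Or.inl le_rfl)), C.ci]
  have cD0 : ∀ j l u, l < j ∨ (j ≠ l ∧ C.q j < C.q l + 1) →
      C.c hY hX j ((QQ Y X hY hX).D (C.i hY hX l u)) = 0 := fun j l u h => by
    have hne : j ≠ l := by
      rcases h with h | h
      · exact ne_of_gt h
      · exact h.1
    have hk : C.κ j (X.D (C.e l)) = 0 := C.κ0 j l (h.imp le_of_lt And.right)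
    rw [C.cDi hY hX j l hk, C.ci0 hY hX j l _ hne, smul_zero]
  obtain ⟨g', h1, h2⟩ := devis C.q (C.c hY hX) (C.i hY hX) (C.ci hY hX)
    (fun j l u h => C.ci0 hY hX j l u h) (C.ic hY hX) (C.cdeg hY hX) (C.ideg hY hX) (C.cl hY hX)
    (C.cr hY hX) (C.il hY hX) (C.ir hY hX) cD cD0 nul hm hg
  have h3 : ∀ p, phi hY hX Λ Λl (g' p) = 0 := by
    intro p
    rw [C.ic hY hX (g' p), map_sum]
    refine Finset.sum_eq_zero fun j _ => ?_
    by_cases hq : C.q j ≤ 0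
    · rw [h2 j hq p, map_zero, map_zero]
    · refine C.phi_i hY hX j Λ Λl hΛ.r ?_ _
      have := hΛ.deg _ _ (C.e_deg j)
      change Λ (C.e j) ∈ A.gr (C.q j) at this
      rw [hconc _ (not_le.1 hq)] at this
      exact (Submodule.mem_bot k).1 this
  have h4 := ((phi_mor (hY := hY) (hX := hX) hΛ Λl).sh m).compNull h1
  have h5 := hfg.add h4
  have e : f = (f - phi hY hX Λ Λl ∘ₗ g) + phi hY hX Λ Λl ∘ₗ (g - g') := by
    ext p
    simp [h3 p]
  rw [e]; exact h5

theorem main_null (hconc : ∀ i : ℤ, 0 < i → A.gr i = ⊥) (hc : IsCompactAlg A) {P : DGBimod A}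
    {T : DGBimod A} (W : Tw T) {ι : P.M →ₗ[k] T.M} {ρ : T.M →ₗ[k] P.M}
    (hι : IsMor (tg P) (tg T) ι) (hρ : IsMor (tg T) (tg P) ρ)
    (hn : Null (tg P) (tg P) (ρ ∘ₗ ι - LinearMap.id)) (hP : Proj P) {F : P.M →ₗ[k] A.R}
    (hF : IsMor (tg P) (dT A) F) (hq : QI (tg P) (dT A) F) {m : ℤ} (hm : 0 < m)
    {f : P.M →ₗ[k] (Adual A).M}
    (hf : IsMor (tg P) (Sh m (Adual A)) f) : Null (tg P) (Sh m (Adual A)) f := by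
  obtain ⟨s0, h0, hD, w, hw, hs⟩ := hq.surj 0 (1 : A.R) A.one_mem d_one
  have h1 : w ∈ A.gr (-1) := hw
  have hs' : F s0 = 1 + A.d w := by
    have : F s0 - 1 = A.d w := hs
    rw [← this]; abel
  have hΛ : IsMor (tg T) (dT A) (F ∘ₗ ρ) := hF.comp hρ
  obtain ⟨g, hg, hfg⟩ := lift_P Adual_ok hP hF hq h0 hD h1 hs' (tg_ok T) hι hρ hn hf (F ∘ₗ ρ) rfl
    hΛ.l
  exact main_gen hconc Adual_ok (tg_ok T) (W.coo hconc) hm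
    (fun m hm g hg => N1_null hconc hc hP hF hq h0 hD h1 hs' hm hg) hΛ hΛ.l hg hfg

theorem fin_thm {k : Type} [Field k] (A : DGAlgebra k)
    (hconc : ∀ i : ℤ, 0 < i → A.gr i = ⊥)
    (hc : IsCompactAlg A) (hs : IsSmooth A)
    (P : DGBimod A) (F : BimodHom P (diagBimod A)) (hPF : IsDiagResolution P F) :
    ∀ n : ℤ, n ≠ 0 → Subsingleton (HHspace P n) := by
  intro n hn
  obtain ⟨T, W, ι, ρ, hι, hρ, hnul, hP, f, hf, hq⟩ := smooth_data hs P F hPF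
  rcases lt_or_gt_of_ne hn with h | h
  · obtain ⟨m, rfl⟩ : ∃ m, n = -m := ⟨-n, by ring⟩
    exact HH_neg m fun g hg => main_null hconc hc W hι hρ hnul hP hf hq (by omega) hg
  · exact HH_pos hconc P f hf hq hP n h

end

/-- If `A` is a compact homologically smooth DG algebra
concentrated in non-positive degrees, then `HH_n(A) = 0` for all `n ≠ 0`.
Hochschild homology is computed from any h-projective bimodule resolution
`F : P → A` of the diagonal. -/
theorem hochschild_concentrated_in_degree_zero {k : Type} [Field k] (A : DGAlgebra k)
    (hconc : ∀ i : ℤ, 0 < i → A.gr i = ⊥)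
    (hc : IsCompactAlg A) (hs : IsSmooth A)
    (P : DGBimod A) (F : BimodHom P (diagBimod A)) (hPF : IsDiagResolution P F) :
    ∀ n : ℤ, n ≠ 0 → Subsingleton (HHspace P n) := by
  exact fin_thm A hconc hc hs P F hPF
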